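/- arXiv:2102.00303 — 4 statements merged into one kernel-verified Lean document; each statement's English description precedes it below -/
import Mathlib

section
/- There is an absolute constant C such that the following holds. Let x ≥ 3 and (log x)^{1.1} ≤ y ≤ x^{1/3}, let q ≥ 1 be an integer, δ ∈ ℝ, L = 2(1 + |δx|), let j be an integer with 0 ≤ j ≤ (log y)/(log 2), and let p be a prime dividing q. Then, summing over ordered pairs (n₁, n₂) of positive y-smooth integers n₁, n₂ ≤ x/(2^j qLy) with n₁ ≡ n₂ (mod q/p), one has Σ min{ 2^{j+1}qLy, 1/|(n₁ − n₂)δ| } ≤ C·( p·2^j·y·Ψ(x/(2^j qLy), y)²·(qL/p)^{1−α(x,y)}·(log x)·(log L) + 2^j·qLy²·Ψ(x/(2^j qLy), y) ), where the minimum is interpreted as 2^{j+1}qLy whenever (n₁ − n₂)δ = 0. -/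
open scoped Classical

noncomputable section

/-- `n` is `y`-smooth: every prime factor of `n` is at most `y`. -/
def IsSmooth (y : ℝ) (n : ℕ) : Prop := ∀ p : ℕ, p.Prime → p ∣ n → (p : ℝ) ≤ y

/-- `Ψ(X, y)`: the number of `y`-smooth integers `n` with `1 ≤ n ≤ X`. -/
def Psi (X y : ℝ) : ℕ := Nat.card {n : ℕ | 1 ≤ n ∧ (n : ℝ) ≤ X ∧ IsSmooth y n}

/-- `e(t) = exp(2πit)`. -/
def e2pi (t : ℝ) : ℂ := Complex.exp (2 * Real.pi * Complex.I * t)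

/-- `alphaEq x y a` says `a` solves `∑_{p ≤ y prime} log p / (p^a - 1) = log x`,
i.e. `a = α(x, y)`. -/
def alphaEq (x y a : ℝ) : Prop :=
  ∑ p ∈ (Finset.range (⌊y⌋₊ + 1)).filter Nat.Prime,
    Real.log p / ((p : ℝ) ^ a - 1) = Real.log x

section SmoothSums

open Finset

/-- The `y`-smooth positive integers up to `X`. -/
def smoothUpTo (X y : ℝ) : Finset ℕ := (Finset.Icc 1 ⌊X⌋₊).filter (IsSmooth y)

/-- The primes up to `y`. -/
def primesUpTo (y : ℝ) : Finset ℕ := (Finset.range (⌊y⌋₊ + 1)).filter Nat.Prime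

/-- The function `s ↦ ∑_{p ≤ y} log p / (p ^ s - 1)` whose value at `α(x, y)` is `log x`. -/
def smoothLogDeriv (y s : ℝ) : ℝ := ∑ p ∈ primesUpTo y, Real.log p / ((p : ℝ) ^ s - 1)

/-- The Euler product `∏_{p ≤ y} (1 - p ^ (-s))⁻¹`. -/
def smoothZeta (y s : ℝ) : ℝ := ∏ p ∈ primesUpTo y, (1 - (p : ℝ) ^ (-s))⁻¹

lemma mem_smoothUpTo {X y : ℝ} {n : ℕ} :
    n ∈ smoothUpTo X y ↔ 1 ≤ n ∧ (n : ℝ) ≤ X ∧ IsSmooth y n := by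
  simp only [smoothUpTo, mem_filter, mem_Icc]
  constructor
  · rintro ⟨⟨h1, h2⟩, h3⟩
    exact ⟨h1, (Nat.le_floor_iff' (by omega)).1 h2, h3⟩
  · rintro ⟨h1, h2, h3⟩
    exact ⟨⟨h1, (Nat.le_floor_iff' (by omega)).2 h2⟩, h3⟩

lemma mem_primesUpTo {y : ℝ} {p : ℕ} : p ∈ primesUpTo y ↔ p.Prime ∧ (p : ℝ) ≤ y := by
  simp only [primesUpTo, mem_filter, mem_range, Nat.lt_succ_iff]
  constructor
  · rintro ⟨h1, h2⟩
    exact ⟨h2, (Nat.le_floor_iff' h2.ne_zero).1 h1⟩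
  · rintro ⟨h1, h2⟩
    exact ⟨(Nat.le_floor_iff' h1.ne_zero).2 h2, h1⟩

lemma Psi_eq_card (X y : ℝ) : Psi X y = (smoothUpTo X y).card := by
  rw [Psi, Nat.card_coe_set_eq, ← Set.ncard_coe_finset]
  congr 1
  ext n
  simp [mem_smoothUpTo]

lemma smoothUpTo_mono {X X' y : ℝ} (h : X ≤ X') : smoothUpTo X y ⊆ smoothUpTo X' y := by
  intro n hn
  rw [mem_smoothUpTo] at hn ⊢
  exact ⟨hn.1, hn.2.1.trans h, hn.2.2⟩

lemma Psi_mono {X X' y : ℝ} (h : X ≤ X') : (Psi X y : ℝ) ≤ Psi X' y := by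
  rw [Psi_eq_card, Psi_eq_card]
  exact_mod_cast card_le_card (smoothUpTo_mono h)

lemma IsSmooth.mul {y : ℝ} {m n : ℕ} (hm : IsSmooth y m) (hn : IsSmooth y n) :
    IsSmooth y (m * n) := fun p hp h => ((hp.dvd_mul).1 h).elim (hm p hp) (hn p hp)

lemma IsSmooth.of_dvd {y : ℝ} {m n : ℕ} (hn : IsSmooth y n) (h : m ∣ n) : IsSmooth y m :=
  fun p hp hpm => hn p hp (hpm.trans h)

lemma isSmooth_prime {y : ℝ} {p : ℕ} (hp : p ∈ primesUpTo y) : IsSmooth y p := by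
  rw [mem_primesUpTo] at hp
  intro q hq h
  rw [(Nat.prime_dvd_prime_iff_eq hq hp.1).1 h]
  exact hp.2

lemma IsSmooth.pow {y : ℝ} {m : ℕ} (hm : IsSmooth y m) (k : ℕ) : IsSmooth y (m ^ k) :=
  fun p hp h => hm p hp (hp.dvd_of_dvd_pow h)

/-- Double counting of pairs `(l, d)` with `l * d ≤ X`. -/
lemma sum_smoothUpTo_mul (X y : ℝ) (D : Finset ℕ) (hD : ∀ d ∈ D, 1 ≤ d ∧ IsSmooth y d)
    (F g : ℕ → ℝ) :
    ∑ l ∈ smoothUpTo X y, ∑ d ∈ D with (l * d : ℕ) ≤ X, F (l * d) * g d =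
      ∑ n ∈ smoothUpTo X y, F n * ∑ d ∈ D with d ∣ n, g d := by
  simp_rw [mul_sum]
  rw [sum_sigma', sum_sigma']
  refine sum_bij' (fun a _ => ⟨a.1 * a.2, a.2⟩) (fun b _ => ⟨b.1 / b.2, b.2⟩) ?_ ?_ ?_ ?_ ?_
  · rintro ⟨l, d⟩ h
    simp only [mem_sigma, mem_filter, mem_smoothUpTo] at h ⊢
    obtain ⟨⟨h1, h2, h3⟩, h4, h5⟩ := h
    exact ⟨⟨Nat.mul_pos h1 (hD d h4).1, h5, h3.mul (hD d h4).2⟩, h4, Dvd.intro_left l rfl⟩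
  · rintro ⟨n, d⟩ h
    simp only [mem_sigma, mem_filter, mem_smoothUpTo] at h ⊢
    obtain ⟨⟨h1, h2, h3⟩, h4, c, rfl⟩ := h
    have hd := (hD d h4).1
    rw [Nat.mul_div_cancel_left c (by omega)]
    have hc : 1 ≤ c := Nat.pos_of_ne_zero (by rintro rfl; simp at h1)
    refine ⟨⟨hc, le_trans ?_ h2, h3.of_dvd (Dvd.intro_left d rfl)⟩, h4, by rwa [mul_comm]⟩
    exact_mod_cast Nat.le_mul_of_pos_left c hd
  · rintro ⟨l, d⟩ h
    simp only [mem_sigma, mem_filter] at h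
    have hd := (hD d h.2.1).1
    simp [Nat.mul_div_cancel l (show 0 < d by omega)]
  · rintro ⟨n, d⟩ h
    simp only [mem_sigma, mem_filter] at h
    simp [Nat.div_mul_cancel h.2.2]
  · rintro ⟨l, d⟩ h
    rfl

lemma theta_eq_sum_primesUpTo (t : ℝ) : Chebyshev.theta t = ∑ p ∈ primesUpTo t, Real.log p := by
  rw [Chebyshev.theta]
  refine sum_congr ?_ fun _ _ => rfl
  ext p
  simp only [mem_filter, mem_Ioc, primesUpTo, mem_range, Nat.lt_succ_iff]
  exact ⟨fun h => ⟨h.1.2, h.2⟩, fun h => ⟨⟨h.2.pos, h.1⟩, h.2⟩⟩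

/-- `Λ` summed against the smooth divisors of a smooth number. -/
lemma sum_vonMangoldt_dvd {X y : ℝ} {n : ℕ} (hn : n ∈ smoothUpTo X y) :
    ∑ d ∈ smoothUpTo X y with d ∣ n, ArithmeticFunction.vonMangoldt d = Real.log n := by
  rw [← ArithmeticFunction.vonMangoldt_sum]
  rw [mem_smoothUpTo] at hn
  refine sum_congr ?_ fun _ _ => rfl
  ext d
  simp only [mem_filter, mem_smoothUpTo, Nat.mem_divisors]
  constructor
  · rintro ⟨-, h⟩
    exact ⟨h, by omega⟩
  · rintro ⟨h, -⟩
    have h1 : d ≤ n := Nat.le_of_dvd (by omega) h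
    exact ⟨⟨Nat.pos_of_dvd_of_pos h (by omega), le_trans (by exact_mod_cast h1) hn.2.1,
      hn.2.2.of_dvd h⟩, h⟩

lemma mul_le_iff_mem_smoothUpTo {X y : ℝ} {l d : ℕ} (hl : 1 ≤ l) (hd : 1 ≤ d ∧ IsSmooth y d) :
    ((l * d : ℕ) : ℝ) ≤ X ↔ d ∈ smoothUpTo (X / l) y := by
  have : (0 : ℝ) < l := by exact_mod_cast hl
  rw [mem_smoothUpTo, le_div_iff₀ this, Nat.cast_mul, mul_comm]
  tauto

lemma filter_mul_le_smoothUpTo {X y : ℝ} {l : ℕ} (hl : 1 ≤ l) :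
    (smoothUpTo X y).filter (fun d => ((l * d : ℕ) : ℝ) ≤ X) = smoothUpTo (X / l) y := by
  have hl0 : (1 : ℝ) ≤ l := by exact_mod_cast hl
  ext d
  rw [mem_filter]
  constructor
  · rintro ⟨h1, h2⟩
    have := mem_smoothUpTo.1 h1
    exact (mul_le_iff_mem_smoothUpTo hl ⟨this.1, this.2.2⟩).1 h2
  · intro h
    have h' := mem_smoothUpTo.1 h
    have h2 := (mul_le_iff_mem_smoothUpTo hl ⟨h'.1, h'.2.2⟩).2 h
    refine ⟨mem_smoothUpTo.2 ⟨h'.1, ?_, h'.2.2⟩, h2⟩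
    refine le_trans ?_ h2
    exact_mod_cast Nat.le_mul_of_pos_left d hl

/-- The convolution identity `log = Λ * 1` summed over smooth numbers with a weight. -/
lemma sum_mul_log_eq (X y : ℝ) (F : ℕ → ℝ) :
    ∑ n ∈ smoothUpTo X y, F n * Real.log n =
      ∑ l ∈ smoothUpTo X y, ∑ d ∈ smoothUpTo (X / l) y,
        F (l * d) * ArithmeticFunction.vonMangoldt d := by
  have h := sum_smoothUpTo_mul X y (smoothUpTo X y)
    (fun d hd => ⟨(mem_smoothUpTo.1 hd).1, (mem_smoothUpTo.1 hd).2.2⟩) F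
    ArithmeticFunction.vonMangoldt
  rw [sum_congr rfl fun n hn => by rw [← sum_vonMangoldt_dvd hn], ← h]
  refine sum_congr rfl fun l hl => ?_
  rw [filter_mul_le_smoothUpTo (mem_smoothUpTo.1 hl).1]

lemma sum_log_le (X y : ℝ) :
    ∑ n ∈ smoothUpTo X y, Real.log n ≤ Psi X y * Real.log X := by
  rw [Psi_eq_card, ← nsmul_eq_mul]
  refine sum_le_card_nsmul _ _ _ fun n hn => ?_
  have := mem_smoothUpTo.1 hn
  exact Real.log_le_log (by exact_mod_cast this.1) this.2.1

/-- `Ψ(X) log X ≥ ∑_d Λ(d) Ψ(X / d)`. -/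
lemma sum_vonMangoldt_mul_Psi_le (X y : ℝ) :
    ∑ d ∈ smoothUpTo X y, ArithmeticFunction.vonMangoldt d * Psi (X / d) y ≤
      Psi X y * Real.log X := by
  refine le_trans (le_of_eq ?_) (sum_log_le X y)
  have h := sum_mul_log_eq X y (fun _ => 1)
  simp only [one_mul] at h
  rw [h, sum_sigma', sum_congr rfl fun d _ => by rw [Psi_eq_card, mul_comm, ← nsmul_eq_mul,
    ← sum_const], sum_sigma']
  refine sum_bij' (fun a _ => ⟨a.2, a.1⟩) (fun a _ => ⟨a.2, a.1⟩) ?_ ?_ ?_ ?_ ?_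
  · rintro ⟨d, l⟩ h
    rw [mem_sigma] at h ⊢
    dsimp at h ⊢
    rw [← filter_mul_le_smoothUpTo (mem_smoothUpTo.1 h.1).1, mem_filter] at h
    exact ⟨h.2.1, by
      rw [← filter_mul_le_smoothUpTo (mem_smoothUpTo.1 h.2.1).1, mem_filter, mul_comm]
      exact ⟨h.1, h.2.2⟩⟩
  · rintro ⟨d, l⟩ h
    rw [mem_sigma] at h ⊢
    dsimp at h ⊢
    rw [← filter_mul_le_smoothUpTo (mem_smoothUpTo.1 h.1).1, mem_filter] at h
    exact ⟨h.2.1, by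
      rw [← filter_mul_le_smoothUpTo (mem_smoothUpTo.1 h.2.1).1, mem_filter, mul_comm]
      exact ⟨h.1, h.2.2⟩⟩
  · rintro ⟨d, l⟩ h; rfl
  · rintro ⟨d, l⟩ h; rfl
  · rintro ⟨d, l⟩ h; rfl

lemma sum_log_primes_dvd_le {n : ℕ} (hn : 1 ≤ n) (y : ℝ) :
    ∑ p ∈ primesUpTo y with p ∣ n, Real.log p ≤ Real.log n := by
  rw [← ArithmeticFunction.vonMangoldt_sum]
  calc _ = ∑ p ∈ primesUpTo y with p ∣ n, ArithmeticFunction.vonMangoldt p := by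
        refine sum_congr rfl fun p hp => ?_
        rw [ArithmeticFunction.vonMangoldt_apply_prime (mem_primesUpTo.1 (mem_filter.1 hp).1).1]
    _ ≤ _ := by
        refine sum_le_sum_of_subset_of_nonneg ?_
          fun _ _ _ => ArithmeticFunction.vonMangoldt_nonneg
        intro p hp
        rw [mem_filter] at hp
        exact Nat.mem_divisors.2 ⟨hp.2, by omega⟩

/-- `∑_l θ(min(y, X / l)) ≤ Ψ(X) log X`. -/
lemma sum_theta_min_le (X y : ℝ) :
    ∑ l ∈ smoothUpTo X y, Chebyshev.theta (min y (X / l)) ≤ Psi X y * Real.log X := by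
  refine le_trans (le_of_eq ?_) ((sum_le_sum (f := fun n : ℕ =>
    1 * ∑ p ∈ primesUpTo y with p ∣ n, Real.log p) (g := fun n : ℕ => Real.log n)
    fun n hn => ?_).trans (sum_log_le X y))
  · rw [← sum_smoothUpTo_mul X y (primesUpTo y)
      (fun p hp => ⟨(mem_primesUpTo.1 hp).1.one_le, isSmooth_prime hp⟩) (fun _ => 1)
      (fun p => Real.log p)]
    refine sum_congr rfl fun l hl => ?_
    have hl0 : (0 : ℝ) < l := by exact_mod_cast (mem_smoothUpTo.1 hl).1
    simp only [one_mul]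
    rw [theta_eq_sum_primesUpTo]
    refine sum_congr ?_ fun _ _ => rfl
    ext p
    simp only [mem_filter, mem_primesUpTo, le_min_iff, le_div_iff₀ hl0, Nat.cast_mul]
    rw [mul_comm (p : ℝ)]
    tauto
  · rw [one_mul]
    exact sum_log_primes_dvd_le (mem_smoothUpTo.1 hn).1 y

/-- Chebyshev's lower bound for `θ`. -/
lemma exists_mul_le_theta :
    ∃ c : ℝ, 0 < c ∧ c ≤ 1 ∧ ∀ t : ℝ, 2 ≤ t → c * t ≤ Chebyshev.theta t := by
  have h1 : (fun t : ℝ => Real.log (t + 2)) =o[Filter.atTop] (fun t : ℝ => t) := by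
    have h := Real.isLittleO_log_id_atTop.comp_tendsto
      (Filter.tendsto_atTop_add_const_right Filter.atTop (2 : ℝ) Filter.tendsto_id)
    refine h.trans_isBigO ?_
    refine Asymptotics.IsBigO.of_bound 2 ?_
    filter_upwards [Filter.eventually_ge_atTop 2] with t ht
    simp only [Function.comp, id, Real.norm_eq_abs]
    rw [abs_of_nonneg (by linarith), abs_of_nonneg (by linarith)]
    linarith
  have h2 : (fun t : ℝ => √t * Real.log t) =o[Filter.atTop] (fun t : ℝ => t) := by
    have h := (isLittleO_log_rpow_atTop (show (0 : ℝ) < 1 / 2 by norm_num))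
    have h3 := (Asymptotics.isBigO_refl (fun t : ℝ => √t) Filter.atTop).mul_isLittleO h
    refine h3.congr' (Filter.EventuallyEq.rfl) ?_
    filter_upwards [Filter.eventually_ge_atTop 0] with t ht
    rw [← Real.sqrt_eq_rpow, Real.mul_self_sqrt ht]
  have h1' := h1.bound (show (0 : ℝ) < 1 / 20 by norm_num)
  have h2' := h2.bound (show (0 : ℝ) < 1 / 20 by norm_num)
  obtain ⟨t0, ht0⟩ := Filter.eventually_atTop.1 (h1'.and h2')
  have hlog2 := Real.log_two_gt_d9
  set M := max t0 100 with hM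
  have hM0 : 0 < M := lt_of_lt_of_le (by norm_num) (le_max_right _ _)
  refine ⟨min (1 / 4) (Real.log 2 / M), lt_min (by norm_num) (by positivity),
    (min_le_left _ _).trans (by norm_num), fun t ht => ?_⟩
  rcases le_total t M with h | h
  · calc min (1 / 4) (Real.log 2 / M) * t ≤ Real.log 2 / M * M := by
          gcongr
          exact min_le_right _ _
      _ = Real.log 2 := by field_simp
      _ = Chebyshev.theta 2 := by
          rw [theta_eq_sum_primesUpTo]
          have : primesUpTo 2 = {2} := by
            ext p
            simp only [mem_primesUpTo, mem_singleton]
            constructor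
            · rintro ⟨h1, h2⟩
              exact le_antisymm (by exact_mod_cast h2) h1.two_le
            · rintro rfl
              exact ⟨Nat.prime_two, by norm_num⟩
          rw [this, sum_singleton]
          norm_num
      _ ≤ _ := Chebyshev.theta_mono ht
  · obtain ⟨h3, h4⟩ := ht0 t ((le_max_left _ _).trans h)
    have h100 : 100 ≤ t := (le_max_right _ _).trans h
    have h5 := Chebyshev.theta_ge' (x := t) (by linarith)
    simp only [Real.norm_eq_abs] at h3 h4
    rw [abs_of_nonneg (by linarith : (0 : ℝ) ≤ t)] at h3 h4
    have h6 := (le_abs_self _).trans h3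
    have h7 := (le_abs_self _).trans h4
    have h8 : min (1 / 4) (Real.log 2 / M) * t ≤ 1 / 4 * t := by
      gcongr
      exact min_le_left _ _
    nlinarith

lemma theta_le_two_mul {t : ℝ} (ht : 0 ≤ t) : Chebyshev.theta t ≤ 2 * t := by
  refine (Chebyshev.theta_le_log4_mul_x ht).trans ?_
  have : Real.log 4 = 2 * Real.log 2 := by
    rw [show (4 : ℝ) = 2 ^ 2 by norm_num, Real.log_pow]; norm_num
  have := Real.log_two_lt_d9
  gcongr
  linarith

/-- The primes in the interval `(a, b]`. -/
def primesBetween (a b : ℝ) : Finset ℕ := (primesUpTo b).filter (fun p : ℕ => a < p)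

lemma mem_primesBetween {a b : ℝ} {p : ℕ} :
    p ∈ primesBetween a b ↔ p.Prime ∧ a < p ∧ (p : ℝ) ≤ b := by
  rw [primesBetween, mem_filter, mem_primesUpTo]; tauto

lemma primesBetween_subset_primesUpTo {a b y : ℝ} (h : b ≤ y) :
    primesBetween a b ⊆ primesUpTo y := fun p hp => by
  rw [mem_primesBetween] at hp
  exact mem_primesUpTo.2 ⟨hp.1, hp.2.2.trans h⟩

lemma sum_primesBetween_add {a b d : ℝ} (hab : a ≤ b) (hbd : b ≤ d) (f : ℕ → ℝ) :
    ∑ p ∈ primesBetween a b, f p + ∑ p ∈ primesBetween b d, f p =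
      ∑ p ∈ primesBetween a d, f p := by
  rw [← sum_union]
  · refine sum_congr ?_ fun _ _ => rfl
    ext p
    simp only [mem_union, mem_primesBetween]
    constructor
    · rintro (h | h)
      · exact ⟨h.1, h.2.1, h.2.2.trans hbd⟩
      · exact ⟨h.1, hab.trans_lt h.2.1, h.2.2⟩
    · rintro h
      rcases le_or_gt (p : ℝ) b with h' | h'
      · exact Or.inl ⟨h.1, h.2.1, h'⟩
      · exact Or.inr ⟨h.1, h', h.2.2⟩
  · rw [disjoint_left]
    intro p hp hp'
    rw [mem_primesBetween] at hp hp'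
    exact absurd hp'.2.1 (not_lt.2 hp.2.2)

lemma primesBetween_eq_primesUpTo {a b : ℝ} (ha : a < 2) : primesBetween a b = primesUpTo b := by
  refine filter_true_of_mem fun p hp => ha.trans_le ?_
  exact_mod_cast (mem_primesUpTo.1 hp).1.two_le

lemma exists_block_lower : ∃ A c : ℝ, 2 ≤ A ∧ 0 < c ∧ ∀ z : ℝ, 2 ≤ z →
    c * z ≤ ∑ p ∈ primesBetween (z / A) z, Real.log p := by
  obtain ⟨c, hc, hc1, h⟩ := exists_mul_le_theta
  refine ⟨4 / c, c / 2, ?_, by positivity, fun z hz => ?_⟩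
  · rw [le_div_iff₀ hc]; linarith
  · have hz0 : 0 ≤ z := by linarith
    have e : z / (4 / c) = c * z / 4 := by field_simp
    have h1 := sum_primesBetween_add (a := 0) (b := z / (4 / c)) (d := z) (by positivity)
      (by rw [e]; nlinarith) (fun p => Real.log p)
    rw [primesBetween_eq_primesUpTo (a := 0) (by norm_num),
      primesBetween_eq_primesUpTo (a := 0) (by norm_num),
      ← theta_eq_sum_primesUpTo, ← theta_eq_sum_primesUpTo] at h1
    have h2 := h z hz
    have h3 := theta_le_two_mul (t := z / (4 / c)) (by positivity)
    have h4 : 2 * (z / (4 / c)) = c * z / 2 := by rw [e]; ring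
    linarith

lemma sum_primesBetween_log_le {a z : ℝ} (hz : 0 ≤ z) :
    ∑ p ∈ primesBetween a z, Real.log p ≤ 2 * z := by
  refine le_trans ?_ (theta_le_two_mul hz)
  rw [theta_eq_sum_primesUpTo]
  refine sum_le_sum_of_subset_of_nonneg (filter_subset _ _) fun p hp _ => ?_
  exact Real.log_natCast_nonneg p

lemma block_rpow_identity {A z s : ℝ} (hA : 0 < A) (hz : 0 < z) (n : ℕ) :
    (z / A ^ n) ^ (1 - s) = z ^ (1 - s) * (A ^ (s - 1)) ^ n := by
  rw [Real.div_rpow hz.le (by positivity), div_eq_mul_inv, ← Real.rpow_natCast,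
    ← Real.rpow_natCast (A ^ (s - 1)), ← Real.rpow_mul hA.le, ← Real.rpow_mul hA.le,
    ← Real.rpow_neg hA.le]
  congr 2; ring

lemma block_rpow_le {a z s : ℝ} (ha : 0 < a) (hs0 : 0 ≤ s) :
    z ^ (-s) * ∑ p ∈ primesBetween a z, Real.log p ≤
        ∑ p ∈ primesBetween a z, Real.log p * (p : ℝ) ^ (-s) ∧
    ∑ p ∈ primesBetween a z, Real.log p * (p : ℝ) ^ (-s) ≤
        a ^ (-s) * ∑ p ∈ primesBetween a z, Real.log p := by
  constructor <;> rw [mul_sum] <;> refine sum_le_sum fun p hp => ?_ <;>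
    rw [mem_primesBetween] at hp <;> have hl := Real.log_natCast_nonneg p
  · rw [mul_comm]
    exact mul_le_mul_of_nonneg_left
      (Real.rpow_le_rpow_of_nonpos (ha.trans hp.2.1) hp.2.2 (by linarith)) hl
  · rw [mul_comm (a ^ (-s))]
    exact mul_le_mul_of_nonneg_left
      (Real.rpow_le_rpow_of_nonpos ha hp.2.1.le (by linarith)) hl

lemma blocks_lower {A c : ℝ} (hA : 2 ≤ A)
    (hb : ∀ z : ℝ, 2 ≤ z → c * z ≤ ∑ p ∈ primesBetween (z / A) z, Real.log p)
    {s z : ℝ} (hs0 : 0 ≤ s) (n : ℕ) (hz : A ^ n ≤ z) :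
    c * z ^ (1 - s) * ∑ i ∈ range n, (A ^ (s - 1)) ^ i ≤
      ∑ p ∈ primesBetween (z / A ^ n) z, Real.log p * (p : ℝ) ^ (-s) := by
  have hA0 : 0 < A := by linarith
  induction n with
  | zero =>
    simp only [range_zero, sum_empty, mul_zero]
    exact sum_nonneg fun p _ => mul_nonneg (Real.log_natCast_nonneg p) (by positivity)
  | succ n ih =>
    have hz0 : 0 < z := lt_of_lt_of_le (by positivity) hz
    have hAn : A ^ n * A ≤ z := by rwa [← pow_succ]
    have ih := ih (le_trans (by nlinarith [pow_pos hA0 n]) hAn)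
    have h2 : 2 ≤ z / A ^ n := by
      rw [le_div_iff₀ (by positivity)]; nlinarith [pow_pos hA0 n]
    have e : z / A ^ n / A = z / A ^ (n + 1) := by rw [pow_succ, div_div]
    have hw : 0 < z / A ^ n := by linarith
    have h3 := (block_rpow_le (a := z / A ^ n / A) (z := z / A ^ n) (by positivity) hs0).1
    have h4 := mul_le_mul_of_nonneg_left (hb _ h2) (Real.rpow_nonneg hw.le (-s))
    have h5 : (z / A ^ n) ^ (-s) * (c * (z / A ^ n)) = c * (z ^ (1 - s) * (A ^ (s - 1)) ^ n) := by
      rw [← block_rpow_identity hA0 hz0, show 1 - s = -s + 1 by ring, Real.rpow_add hw,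
        Real.rpow_one]; ring
    rw [sum_range_succ, mul_add, ← sum_primesBetween_add (a := z / A ^ (n + 1)) (b := z / A ^ n)
      (by rw [← e]; exact div_le_self hw.le (by linarith))
      (div_le_self hz0.le (one_le_pow₀ (by linarith)))]
    rw [e] at h3 h4
    linarith

lemma blocks_upper {A : ℝ} (hA : 2 ≤ A) {s z : ℝ} (hs0 : 0 ≤ s) (hs1 : s ≤ 1) (n : ℕ)
    (hz : 0 < z) :
    ∑ p ∈ primesBetween (z / A ^ n) z, Real.log p * (p : ℝ) ^ (-s) ≤
      2 * A * z ^ (1 - s) * ∑ i ∈ range n, (A ^ (s - 1)) ^ i := by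
  have hA0 : 0 < A := by linarith
  induction n with
  | zero =>
    simp only [range_zero, sum_empty, mul_zero, pow_zero, div_one]
    refine le_of_eq (sum_eq_zero fun p hp => ?_)
    rw [mem_primesBetween] at hp
    linarith [hp.2.1, hp.2.2]
  | succ n ih =>
    have hw : 0 < z / A ^ n := by positivity
    have e : z / A ^ n / A = z / A ^ (n + 1) := by rw [pow_succ, div_div]
    have h3 := (block_rpow_le (a := z / A ^ n / A) (z := z / A ^ n) (by positivity) hs0).2
    have h4 := mul_le_mul_of_nonneg_left (sum_primesBetween_log_le (a := z / A ^ n / A) hw.le)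
      (Real.rpow_nonneg (div_pos hw hA0).le (-s))
    have h5 : (z / A ^ n / A) ^ (-s) * (2 * (z / A ^ n)) ≤
        2 * A * (z ^ (1 - s) * (A ^ (s - 1)) ^ n) := by
      rw [← block_rpow_identity hA0 hz, show 1 - s = -s + 1 by ring, Real.rpow_add hw,
        Real.rpow_one, Real.div_rpow hw.le hA0.le, Real.rpow_neg hA0.le, div_inv_eq_mul]
      have : A ^ s ≤ A := by
        simpa using Real.rpow_le_rpow_of_exponent_le (show 1 ≤ A by linarith) hs1
      have h6 : 0 ≤ (z / A ^ n) ^ (-s) * (z / A ^ n) := by positivity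
      nlinarith
    rw [sum_range_succ, mul_add, ← sum_primesBetween_add (a := z / A ^ (n + 1)) (b := z / A ^ n)
      (by rw [← e]; exact div_le_self hw.le (by linarith))
      (div_le_self hz.le (one_le_pow₀ (by linarith)))]
    rw [e] at h3 h4 h5
    linarith

lemma geom_add_le {r : ℝ} (h0 : 0 ≤ r) (h1 : r ≤ 1) (m n : ℕ) :
    ∑ i ∈ range (m + n), r ^ i ≤ ∑ i ∈ range m, r ^ i + ∑ i ∈ range n, r ^ i := by
  rw [sum_range_add]
  gcongr 1
  exact sum_le_sum fun i _ => pow_le_pow_of_le_one h0 h1 (by omega)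

lemma geom_four_mul_le {r : ℝ} (h0 : 0 ≤ r) (h1 : r ≤ 1) {m n : ℕ} (hmn : m ≤ 4 * n) :
    ∑ i ∈ range m, r ^ i ≤ 4 * ∑ i ∈ range n, r ^ i := by
  have h2 : ∑ i ∈ range m, r ^ i ≤ ∑ i ∈ range (n + n + (n + n)), r ^ i :=
    sum_le_sum_of_subset_of_nonneg (range_subset_range.2 (by omega)) fun i _ _ => by positivity
  have h3 := geom_add_le h0 h1 (n + n) (n + n)
  have h4 := geom_add_le h0 h1 n n
  linarith

/-- For `s ≥ 1/20` the sums of `log p / (p ^ s - 1)` and of `log p / p ^ s` are comparable. -/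
lemma exists_inv_sub_one_le : ∃ K : ℝ, 1 ≤ K ∧ ∀ (s : ℝ) (p : ℕ), 1 / 20 ≤ s → 2 ≤ p →
    ((p : ℝ) ^ s - 1)⁻¹ ≤ K * (p : ℝ) ^ (-s) ∧ (p : ℝ) ^ (-s) ≤ ((p : ℝ) ^ s - 1)⁻¹ ∧
      0 < (p : ℝ) ^ s - 1 := by
  have h2 : (1 : ℝ) < 2 ^ (1 / 20 : ℝ) := Real.one_lt_rpow (by norm_num) (by norm_num)
  set b : ℝ := 2 ^ (1 / 20 : ℝ) with hb
  refine ⟨b / (b - 1), ?_, fun s p hs hp => ?_⟩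
  · rw [le_div_iff₀ (by linarith)]; linarith
  · have hp' : (2 : ℝ) ≤ p := by exact_mod_cast hp
    have h3 : b ≤ (p : ℝ) ^ s :=
      (Real.rpow_le_rpow (by norm_num) hp' (by norm_num)).trans
        (Real.rpow_le_rpow_of_exponent_le (by linarith) hs)
    rw [Real.rpow_neg (by linarith)]
    have h4 : 0 < (p : ℝ) ^ s - 1 := by linarith
    refine ⟨?_, ?_, h4⟩
    · rw [inv_eq_one_div, ← div_eq_mul_inv, div_div, div_le_div_iff₀ h4 (by nlinarith)]
      nlinarith
    · gcongr
      linarith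

lemma smoothLogDeriv_nonneg {y s : ℝ} (hs : 1 / 20 ≤ s) : 0 ≤ smoothLogDeriv y s := by
  obtain ⟨K, -, h⟩ := exists_inv_sub_one_le
  refine sum_nonneg fun p hp => ?_
  exact div_nonneg (Real.log_natCast_nonneg p) (h s p hs (mem_primesUpTo.1 hp).1.two_le).2.2.le

lemma exists_block_parameters {A : ℝ} (hA : 2 ≤ A) {y : ℝ} (hy1 : 1 < y)
    (hy : 8 * Real.log A ≤ Real.log y) : ∃ n N : ℕ, N ≤ 4 * n ∧ A ^ n ≤ y ^ (3 / 8 : ℝ) ∧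
      y < A ^ N ∧ Real.log y ≤ 4 * Real.log A * n := by
  have hl : 0 < Real.log A := Real.log_pos (by linarith)
  set Y := Real.log y
  have hY : 0 < Y := by linarith
  refine ⟨⌊3 / 8 * Y / Real.log A⌋₊, ⌊Y / Real.log A⌋₊ + 1, ?_, ?_, ?_, ?_⟩
  · have h1 : ⌊Y / Real.log A⌋₊ ≤ Y / Real.log A := Nat.floor_le (by positivity)
    have h2 := Nat.lt_floor_add_one (3 / 8 * Y / Real.log A)
    have h3 : 8 ≤ Y / Real.log A := by rwa [le_div_iff₀ hl]
    have h4 : 3 / 8 * Y / Real.log A = 3 / 8 * (Y / Real.log A) := by ring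
    rw [h4] at h2 ⊢
    set a : ℕ := ⌊Y / Real.log A⌋₊
    set b : ℕ := ⌊3 / 8 * (Y / Real.log A)⌋₊
    have h5 : (3 : ℝ) / 8 * a < b + 1 := by linarith
    have h6 : 3 * a < 8 * b + 8 := by
      have : (3 : ℝ) * a < 8 * b + 8 := by linarith
      exact_mod_cast this
    have h7 : 2 < b + 1 := by
      have : (2 : ℝ) < b + 1 := by linarith
      exact_mod_cast this
    omega
  · rw [← Real.log_le_log_iff (by positivity) (by positivity), Real.log_pow,
      Real.log_rpow (by linarith), ← le_div_iff₀ hl]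
    exact Nat.floor_le (by positivity)
  · rw [← Real.log_lt_log_iff (by linarith) (by positivity), Real.log_pow, ← div_lt_iff₀ hl]
    push_cast
    exact Nat.lt_floor_add_one _
  · have h2 := Nat.lt_floor_add_one (3 / 8 * Y / Real.log A)
    have h3 : 8 ≤ Y / Real.log A := by rwa [le_div_iff₀ hl]
    have h4 : 3 / 8 * Y / Real.log A = 3 / 8 * (Y / Real.log A) := by ring
    rw [h4] at h2 ⊢
    have h5 : Y / Real.log A ≤ 4 * ⌊3 / 8 * (Y / Real.log A)⌋₊ := by linarith
    rw [div_le_iff₀ hl] at h5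
    linarith

lemma exists_sum_primesBetween_ge : ∃ c y₀ : ℝ, 0 < c ∧ 2 ≤ y₀ ∧ ∀ y s : ℝ, y₀ ≤ y → 1 / 20 ≤ s →
    s ≤ 1 → (∀ T : ℝ, 1 ≤ T → T ≤ y ^ (1 / 8 : ℝ) →
      c * T ^ (s - 1) * (smoothLogDeriv y s / Real.log y) ≤
        ∑ p ∈ primesBetween √y (y / T), (p : ℝ) ^ (-s)) ∧
    c * y ^ (1 - s) ≤ (smoothLogDeriv y s / Real.log y) ^ 2 := by
  obtain ⟨A, c, hA, hc, hb⟩ := exists_block_lower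
  obtain ⟨K, hK, hK'⟩ := exists_inv_sub_one_le
  have hA0 : 0 < A := by linarith
  have hl : 0 < Real.log A := Real.log_pos (by linarith)
  refine ⟨min (c / (8 * K * A)) ((c / (4 * Real.log A)) ^ 2), max 2 (Real.exp (8 * Real.log A)),
    by positivity, le_max_left _ _, fun y s hy hs hs1 => ?_⟩
  have hy2 : 2 ≤ y := (le_max_left _ _).trans hy
  have hy0 : 0 < y := by linarith
  have hY8 : 8 * Real.log A ≤ Real.log y :=
    (Real.le_log_iff_exp_le hy0).2 ((le_max_right _ _).trans hy)
  have hY : 0 < Real.log y := by linarith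
  obtain ⟨n, N, hNn, hn, hN, hYn⟩ := exists_block_parameters hA (by linarith) hY8
  have hs0 : 0 ≤ s := by linarith
  set r := A ^ (s - 1) with hr
  have hr0 : 0 < r := by positivity
  have hr1 : r ≤ 1 := Real.rpow_le_one_of_one_le_of_nonpos (by linarith) (by linarith)
  have key : ∀ T : ℝ, 1 ≤ T → T ≤ y ^ (1 / 8 : ℝ) →
      c * (y ^ (1 - s) * T ^ (s - 1)) * ∑ i ∈ range n, r ^ i ≤
        ∑ p ∈ primesBetween √y (y / T), Real.log p * (p : ℝ) ^ (-s) := by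
    intro T hT hT'
    have hT0 : 0 < T := by linarith
    have h1 : √y * A ^ n ≤ y / T := by
      rw [le_div_iff₀ hT0, Real.sqrt_eq_rpow]
      calc y ^ (1 / 2 : ℝ) * A ^ n * T ≤ y ^ (1 / 2 : ℝ) * y ^ (3 / 8 : ℝ) * y ^ (1 / 8 : ℝ) := by
            gcongr
        _ = y := by rw [← Real.rpow_add hy0, ← Real.rpow_add hy0]; norm_num
    have h2 : 1 ≤ √y := Real.one_le_sqrt.2 (by linarith)
    have h3 : A ^ n ≤ y / T := le_trans (le_mul_of_one_le_left (by positivity) h2) h1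
    have h4 := blocks_lower hA hb hs0 n h3
    have e : (y / T) ^ (1 - s) = y ^ (1 - s) * T ^ (s - 1) := by
      rw [Real.div_rpow hy0.le hT0.le, div_eq_mul_inv, ← Real.rpow_neg hT0.le]; congr 2; ring
    rw [e] at h4
    refine h4.trans (sum_le_sum_of_subset_of_nonneg (fun p hp => ?_) fun p _ _ =>
      mul_nonneg (Real.log_natCast_nonneg p) (by positivity))
    rw [mem_primesBetween] at hp ⊢
    exact ⟨hp.1, ((le_div_iff₀ (by positivity)).2 h1).trans_lt hp.2.1, hp.2.2⟩
  have hm1 : smoothLogDeriv y s ≤ K * ∑ p ∈ primesUpTo y, Real.log p * (p : ℝ) ^ (-s) := by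
    rw [smoothLogDeriv, mul_sum]
    refine sum_le_sum fun p hp => ?_
    have := (hK' s p hs (mem_primesUpTo.1 hp).1.two_le).1
    rw [div_eq_mul_inv]
    nlinarith [mul_le_mul_of_nonneg_left this (Real.log_natCast_nonneg p)]
  have hm2 : ∑ p ∈ primesUpTo y, Real.log p * (p : ℝ) ^ (-s) ≤ smoothLogDeriv y s := by
    refine sum_le_sum fun p hp => ?_
    have := (hK' s p hs (mem_primesUpTo.1 hp).1.two_le).2.1
    rw [div_eq_mul_inv]
    exact mul_le_mul_of_nonneg_left this (Real.log_natCast_nonneg p)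
  constructor
  · intro T hT hT'
    have hT0 : 0 < T := by linarith
    have h1 := key T hT hT'
    have h2 := blocks_upper hA hs0 hs1 N hy0
    rw [primesBetween_eq_primesUpTo (lt_of_lt_of_le ((div_lt_one (by positivity)).2 hN)
      (by norm_num))] at h2
    have h3 := geom_four_mul_le hr0.le hr1 hNn
    set G := ∑ i ∈ range n, r ^ i
    have hG : 0 ≤ G := sum_nonneg fun _ _ => by positivity
    have h4 : smoothLogDeriv y s ≤ 8 * K * A * (y ^ (1 - s) * G) := by
      refine hm1.trans ?_
      calc _ ≤ K * (2 * A * y ^ (1 - s) * (4 * G)) := by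
            refine mul_le_mul_of_nonneg_left (h2.trans ?_) (by linarith)
            gcongr
        _ = _ := by ring
    have h5 : ∑ p ∈ primesBetween √y (y / T), Real.log p * (p : ℝ) ^ (-s) ≤
        Real.log y * ∑ p ∈ primesBetween √y (y / T), (p : ℝ) ^ (-s) := by
      rw [mul_sum]
      refine sum_le_sum fun p hp => mul_le_mul_of_nonneg_right ?_ (by positivity)
      rw [mem_primesBetween] at hp
      exact Real.log_le_log (by exact_mod_cast hp.1.pos)
        (hp.2.2.trans (div_le_self hy0.le hT))
    have hT1 : 0 < T ^ (s - 1) := by positivity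
    rw [← mul_div_assoc, div_le_iff₀ hY, mul_comm _ (Real.log y)]
    refine le_trans ?_ (h1.trans h5)
    calc _ ≤ c / (8 * K * A) * T ^ (s - 1) * (8 * K * A * (y ^ (1 - s) * G)) := by
          refine mul_le_mul (mul_le_mul_of_nonneg_right (min_le_left _ _) hT1.le) h4
            (smoothLogDeriv_nonneg hs) (by positivity)
      _ = _ := by field_simp
  · have h1 := key 1 le_rfl (Real.one_le_rpow (by linarith) (by norm_num))
    rw [Real.one_rpow, mul_one, div_one] at h1
    have h2 : ∑ p ∈ primesBetween √y y, Real.log p * (p : ℝ) ^ (-s) ≤ smoothLogDeriv y s := by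
      refine le_trans (sum_le_sum_of_subset_of_nonneg (filter_subset _ _) fun p _ _ =>
        mul_nonneg (Real.log_natCast_nonneg p) (by positivity)) hm2
    have h3 : (n : ℝ) * r ^ n ≤ ∑ i ∈ range n, r ^ i := by
      rw [← nsmul_eq_mul]
      nth_rw 1 [← card_range n]
      exact card_nsmul_le_sum _ _ _ fun i hi =>
        pow_le_pow_of_le_one hr0.le hr1 (mem_range.1 hi).le
    have h4 : y ^ (-(1 - s) / 2) ≤ r ^ n := by
      have : r ^ n = (A ^ n) ^ (s - 1) := by
        rw [hr, ← Real.rpow_natCast, ← Real.rpow_natCast, ← Real.rpow_mul hA0.le,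
          ← Real.rpow_mul hA0.le, mul_comm]
      rw [this]
      calc y ^ (-(1 - s) / 2) ≤ y ^ (3 / 8 * (s - 1)) :=
            Real.rpow_le_rpow_of_exponent_le (by linarith) (by linarith)
        _ = (y ^ (3 / 8 : ℝ)) ^ (s - 1) := by rw [← Real.rpow_mul hy0.le]
        _ ≤ _ := Real.rpow_le_rpow_of_nonpos (by positivity) hn (by linarith)
    have h5 : y ^ (1 - s) * y ^ (-(1 - s) / 2) = y ^ ((1 - s) / 2) := by
      rw [← Real.rpow_add hy0]; congr 1; ring
    have h6 : c / (4 * Real.log A) * y ^ ((1 - s) / 2) ≤ smoothLogDeriv y s / Real.log y := by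
      rw [le_div_iff₀ hY]
      calc c / (4 * Real.log A) * y ^ ((1 - s) / 2) * Real.log y
          ≤ c / (4 * Real.log A) * y ^ ((1 - s) / 2) * (4 * Real.log A * n) := by gcongr
        _ = c * y ^ (1 - s) * (n * y ^ (-(1 - s) / 2)) := by rw [← h5]; field_simp
        _ ≤ c * y ^ (1 - s) * (n * r ^ n) := by gcongr
        _ ≤ c * y ^ (1 - s) * ∑ i ∈ range n, r ^ i := by gcongr
        _ ≤ _ := h1.trans h2
    calc _ ≤ (c / (4 * Real.log A)) ^ 2 * y ^ (1 - s) := by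
          gcongr
          exact min_le_right _ _
      _ = (c / (4 * Real.log A) * y ^ ((1 - s) / 2)) ^ 2 := by
          rw [mul_pow, ← Real.rpow_natCast (y ^ _), ← Real.rpow_mul hy0.le]
          congr 2; push_cast; ring
      _ ≤ _ := pow_le_pow_left₀ (by positivity) h6 2

lemma Psi_eq_floor {X y : ℝ} (h : X ≤ y) : Psi X y = ⌊X⌋₊ := by
  rw [Psi_eq_card, smoothUpTo, filter_true_of_mem, Nat.card_Icc, Nat.add_sub_cancel]
  intro n hn p _ hpn
  rw [mem_Icc] at hn
  have h1 : p ≤ n := Nat.le_of_dvd (by omega) hpn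
  have h2 : (n : ℝ) ≤ X := (Nat.le_floor_iff' (by omega)).1 hn.2
  have h3 : (p : ℝ) ≤ n := by exact_mod_cast h1
  linarith

lemma Psi_le_self {X : ℝ} (hX : 0 ≤ X) (y : ℝ) : (Psi X y : ℝ) ≤ X := by
  rw [Psi_eq_card, smoothUpTo]
  refine le_trans ?_ (Nat.floor_le hX)
  exact_mod_cast (card_filter_le _ _).trans (by simp)

lemma primesUpTo_subset_smoothUpTo {X y : ℝ} (h : y ≤ X) : primesUpTo y ⊆ smoothUpTo X y :=
  fun p hp => by
    have := mem_primesUpTo.1 hp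
    exact mem_smoothUpTo.2 ⟨this.1.one_le, this.2.trans h, isSmooth_prime hp⟩

lemma sum_log_mul_Psi_le {X y : ℝ} (h : y ≤ X) :
    ∑ p ∈ primesUpTo y, Real.log p * Psi (X / p) y ≤ Psi X y * Real.log X := by
  refine le_trans ?_ (sum_vonMangoldt_mul_Psi_le X y)
  calc _ = ∑ p ∈ primesUpTo y, ArithmeticFunction.vonMangoldt p * Psi (X / p) y :=
        sum_congr rfl fun p hp => by
          rw [ArithmeticFunction.vonMangoldt_apply_prime (mem_primesUpTo.1 hp).1]
    _ ≤ _ := sum_le_sum_of_subset_of_nonneg (primesUpTo_subset_smoothUpTo h) fun d _ _ =>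
        mul_nonneg ArithmeticFunction.vonMangoldt_nonneg (by positivity)

lemma sum_log_div_le {y : ℝ} (hy : 2 ≤ y) :
    ∑ p ∈ primesUpTo y, Real.log p / p ≤ Real.log y + 2 := by
  have h1 := sum_log_mul_Psi_le (le_refl y)
  have h2 : (Psi y y : ℝ) * Real.log y ≤ y * Real.log y :=
    mul_le_mul_of_nonneg_right (Psi_le_self (by linarith) y) (Real.log_nonneg (by linarith))
  have h3 : ∑ p ∈ primesUpTo y, Real.log p * (y / p - 1) ≤
      ∑ p ∈ primesUpTo y, Real.log p * Psi (y / p) y := by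
    refine sum_le_sum fun p hp => mul_le_mul_of_nonneg_left ?_ (Real.log_natCast_nonneg p)
    have hp1 : (1 : ℝ) ≤ p := by exact_mod_cast (mem_primesUpTo.1 hp).1.one_le
    rw [Psi_eq_floor (div_le_self (by linarith) hp1)]
    linarith [Nat.lt_floor_add_one (y / p)]
  have h4 : ∑ p ∈ primesUpTo y, Real.log p * (y / p - 1) =
      y * ∑ p ∈ primesUpTo y, Real.log p / p - Chebyshev.theta y := by
    rw [theta_eq_sum_primesUpTo, mul_sum, ← sum_sub_distrib]
    exact sum_congr rfl fun p _ => by ring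
  have h5 := theta_le_two_mul (t := y) (by linarith)
  have h6 : y * ∑ p ∈ primesUpTo y, Real.log p / p ≤ y * (Real.log y + 2) := by linarith
  exact le_of_mul_le_mul_left h6 (by linarith)

lemma smoothLogDeriv_one_le {y : ℝ} (hy : 2 ≤ y) :
    smoothLogDeriv y 1 ≤ 2 * Real.log y + 4 := by
  have h := sum_log_div_le hy
  calc smoothLogDeriv y 1 ≤ ∑ p ∈ primesUpTo y, 2 * (Real.log p / p) := by
        refine sum_le_sum fun p hp => ?_
        have hp2 : (2 : ℝ) ≤ p := by exact_mod_cast (mem_primesUpTo.1 hp).1.two_le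
        have hl := Real.log_natCast_nonneg p
        rw [Real.rpow_one, ← mul_div_assoc, div_le_div_iff₀ (by linarith) (by linarith)]
        nlinarith
    _ ≤ _ := by rw [← mul_sum]; linarith

lemma smoothLogDeriv_strictAnti {y s t : ℝ} (hy : 2 ≤ y) (hs : 0 < s) (hst : s < t) :
    smoothLogDeriv y t < smoothLogDeriv y s := by
  refine sum_lt_sum_of_nonempty ⟨2, mem_primesUpTo.2 ⟨Nat.prime_two, by exact_mod_cast hy⟩⟩
    fun p hp => ?_
  have hp2 : (1 : ℝ) < p := by exact_mod_cast (mem_primesUpTo.1 hp).1.one_lt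
  have h1 := Real.one_lt_rpow hp2 hs
  have h2 := Real.rpow_lt_rpow_of_exponent_lt hp2 hst
  exact div_lt_div_of_pos_left (Real.log_pos hp2) (by linarith) (by linarith)

lemma continuousOn_smoothLogDeriv (y : ℝ) : ContinuousOn (smoothLogDeriv y) (Set.Ioi 0) := by
  unfold smoothLogDeriv
  refine continuousOn_finsetSum _ fun p hp => ?_
  have hp2 : (1 : ℝ) < p := by exact_mod_cast (mem_primesUpTo.1 hp).1.one_lt
  refine ContinuousOn.div continuousOn_const ?_ fun s hs => ?_
  · exact ((Real.continuous_const_rpow (by linarith)).continuousOn).sub continuousOn_const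
  · have := Real.one_lt_rpow hp2 hs
    linarith

lemma exists_alpha_bounds : ∃ y₀ : ℝ, 2 ≤ y₀ ∧ ∀ x y α : ℝ, y₀ ≤ y → 1 < x →
    Real.log x ^ (1.1 : ℝ) ≤ y → y ≤ x ^ ((1 : ℝ) / 3) → alphaEq x y α →
    1 / 20 ≤ α ∧ α ≤ 1 ∧ smoothLogDeriv y α = Real.log x := by
  obtain ⟨c, hc, -, hθ⟩ := exists_mul_le_theta
  refine ⟨max (Real.exp 5) ((2 / c) ^ (25 : ℝ)), ?_, fun x y α hy hx h1 h2 hα => ?_⟩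
  · refine le_max_of_le_left ?_
    linarith [Real.add_one_le_exp 5]
  have hα' : smoothLogDeriv y α = Real.log x := hα
  have hy5 : Real.exp 5 ≤ y := (le_max_left _ _).trans hy
  have hy2 : 6 ≤ y := by linarith [Real.add_one_le_exp 5]
  have hY : 5 ≤ Real.log y := (Real.le_log_iff_exp_le (by linarith)).2 hy5
  have hlx : 0 < Real.log x := Real.log_pos hx
  have h3 : 3 * Real.log y ≤ Real.log x := by
    have := Real.log_le_log (by linarith) h2
    rw [Real.log_rpow (by linarith)] at this
    linarith
  have hα0 : 0 < α := by
    by_contra! hneg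
    have : smoothLogDeriv y α ≤ 0 := by
      refine sum_nonpos fun p hp => ?_
      have hp2 : (1 : ℝ) ≤ p := by exact_mod_cast (mem_primesUpTo.1 hp).1.one_le
      have := Real.rpow_le_one_of_one_le_of_nonpos hp2 hneg
      exact div_nonpos_of_nonneg_of_nonpos (Real.log_natCast_nonneg p) (by linarith)
    linarith
  refine ⟨?_, ?_, hα'⟩
  · by_contra! hlt
    have h4 : c * y ^ (19 / 20 : ℝ) ≤ Real.log x := by
      rw [← hα']
      have h5 : y ^ (-α) * Chebyshev.theta y ≤ smoothLogDeriv y α := by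
        rw [theta_eq_sum_primesUpTo, mul_sum]
        refine sum_le_sum fun p hp => ?_
        have hp' := mem_primesUpTo.1 hp
        have hp2 : (1 : ℝ) < p := by exact_mod_cast hp'.1.one_lt
        have h6 := Real.one_lt_rpow hp2 hα0
        have h7 : (p : ℝ) ^ α ≤ y ^ α := Real.rpow_le_rpow (by linarith) hp'.2 hα0.le
        rw [Real.rpow_neg (by linarith), mul_comm, ← div_eq_mul_inv]
        exact div_le_div_of_nonneg_left (Real.log_natCast_nonneg p) (by linarith) (by linarith)
      refine le_trans ?_ h5
      have h8 : y ^ (-(1 / 20) : ℝ) ≤ y ^ (-α) :=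
        Real.rpow_le_rpow_of_exponent_le (by linarith) (by linarith)
      have h9 : y ^ (19 / 20 : ℝ) = y ^ (-(1 / 20) : ℝ) * y := by
        rw [← Real.rpow_add_one (by linarith)]; norm_num
      rw [h9]
      have := hθ y (by linarith)
      calc _ = y ^ (-(1 / 20) : ℝ) * (c * y) := by ring
        _ ≤ _ := by gcongr
    have h5 : Real.log x ≤ y ^ (10 / 11 : ℝ) := by
      have := Real.rpow_le_rpow (by positivity) h1 (show (0 : ℝ) ≤ 10 / 11 by norm_num)
      rwa [← Real.rpow_mul hlx.le, show (1.1 : ℝ) * (10 / 11) = 1 by norm_num,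
        Real.rpow_one] at this
    have h6 : 2 / c ≤ y ^ (1 / 25 : ℝ) := by
      have := Real.rpow_le_rpow (by positivity) ((le_max_right _ _).trans hy)
        (show (0 : ℝ) ≤ 1 / 25 by norm_num)
      rwa [← Real.rpow_mul (by positivity), show (25 : ℝ) * (1 / 25) = 1 by norm_num,
        Real.rpow_one] at this
    have h7 : y ^ (10 / 11 : ℝ) * y ^ (1 / 25 : ℝ) ≤ y ^ (19 / 20 : ℝ) := by
      rw [← Real.rpow_add (by linarith)]
      exact Real.rpow_le_rpow_of_exponent_le (by linarith) (by norm_num)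
    have h8 : 0 < y ^ (10 / 11 : ℝ) := by positivity
    have h9 : y ^ (10 / 11 : ℝ) * (2 / c) ≤ y ^ (19 / 20 : ℝ) :=
      le_trans (by gcongr) h7
    have h10 : c * (y ^ (10 / 11 : ℝ) * (2 / c)) ≤ y ^ (10 / 11 : ℝ) :=
      (mul_le_mul_of_nonneg_left h9 hc.le).trans (h4.trans h5)
    have h11 : c * (y ^ (10 / 11 : ℝ) * (2 / c)) = 2 * y ^ (10 / 11 : ℝ) := by field_simp
    linarith
  · by_contra! hgt
    have := smoothLogDeriv_strictAnti (by linarith : (2 : ℝ) ≤ y) one_pos hgt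
    have h4 := smoothLogDeriv_one_le (by linarith : (2 : ℝ) ≤ y)
    linarith

/-- Sums of `Λ` against a function over smooth numbers, as sums over prime powers. -/
lemma sum_vonMangoldt_mul {t y : ℝ} (ht : 1 ≤ t) (f : ℕ → ℝ) :
    ∑ d ∈ smoothUpTo t y, ArithmeticFunction.vonMangoldt d * f d =
      ∑ p ∈ primesUpTo y, Real.log p * ∑ k ∈ Icc 1 (Nat.log p ⌊t⌋₊), f (p ^ k) := by
  have ht0 : ⌊t⌋₊ ≠ 0 := by
    have := (Nat.one_le_floor_iff t).2 ht
    omega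
  simp_rw [mul_sum]
  rw [sum_sigma']
  symm
  refine sum_bij_ne_zero (fun a _ _ => a.1 ^ a.2) ?_ ?_ ?_ ?_
  · rintro ⟨p, k⟩ h _
    simp only [mem_sigma, mem_Icc] at h ⊢
    have hp := (mem_primesUpTo.1 h.1).1
    refine mem_smoothUpTo.2 ⟨Nat.one_le_pow _ _ hp.pos, ?_, (isSmooth_prime h.1).pow k⟩
    rw [← Nat.le_floor_iff' (pow_ne_zero _ hp.ne_zero)]
    exact Nat.pow_le_of_le_log ht0 h.2.2
  · rintro ⟨p, k⟩ h _ ⟨p', k'⟩ h' _ e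
    simp only [mem_sigma, mem_Icc] at h h' e
    have hp := (mem_primesUpTo.1 h.1).1
    have hp' := (mem_primesUpTo.1 h'.1).1
    have h1 : p = p' := by
      refine (Nat.prime_dvd_prime_iff_eq hp hp').1 (hp.dvd_of_dvd_pow (n := k') ?_)
      rw [← e]
      exact dvd_pow_self _ (by omega)
    subst h1
    rw [Nat.pow_right_injective hp.two_le e]
  · intro d hd hne
    have h1 : ArithmeticFunction.vonMangoldt d ≠ 0 := left_ne_zero_of_mul hne
    rw [ArithmeticFunction.vonMangoldt_ne_zero_iff, isPrimePow_nat_iff] at h1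
    obtain ⟨p, k, hp, hk, rfl⟩ := h1
    have hd' := mem_smoothUpTo.1 hd
    have hpy : p ∈ primesUpTo y :=
      mem_primesUpTo.2 ⟨hp, hd'.2.2 p hp (dvd_pow_self _ (by omega))⟩
    refine ⟨⟨p, k⟩, ?_, ?_, rfl⟩
    · simp only [mem_sigma, mem_Icc]
      refine ⟨hpy, hk, Nat.le_log_of_pow_le hp.one_lt ?_⟩
      exact (Nat.le_floor_iff' (by omega)).2 hd'.2.1
    · simp only
      rwa [ArithmeticFunction.vonMangoldt_apply_pow (by omega),
        ArithmeticFunction.vonMangoldt_apply_prime hp] at hne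
  · rintro ⟨p, k⟩ h _
    simp only [mem_sigma, mem_Icc] at h ⊢
    have hp := (mem_primesUpTo.1 h.1).1
    rw [ArithmeticFunction.vonMangoldt_apply_pow (by omega),
        ArithmeticFunction.vonMangoldt_apply_prime hp]

lemma card_primesUpTo_le {y : ℝ} (hy : 3 ≤ y) :
    ((primesUpTo y).card : ℝ) ≤ 5 * y / Real.log y := by
  have h1 := Chebyshev.pi_le_log4_mul_div (x := y) (by linarith)
  have e : (primesUpTo y).card = Nat.primeCounting ⌊y⌋₊ := by
    rw [Nat.primeCounting, ← Nat.primesBelow_card_eq_primeCounting']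
    rfl
  rw [e]
  refine h1.trans ?_
  have hY : 0 < Real.log y := Real.log_pos (by linarith)
  have hs : 0 < √y := Real.sqrt_pos.2 (by linarith)
  rw [Real.log_sqrt (by linarith)]
  have h4 : Real.log 4 ≤ 1.4 := by
    rw [show (4 : ℝ) = 2 ^ 2 by norm_num, Real.log_pow]
    have := Real.log_two_lt_d9
    norm_num; linarith
  have h5 : Real.log y ≤ 2 * √y := by
    have := Real.log_le_sub_one_of_pos hs
    rw [Real.log_sqrt (by linarith)] at this
    linarith
  have h6 : √y * √y = y := Real.mul_self_sqrt (by linarith)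
  rw [le_div_iff₀ hY, add_mul]
  have h7 : Real.log 4 * y / (Real.log y / 2) * Real.log y = 2 * (Real.log 4 * y) := by field_simp
  rw [h7]
  nlinarith

lemma one_add_log_le {w s : ℝ} (hw : 1 ≤ w) (hs : 1 / 20 ≤ s) : 1 + Real.log w ≤ 20 * w ^ s := by
  have h1 : Real.log (w ^ (1 / 20 : ℝ)) ≤ w ^ (1 / 20 : ℝ) - 1 :=
    Real.log_le_sub_one_of_pos (by positivity)
  rw [Real.log_rpow (by linarith)] at h1
  have h2 := Real.rpow_le_rpow_of_exponent_le hw hs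
  linarith

lemma sum_vonMangoldt_smoothUpTo_le {y t s : ℝ} (hy : 3 ≤ y) (ht : 1 ≤ t) (hs : 1 / 20 ≤ s)
    (hs1 : s ≤ 1) :
    ∑ d ∈ smoothUpTo t y, ArithmeticFunction.vonMangoldt d ≤ 100 * (y ^ (1 - s) * t ^ s) := by
  have hy0 : 0 < y := by linarith
  rcases le_or_gt t y with hty | hty
  · have h1 : ∑ d ∈ smoothUpTo t y, ArithmeticFunction.vonMangoldt d ≤ Chebyshev.psi t := by
      rw [Chebyshev.psi]
      refine sum_le_sum_of_subset_of_nonneg (fun d hd => ?_) fun d _ _ =>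
        ArithmeticFunction.vonMangoldt_nonneg
      have := mem_smoothUpTo.1 hd
      exact mem_Ioc.2 ⟨this.1, (Nat.le_floor_iff' (by omega)).2 this.2.1⟩
    have h2 := Chebyshev.psi_le_const_mul_self (x := t) (by linarith)
    have h3 : t = t ^ (1 - s) * t ^ s := by
      rw [← Real.rpow_add (by linarith), sub_add_cancel, Real.rpow_one]
    have h4 : t ^ (1 - s) ≤ y ^ (1 - s) := Real.rpow_le_rpow (by linarith) hty (by linarith)
    have h5 : t ≤ y ^ (1 - s) * t ^ s := by
      nth_rw 1 [h3]
      gcongr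
    have h6 : Real.log 4 ≤ 3 := by
      have := Real.log_le_sub_one_of_pos (show (0 : ℝ) < 4 by norm_num)
      linarith
    have h7 : (Real.log 4 + 4) * t ≤ 100 * t := by gcongr; linarith
    linarith
  · have hY : 1 ≤ Real.log y := by
      rw [Real.le_log_iff_exp_le hy0]
      have := Real.exp_one_lt_d9
      linarith
    have h0 := sum_vonMangoldt_mul (y := y) ht (fun _ => 1)
    simp only [mul_one, sum_const, nsmul_eq_mul, Nat.card_Icc, Nat.add_sub_cancel] at h0
    have h1 : ∑ d ∈ smoothUpTo t y, ArithmeticFunction.vonMangoldt d ≤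
        (primesUpTo y).card * Real.log t := by
      rw [h0, ← nsmul_eq_mul]
      refine sum_le_card_nsmul _ _ _ fun p hp => ?_
      have hp' := (mem_primesUpTo.1 hp).1
      rw [mul_comm, ← Real.log_pow]
      refine Real.log_le_log (pow_pos (by exact_mod_cast hp'.pos) _) ?_
      rw [← Nat.cast_pow]
      have ht0 : ⌊t⌋₊ ≠ 0 := by
        have := (Nat.one_le_floor_iff t).2 ht
        omega
      exact (Nat.le_floor_iff' (pow_ne_zero _ hp'.ne_zero)).1 (Nat.pow_log_le_self p ht0)
    have h2 : ((primesUpTo y).card : ℝ) * Real.log t ≤ 5 * y / Real.log y * Real.log t :=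
      mul_le_mul_of_nonneg_right (card_primesUpTo_le hy) (Real.log_nonneg ht)
    have h3 : Real.log t = Real.log y + Real.log (t / y) := by
      rw [Real.log_div (by linarith) (by linarith)]; ring
    have hl : 0 ≤ Real.log (t / y) := Real.log_nonneg ((one_le_div hy0).2 hty.le)
    have h4 : 5 * y / Real.log y * Real.log t ≤ 5 * y * (1 + Real.log (t / y)) := by
      rw [h3, div_mul_eq_mul_div, div_le_iff₀ (by linarith)]
      have : Real.log (t / y) ≤ Real.log (t / y) * Real.log y := le_mul_of_one_le_right hl hY
      have h6 : Real.log y + Real.log (t / y) ≤ (1 + Real.log (t / y)) * Real.log y := by linarith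
      calc _ ≤ 5 * y * ((1 + Real.log (t / y)) * Real.log y) := by gcongr
        _ = _ := by ring
    have h5 := one_add_log_le ((one_le_div hy0).2 hty.le) hs
    have h6 : y ^ (1 - s) * t ^ s = y * (t / y) ^ s := by
      rw [Real.div_rpow (by linarith) hy0.le, Real.rpow_sub hy0, Real.rpow_one]
      ring
    rw [h6]
    have h7 : 5 * y * (1 + Real.log (t / y)) ≤ 5 * y * (20 * (t / y) ^ s) := by gcongr
    linarith

lemma sum_Icc_inv_pow {b : ℝ} (hb : 1 < b) (K : ℕ) :
    ∑ k ∈ Icc 1 K, (b ^ k)⁻¹ = (b - 1)⁻¹ - (b ^ K)⁻¹ * (b - 1)⁻¹ := by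
  have hb1 : b - 1 ≠ 0 := by linarith
  induction K with
  | zero => simp
  | succ K ih =>
    rw [sum_Icc_succ_top (by omega), ih, pow_succ]
    field_simp
    ring

lemma exists_smoothLogDeriv_tail : ∃ y₀ : ℝ, 3 ≤ y₀ ∧ ∀ y α T : ℝ, y₀ ≤ y → 1 / 20 ≤ α →
    y ^ (41 : ℝ) ≤ T → smoothLogDeriv y α - Real.log y ≤
      ∑ d ∈ smoothUpTo T y, ArithmeticFunction.vonMangoldt d * (d : ℝ) ^ (-α) := by
  obtain ⟨K, hK, hK'⟩ := exists_inv_sub_one_le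
  refine ⟨max 3 (2 * K), le_max_left _ _, fun y α T hy hα hT => ?_⟩
  have hy3 : 3 ≤ y := (le_max_left _ _).trans hy
  have hyK : 2 * K ≤ y := (le_max_right _ _).trans hy
  have hT1 : 1 ≤ T := (Real.one_le_rpow (by linarith) (by norm_num)).trans hT
  rw [sum_vonMangoldt_mul hT1, sub_le_iff_le_add]
  have h1 : ∀ p ∈ primesUpTo y, Real.log p / ((p : ℝ) ^ α - 1) ≤
      Real.log p * ∑ k ∈ Icc 1 (Nat.log p ⌊T⌋₊), ((p ^ k : ℕ) : ℝ) ^ (-α) +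
        Real.log p * (K * T ^ (-α)) := by
    intro p hp
    have hp' := (mem_primesUpTo.1 hp).1
    have hp2 : (1 : ℝ) < p := by exact_mod_cast hp'.one_lt
    have hp0 : (0 : ℝ) < p := by linarith
    obtain ⟨h2, h3, h4⟩ := hK' α p hα hp'.two_le
    set b := (p : ℝ) ^ α with hb
    have e : ∀ k : ℕ, ((p ^ k : ℕ) : ℝ) ^ (-α) = (b ^ k)⁻¹ := by
      intro k
      rw [Nat.cast_pow, Real.rpow_neg (by positivity), hb, ← Real.rpow_natCast,
        ← Real.rpow_natCast, ← Real.rpow_mul hp0.le, ← Real.rpow_mul hp0.le, mul_comm]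
    simp_rw [e]
    rw [sum_Icc_inv_pow (by linarith), ← mul_add, div_eq_mul_inv]
    refine mul_le_mul_of_nonneg_left ?_ (Real.log_natCast_nonneg p)
    set k := Nat.log p ⌊T⌋₊ with hk
    have h5 : (b ^ k)⁻¹ * (b - 1)⁻¹ ≤ K * T ^ (-α) := by
      have h6 : T ≤ ((p ^ (k + 1) : ℕ) : ℝ) :=
        (Nat.lt_of_floor_lt (Nat.lt_pow_succ_log_self hp'.one_lt _)).le
      have h7 : ((p ^ (k + 1) : ℕ) : ℝ) ^ (-α) ≤ T ^ (-α) :=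
        Real.rpow_le_rpow_of_nonpos (by linarith) h6 (by linarith)
      rw [e, pow_succ, mul_inv] at h7
      rw [Real.rpow_neg hp0.le, ← hb] at h2
      have h8 : 0 ≤ (b ^ k)⁻¹ := inv_nonneg.2 (pow_nonneg (by linarith) _)
      calc _ ≤ (b ^ k)⁻¹ * (K * b⁻¹) := by gcongr
        _ = K * ((b ^ k)⁻¹ * b⁻¹) := by ring
        _ ≤ _ := by gcongr
    linarith
  refine (sum_le_sum h1).trans ?_
  rw [sum_add_distrib, ← sum_mul, ← theta_eq_sum_primesUpTo]
  gcongr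
  have h2 := theta_le_two_mul (t := y) (by linarith)
  have h3 : T ^ (-α) ≤ y ^ (-2 : ℝ) := by
    calc T ^ (-α) ≤ (y ^ (41 : ℝ)) ^ (-α) :=
          Real.rpow_le_rpow_of_nonpos (by positivity) hT (by linarith)
      _ = y ^ (41 * -α) := by rw [← Real.rpow_mul (by linarith)]
      _ ≤ _ := Real.rpow_le_rpow_of_exponent_le (by linarith) (by linarith)
  have h4 : y ^ (-2 : ℝ) = (y * y)⁻¹ := by
    rw [Real.rpow_neg (by linarith), show (2 : ℝ) = (2 : ℕ) by norm_num, Real.rpow_natCast, sq]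
  have hY : 1 ≤ Real.log y := by
    rw [Real.le_log_iff_exp_le (by linarith)]
    have := Real.exp_one_lt_d9
    linarith
  calc Chebyshev.theta y * (K * T ^ (-α)) ≤ 2 * y * (K * (y * y)⁻¹) := by
        rw [← h4]
        gcongr
    _ = 2 * K / y := by field_simp
    _ ≤ 1 := (div_le_one (by linarith)).2 hyK
    _ ≤ _ := hY

/-- The weight `(1/2) ^ #{p ∈ R : p ∣ n}`. -/
def halfWeight (R : Finset ℕ) (n : ℕ) : ℝ := (1 / 2) ^ (R.filter (· ∣ n)).card

lemma halfWeight_empty (n : ℕ) : halfWeight ∅ n = 1 := by simp [halfWeight]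

lemma halfWeight_pos (R : Finset ℕ) (n : ℕ) : 0 < halfWeight R n := by
  unfold halfWeight; positivity

lemma halfWeight_one {y : ℝ} {R : Finset ℕ} (hR : R ⊆ primesUpTo y) : halfWeight R 1 = 1 := by
  rw [halfWeight, filter_eq_empty_iff.2, card_empty, pow_zero]
  intro p hp h
  exact (mem_primesUpTo.1 (hR hp)).1.one_lt.ne' (Nat.dvd_one.1 h)

lemma halfWeight_mul {y : ℝ} {R : Finset ℕ} (hR : R ⊆ primesUpTo y) {m n : ℕ}
    (h : Nat.Coprime m n) : halfWeight R (m * n) = halfWeight R m * halfWeight R n := by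
  rw [halfWeight, halfWeight, halfWeight, ← pow_add, ← card_union_of_disjoint]
  · congr 2
    ext p
    simp only [mem_filter, mem_union]
    constructor
    · rintro ⟨h1, h2⟩
      exact ((mem_primesUpTo.1 (hR h1)).1.dvd_mul.1 h2).imp (fun h => ⟨h1, h⟩) fun h => ⟨h1, h⟩
    · rintro (h | h)
      · exact ⟨h.1, h.2.mul_right _⟩
      · exact ⟨h.1, h.2.mul_left _⟩
  · rw [disjoint_left]
    intro p hp hp'
    rw [mem_filter] at hp hp'
    exact Nat.not_coprime_of_dvd_of_dvd (mem_primesUpTo.1 (hR hp.1)).1.one_lt hp.2 hp'.2 h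

lemma halfWeight_prime_pow {y : ℝ} {R : Finset ℕ} (hR : R ⊆ primesUpTo y) {p k : ℕ}
    (hp : p.Prime) (hk : k ≠ 0) :
    halfWeight R (p ^ k) = if p ∈ R then 1 / 2 else 1 := by
  have h : R.filter (· ∣ p ^ k) = if p ∈ R then {p} else ∅ := by
    ext r
    rw [mem_filter]
    constructor
    · rintro ⟨h1, h2⟩
      have h3 := (mem_primesUpTo.1 (hR h1)).1
      have h4 := (Nat.prime_dvd_prime_iff_eq h3 hp).1 (h3.dvd_of_dvd_pow h2)
      subst h4
      simp [h1]
    · intro h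
      split_ifs at h with h1
      · rw [mem_singleton] at h
        subst h
        exact ⟨h1, dvd_pow_self _ hk⟩
      · simp at h
  rw [halfWeight, h]
  split_ifs <;> simp

lemma prime_rpow_neg_lt_one {s : ℝ} (hs : 0 < s) {p : ℕ} (hp : p.Prime) :
    0 < (p : ℝ) ^ (-s) ∧ (p : ℝ) ^ (-s) < 1 :=
  ⟨Real.rpow_pos_of_pos (by exact_mod_cast hp.pos) _,
    Real.rpow_lt_one_of_one_lt_of_neg (by exact_mod_cast hp.one_lt) (by linarith)⟩

lemma hasSum_halfWeight {y s : ℝ} (hs : 0 < s) {R : Finset ℕ} (hR : R ⊆ primesUpTo y) :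
    HasSum (fun m : Nat.factoredNumbers (range (⌊y⌋₊ + 1)) => halfWeight R m * (m : ℝ) ^ (-s))
      (∏ p ∈ primesUpTo y, ((if p ∈ R then 1 / 2 else 1) * (1 - (p : ℝ) ^ (-s))⁻¹ +
        (1 - if p ∈ R then 1 / 2 else 1))) := by
  set f : ℕ → ℝ := fun m => halfWeight R m * (m : ℝ) ^ (-s) with hf
  have hp : ∀ {p : ℕ}, p.Prime → HasSum (fun n : ℕ => f (p ^ n))
      ((if p ∈ R then 1 / 2 else 1) * (1 - (p : ℝ) ^ (-s))⁻¹ +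
        (1 - if p ∈ R then 1 / 2 else 1)) := by
    intro p hp
    obtain ⟨h1, h2⟩ := prime_rpow_neg_lt_one hs hp
    have h3 := ((hasSum_geometric_of_lt_one h1.le h2).mul_left
      (if p ∈ R then (1 : ℝ) / 2 else 1)).add
      (hasSum_ite_eq 0 (1 - if p ∈ R then (1 : ℝ) / 2 else 1))
    rw [show (fun n : ℕ => f (p ^ n)) = fun n : ℕ => (if p ∈ R then (1 : ℝ) / 2 else 1) *
      ((p : ℝ) ^ (-s)) ^ n + if n = 0 then (1 - if p ∈ R then (1 : ℝ) / 2 else 1) else 0 from ?_]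
    · exact h3
    funext n
    simp only [hf]
    rcases eq_or_ne n 0 with rfl | hn
    · simp [halfWeight_one hR]
    · rw [halfWeight_prime_pow hR hp hn, if_neg hn, add_zero, Nat.cast_pow]
      congr 1
      rw [← Real.rpow_natCast, ← Real.rpow_natCast, ← Real.rpow_mul (by positivity),
        ← Real.rpow_mul (by positivity), mul_comm]
  have h := (EulerProduct.summable_and_hasSum_factoredNumbers_prod_filter_prime_tsum (f := f)
    (by simp [hf, halfWeight_one hR]) (fun {m n} hmn => by
      simp only [hf]
      rw [halfWeight_mul hR hmn, Nat.cast_mul, Real.mul_rpow (by positivity) (by positivity)]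
      ring)
    (fun hp' => (hp hp').summable.norm) (range (⌊y⌋₊ + 1))).2
  rwa [show ∏ p ∈ range (⌊y⌋₊ + 1) with p.Prime, ∑' n : ℕ, f (p ^ n) = _ from
    prod_congr rfl fun p hp' => (hp (mem_filter.1 hp').2).tsum_eq] at h

lemma mem_factoredNumbers_iff_isSmooth {y : ℝ} {n : ℕ} :
    n ∈ Nat.factoredNumbers (range (⌊y⌋₊ + 1)) ↔ n ≠ 0 ∧ IsSmooth y n := by
  rw [Nat.factoredNumbers, Set.mem_ofPred_eq]
  refine and_congr_right fun hn => ?_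
  simp only [Nat.mem_primeFactorsList hn, mem_range, Nat.lt_succ_iff, IsSmooth]
  constructor
  · intro h p hp hpn
    exact (Nat.le_floor_iff' hp.ne_zero).1 (h p ⟨hp, hpn⟩)
  · intro h p hp
    exact (Nat.le_floor_iff' hp.1.ne_zero).2 (h p hp.1 hp.2)

lemma sum_smoothUpTo_eq_sum_subtype (X y : ℝ) (f : ℕ → ℝ) :
    ∑ n ∈ smoothUpTo X y, f n =
      ∑ m ∈ (smoothUpTo X y).subtype (· ∈ Nat.factoredNumbers (range (⌊y⌋₊ + 1))), f m := by
  rw [sum_subtype_eq_sum_filter, filter_true_of_mem]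
  intro n hn
  have := mem_smoothUpTo.1 hn
  exact mem_factoredNumbers_iff_isSmooth.2 ⟨by omega, this.2.2⟩

lemma sum_halfWeight_le {y s : ℝ} (hs : 0 < s) {R : Finset ℕ} (hR : R ⊆ primesUpTo y) (X : ℝ) :
    ∑ n ∈ smoothUpTo X y, halfWeight R n * (n : ℝ) ^ (-s) ≤
      smoothZeta y s * Real.exp (-(∑ p ∈ R, (p : ℝ) ^ (-s)) / 2) := by
  rw [sum_smoothUpTo_eq_sum_subtype X y fun n => halfWeight R n * (n : ℝ) ^ (-s)]
  refine (sum_le_hasSum _ (fun m _ => ?_) (hasSum_halfWeight hs hR)).trans ?_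
  · exact mul_nonneg (halfWeight_pos R m).le (by positivity)
  have e : Real.exp (-(∑ p ∈ R, (p : ℝ) ^ (-s)) / 2) =
      ∏ p ∈ primesUpTo y, if p ∈ R then Real.exp (-(p : ℝ) ^ (-s) / 2) else 1 := by
    rw [prod_ite_mem, inter_eq_right.2 hR, ← Real.exp_sum, ← sum_div, sum_neg_distrib]
  rw [e, smoothZeta, ← prod_mul_distrib]
  refine prod_le_prod (fun p hp => ?_) fun p hp => ?_ <;>
    obtain ⟨h1, h2⟩ := prime_rpow_neg_lt_one hs (mem_primesUpTo.1 hp).1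
  · have h3 : 0 ≤ (1 - (p : ℝ) ^ (-s))⁻¹ := inv_nonneg.2 (by linarith)
    split_ifs <;> linarith
  · split_ifs
    · have h3 := Real.add_one_le_exp (-(p : ℝ) ^ (-s) / 2)
      have h4 : 0 < 1 - (p : ℝ) ^ (-s) := by linarith
      have h5 : 1 / 2 * (1 - (p : ℝ) ^ (-s))⁻¹ + (1 - 1 / 2) =
          (1 - (p : ℝ) ^ (-s))⁻¹ * (-(p : ℝ) ^ (-s) / 2 + 1) := by
        field_simp
        ring
      rw [h5]
      exact mul_le_mul_of_nonneg_left h3 (inv_nonneg.2 h4.le)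
    · simp

lemma sum_rpow_neg_le_smoothZeta {y s : ℝ} (hs : 0 < s) (X : ℝ) :
    ∑ n ∈ smoothUpTo X y, (n : ℝ) ^ (-s) ≤ smoothZeta y s := by
  have := sum_halfWeight_le hs (empty_subset (primesUpTo y)) X
  simpa [halfWeight_empty] using this

lemma smoothZeta_le_of_forall_sum_le {y s B : ℝ} (hs : 0 < s)
    (h : ∀ X : ℝ, ∑ n ∈ smoothUpTo X y, (n : ℝ) ^ (-s) ≤ B) : smoothZeta y s ≤ B := by
  have h1 := hasSum_halfWeight hs (empty_subset (primesUpTo y))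
  simp only [halfWeight_empty, one_mul, notMem_empty, if_false, sub_self, add_zero] at h1
  refine hasSum_le_of_sum_le h1 fun F => ?_
  obtain ⟨N, hN⟩ := (F.image Subtype.val).bddAbove
  refine le_trans ?_ (h N)
  rw [sum_smoothUpTo_eq_sum_subtype N y fun n => (n : ℝ) ^ (-s)]
  refine sum_le_sum_of_subset_of_nonneg (fun m hm => ?_) fun _ _ _ => by positivity
  rw [mem_subtype, mem_smoothUpTo]
  have h2 := mem_factoredNumbers_iff_isSmooth.1 m.2
  exact ⟨Nat.one_le_iff_ne_zero.2 h2.1,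
    by exact_mod_cast hN (mem_coe.2 (mem_image_of_mem _ hm)), h2.2⟩

lemma smoothZeta_pos {y s : ℝ} (hs : 0 < s) : 0 < smoothZeta y s :=
  prod_pos fun p hp => inv_pos.2
    (by linarith [(prime_rpow_neg_lt_one hs (mem_primesUpTo.1 hp).1).2])

/-- Shifting the exponent of the Euler product, to second order. -/
lemma exists_smoothZeta_shift : ∃ C : ℝ, 1 ≤ C ∧ ∀ y β η : ℝ, 1 ≤ y → 1 / 20 ≤ β →
    |η| * Real.log y ≤ 1 → η ≤ β / 2 →
    smoothZeta y (β - η) ≤ smoothZeta y β *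
      Real.exp (η * smoothLogDeriv y β + C * (η ^ 2 * Real.log y * smoothLogDeriv y β)) := by
  have hc2 : (1 : ℝ) < 2 ^ (1 / 40 : ℝ) := Real.one_lt_rpow (by norm_num) (by norm_num)
  set c₀ : ℝ := 2 ^ (1 / 40 : ℝ) - 1 with hc₀
  have hc : 0 < c₀ := by linarith
  refine ⟨1 + 4 / c₀, by simp; positivity, fun y β η hy hβ hη hηβ => ?_⟩
  have e : η * smoothLogDeriv y β + (1 + 4 / c₀) * (η ^ 2 * Real.log y * smoothLogDeriv y β) =
      ∑ p ∈ primesUpTo y, (η * (Real.log p / ((p : ℝ) ^ β - 1)) +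
        (1 + 4 / c₀) * (η ^ 2 * Real.log y * (Real.log p / ((p : ℝ) ^ β - 1)))) := by
    rw [sum_add_distrib, ← mul_sum, ← mul_sum, ← mul_sum]
    rfl
  rw [e, Real.exp_sum, smoothZeta, smoothZeta, ← prod_mul_distrib]
  refine prod_le_prod (fun p hp => ?_) fun p hp => ?_
  · exact inv_nonneg.2
      (by linarith [(prime_rpow_neg_lt_one (s := β - η) (by linarith) (mem_primesUpTo.1 hp).1).2])
  · have hp' := mem_primesUpTo.1 hp
    have hp2 : (2 : ℝ) ≤ p := by exact_mod_cast hp'.1.two_le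
    have hp0 : (0 : ℝ) < p := by linarith
    have hlp : 0 ≤ Real.log p := Real.log_natCast_nonneg p
    have hlpy : Real.log p ≤ Real.log y := Real.log_le_log hp0 hp'.2
    set b := (p : ℝ) ^ β with hb
    set r := (p : ℝ) ^ η with hr
    set l := η * Real.log p with hl
    have hre : r = Real.exp l := by rw [hr, Real.rpow_def_of_pos hp0, hl, mul_comm]
    have hl1 : |l| ≤ 1 := by
      rw [hl, abs_mul, abs_of_nonneg hlp]
      exact (mul_le_mul_of_nonneg_left hlpy (abs_nonneg _)).trans hη
    have hb2 : 1 + c₀ ≤ (p : ℝ) ^ (β / 2) := by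
      rw [hc₀, add_sub_cancel]
      exact (Real.rpow_le_rpow (by norm_num) hp2 (by norm_num)).trans
        (Real.rpow_le_rpow_of_exponent_le (by linarith) (by linarith))
    have hbb : b = (p : ℝ) ^ (β / 2) * (p : ℝ) ^ (β / 2) := by
      rw [← Real.rpow_add hp0, add_halves]
    have hrb : r ≤ (p : ℝ) ^ (β / 2) := Real.rpow_le_rpow_of_exponent_le (by linarith) hηβ
    have hr0 : 0 < r := by positivity
    have hbr : c₀ ≤ b - r := by nlinarith
    have hb1 : 0 < b - 1 := by nlinarith
    have hb0 : 0 < b := by linarith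
    have e1 : (1 - (p : ℝ) ^ (-(β - η)))⁻¹ = b / (b - r) := by
      rw [neg_sub, Real.rpow_sub hp0, ← hb, ← hr, one_sub_div hb0.ne', inv_div]
    have e2 : (1 - (p : ℝ) ^ (-β))⁻¹ = b / (b - 1) := by
      rw [Real.rpow_neg hp0.le, ← hb, inv_eq_one_div b, one_sub_div hb0.ne', inv_div]
    rw [e1, e2]
    have h1 : b / (b - r) = b / (b - 1) * ((r - 1) / (b - r) + 1) := by
      have : b - r ≠ 0 := by linarith
      field_simp
      ring
    rw [h1]
    refine mul_le_mul_of_nonneg_left ((Real.add_one_le_exp _).trans (Real.exp_le_exp.2 ?_))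
      (by positivity)
    have h2 : r - 1 ≤ l + l ^ 2 := by
      have := (abs_le.1 (Real.abs_exp_sub_one_sub_id_le hl1)).2
      rw [hre]; linarith
    have h3 : (r - 1) ^ 2 ≤ 4 * l ^ 2 := by
      have h4 := Real.abs_exp_sub_one_le hl1
      rw [← hre] at h4
      rw [← sq_abs, ← sq_abs l]
      nlinarith [abs_nonneg (r - 1), abs_nonneg l]
    have h4 : (r - 1) / (b - r) = ((r - 1) + (r - 1) ^ 2 / (b - r)) / (b - 1) := by
      have : b - r ≠ 0 := by linarith
      field_simp
      ring
    have h5 : (r - 1) ^ 2 / (b - r) ≤ 4 * l ^ 2 / c₀ :=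
      div_le_div₀ (by positivity) h3 hc hbr
    have h6 : l ^ 2 ≤ η ^ 2 * Real.log y * Real.log p := by
      rw [hl, mul_pow]
      nlinarith [mul_nonneg (sq_nonneg η) (mul_nonneg hlp (sub_nonneg.2 hlpy))]
    have h7 : (1 + 4 / c₀) * l ^ 2 ≤ (1 + 4 / c₀) * (η ^ 2 * Real.log y * Real.log p) := by gcongr
    rw [h4]
    calc _ ≤ (l + (1 + 4 / c₀) * (η ^ 2 * Real.log y * Real.log p)) / (b - 1) := by
          refine div_le_div_of_nonneg_right ?_ hb1.le
          have h8 : (1 + 4 / c₀) * l ^ 2 = l ^ 2 + 4 * l ^ 2 / c₀ := by ring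
          linarith
      _ = _ := by rw [hl]; ring

lemma exp_neg_two_le : 4 * Real.exp (-2) ≤ 1 := by
  rw [Real.exp_neg, ← div_eq_mul_inv, div_le_one (Real.exp_pos _),
    show (2 : ℝ) = 1 + 1 by norm_num, Real.exp_add]
  have := Real.add_one_le_exp 1
  nlinarith

/-- The mass of `n ↦ n ^ (-β)` on smooth numbers concentrates where `log n` is within
`O(√(v log y))` of its mean. -/
lemma exists_concentration : ∃ C : ℝ, 1 ≤ C ∧ ∀ y β v : ℝ, 1 ≤ y → 40 ≤ Real.log y →
    1 / 20 ≤ β → Real.log y ≤ v → smoothLogDeriv y β ≤ v →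
    smoothZeta y β / 2 ≤
      ∑ n ∈ (smoothUpTo (Real.exp (smoothLogDeriv y β + C * √(v * Real.log y))) y).filter
        (fun n : ℕ => smoothLogDeriv y β - C * √(v * Real.log y) ≤ Real.log n), (n : ℝ) ^ (-β) := by
  obtain ⟨C, hC, hshift⟩ := exists_smoothZeta_shift
  refine ⟨C + 2, by linarith, fun y β v hy hY hβ hv hm => ?_⟩
  set Y := Real.log y with hYdef
  set m := smoothLogDeriv y β with hmdef
  set D := √(v * Y) with hD
  set H := (C + 2) * D with hH
  have hβ0 : 0 < β := by linarith
  have hY0 : 0 < Y := by linarith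
  have hv0 : 0 < v := by linarith
  have hDsq : D * D = v * Y := Real.mul_self_sqrt (by positivity)
  have hD0 : 0 < D := Real.sqrt_pos.2 (by positivity)
  have hYD : Y ≤ D := Real.le_sqrt_of_sq_le (by nlinarith)
  have hζ := smoothZeta_pos (y := y) hβ0
  have hηY : |D⁻¹| * Y ≤ 1 := by
    rw [abs_of_pos (inv_pos.2 hD0), inv_mul_le_iff₀ hD0]; linarith
  have hDβ : D⁻¹ ≤ β / 2 := by
    have : D⁻¹ ≤ 40⁻¹ := by gcongr; linarith
    linarith
  have hbound : C * (D⁻¹ ^ 2 * Y * m) ≤ C := by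
    have h1 : D⁻¹ ^ 2 * Y * m ≤ 1 := by
      have h2 : D⁻¹ ^ 2 = (v * Y)⁻¹ := by rw [inv_pow, sq, hDsq]
      rw [h2, mul_assoc, inv_mul_le_iff₀ (by positivity)]
      nlinarith
    nlinarith
  have hDH : D⁻¹ * H = C + 2 := by rw [hH]; field_simp
  have hup : ∀ X : ℝ, ∑ n ∈ (smoothUpTo X y).filter
        (fun n : ℕ => m + H < Real.log n), (n : ℝ) ^ (-β) ≤
      smoothZeta y β * Real.exp (-2) := by
    intro X
    have h1 := hshift y β D⁻¹ hy hβ hηY hDβ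
    have h2 := sum_rpow_neg_le_smoothZeta (y := y) (s := β - D⁻¹) (by linarith) X
    calc _ ≤ ∑ n ∈ (smoothUpTo X y).filter
            (fun n : ℕ => m + H < Real.log n),
          Real.exp (-(D⁻¹ * (m + H))) * (n : ℝ) ^ (-(β - D⁻¹)) := by
          refine sum_le_sum fun n hn => ?_
          rw [mem_filter, mem_smoothUpTo] at hn
          have hn0 : (0 : ℝ) < n := by exact_mod_cast hn.1.1
          rw [Real.rpow_def_of_pos hn0, Real.rpow_def_of_pos hn0, ← Real.exp_add]
          refine Real.exp_le_exp.2 ?_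
          nlinarith [mul_le_mul_of_nonneg_left hn.2.le (inv_nonneg.2 hD0.le)]
      _ ≤ ∑ n ∈ smoothUpTo X y, Real.exp (-(D⁻¹ * (m + H))) * (n : ℝ) ^ (-(β - D⁻¹)) :=
          sum_le_sum_of_subset_of_nonneg (filter_subset _ _) fun _ _ _ => by positivity
      _ ≤ Real.exp (-(D⁻¹ * (m + H))) * (smoothZeta y β *
          Real.exp (D⁻¹ * m + C * (D⁻¹ ^ 2 * Y * m))) := by
          rw [← mul_sum]
          exact mul_le_mul_of_nonneg_left (h2.trans h1) (Real.exp_pos _).le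
      _ = smoothZeta y β * Real.exp (-(D⁻¹ * H) + C * (D⁻¹ ^ 2 * Y * m)) := by
          rw [mul_left_comm, ← Real.exp_add]
          congr 2; ring
      _ ≤ _ := by
          gcongr
          linarith
  have hlow : ∀ X : ℝ, ∑ n ∈ (smoothUpTo X y).filter
        (fun n : ℕ => Real.log n < m - H), (n : ℝ) ^ (-β) ≤
      smoothZeta y β * Real.exp (-2) := by
    intro X
    have h1 := hshift y β (-D⁻¹) hy hβ (by rwa [abs_neg])
      (by linarith [inv_pos.2 hD0])
    rw [sub_neg_eq_add] at h1
    have h2 := sum_rpow_neg_le_smoothZeta (y := y) (s := β + D⁻¹)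
      (by linarith [inv_pos.2 hD0]) X
    calc _ ≤ ∑ n ∈ (smoothUpTo X y).filter
            (fun n : ℕ => Real.log n < m - H),
          Real.exp (D⁻¹ * (m - H)) * (n : ℝ) ^ (-(β + D⁻¹)) := by
          refine sum_le_sum fun n hn => ?_
          rw [mem_filter, mem_smoothUpTo] at hn
          have hn0 : (0 : ℝ) < n := by exact_mod_cast hn.1.1
          rw [Real.rpow_def_of_pos hn0, Real.rpow_def_of_pos hn0, ← Real.exp_add]
          refine Real.exp_le_exp.2 ?_
          nlinarith [mul_le_mul_of_nonneg_left hn.2.le (inv_nonneg.2 hD0.le)]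
      _ ≤ ∑ n ∈ smoothUpTo X y, Real.exp (D⁻¹ * (m - H)) * (n : ℝ) ^ (-(β + D⁻¹)) :=
          sum_le_sum_of_subset_of_nonneg (filter_subset _ _) fun _ _ _ => by positivity
      _ ≤ Real.exp (D⁻¹ * (m - H)) * (smoothZeta y β *
          Real.exp (-D⁻¹ * m + C * ((-D⁻¹) ^ 2 * Y * m))) := by
          rw [← mul_sum]
          exact mul_le_mul_of_nonneg_left (h2.trans h1) (Real.exp_pos _).le
      _ = smoothZeta y β * Real.exp (-(D⁻¹ * H) + C * (D⁻¹ ^ 2 * Y * m)) := by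
          rw [mul_left_comm, ← Real.exp_add]
          congr 2; ring
      _ ≤ _ := by
          gcongr
          linarith
  have hall : smoothZeta y β ≤ 2 * (smoothZeta y β * Real.exp (-2)) +
      ∑ n ∈ (smoothUpTo (Real.exp (m + H)) y).filter
        (fun n : ℕ => m - H ≤ Real.log n), (n : ℝ) ^ (-β) := by
    refine smoothZeta_le_of_forall_sum_le hβ0 fun X => ?_
    rw [← sum_filter_add_sum_filter_not (smoothUpTo X y) (fun n : ℕ => m + H < Real.log n),
      ← sum_filter_add_sum_filter_not
        ((smoothUpTo X y).filter fun n : ℕ => ¬ m + H < Real.log n)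
        (fun n : ℕ => Real.log n < m - H)]
    have h3 : ∑ n ∈ ((smoothUpTo X y).filter fun n : ℕ => ¬ m + H < Real.log n).filter
        (fun n : ℕ => Real.log n < m - H), (n : ℝ) ^ (-β) ≤ smoothZeta y β * Real.exp (-2) := by
      refine le_trans (sum_le_sum_of_subset_of_nonneg ?_ fun _ _ _ => by positivity) (hlow X)
      exact filter_subset_filter _ (filter_subset _ _)
    have h4 : ∑ n ∈ ((smoothUpTo X y).filter fun n : ℕ => ¬ m + H < Real.log n).filter
        (fun n : ℕ => ¬ Real.log n < m - H), (n : ℝ) ^ (-β) ≤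
        ∑ n ∈ (smoothUpTo (Real.exp (m + H)) y).filter
        (fun n : ℕ => m - H ≤ Real.log n), (n : ℝ) ^ (-β) := by
      refine sum_le_sum_of_subset_of_nonneg (fun n hn => ?_) fun _ _ _ => by positivity
      simp only [mem_filter, mem_smoothUpTo, not_lt] at hn ⊢
      have hn0 : (0 : ℝ) < n := by exact_mod_cast hn.1.1.1
      exact ⟨⟨hn.1.1.1, (Real.log_le_iff_le_exp hn0).1 hn.1.2, hn.1.1.2.2⟩, hn.2⟩
    have h5 := hup X
    linarith
  have h6 := exp_neg_two_le
  nlinarith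

/-- Few primes exceeding `√y` can divide `n`. -/
lemma card_dvd_mul_log_le {y b : ℝ} (hy : 1 ≤ y) {n : ℕ} (hn : 1 ≤ n) :
    (((primesBetween (√y) b).filter (· ∣ n)).card : ℝ) * (Real.log y / 2) ≤ Real.log n := by
  have h1 : (((primesBetween (√y) b).filter (· ∣ n)).card : ℝ) * (Real.log y / 2) ≤
      ∑ p ∈ (primesBetween (√y) b).filter (· ∣ n), Real.log p := by
    rw [← nsmul_eq_mul]
    refine card_nsmul_le_sum _ _ _ fun p hp => ?_
    rw [mem_filter, mem_primesBetween] at hp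
    rw [← Real.log_sqrt (by linarith)]
    exact Real.log_le_log (Real.sqrt_pos.2 (by linarith)) hp.1.2.1.le
  refine h1.trans (le_trans ?_ (sum_log_primes_dvd_le hn b))
  refine sum_le_sum_of_subset_of_nonneg ?_ fun p _ _ => Real.log_natCast_nonneg _
  exact filter_subset_filter _ (primesBetween_subset_primesUpTo le_rfl)

/-- The `β`-mass of the smooth numbers `l ≤ exp (v - 1)` with `log l ≥ v - a`. -/
def upperMass (y β v a : ℝ) : ℝ :=
  ∑ l ∈ (smoothUpTo (Real.exp (v - 1)) y).filter (fun l : ℕ => v - a ≤ Real.log l),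
    (l : ℝ) ^ (-β)

lemma upperMass_nonneg (y β v a : ℝ) : 0 ≤ upperMass y β v a :=
  sum_nonneg fun _ _ => by positivity

lemma upperMass_mono (y β v : ℝ) {a b : ℝ} (h : a ≤ b) :
    upperMass y β v a ≤ upperMass y β v b := by
  refine sum_le_sum_of_subset_of_nonneg (fun n hn => ?_) fun _ _ _ => by positivity
  rw [mem_filter] at hn ⊢
  exact ⟨hn.1, by linarith [hn.2]⟩

lemma upperMass_step {y β v a : ℝ} (hy : 1 ≤ y) (hY : 1 ≤ Real.log y) :
    upperMass y β v (a + Real.log y / 2) *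
        ∑ p ∈ primesBetween (√y) (y / Real.exp 1), (p : ℝ) ^ (-β) ≤
      upperMass y β v (Real.log y) *
        ∑ p ∈ primesBetween (√y) (y / Real.exp 1), (p : ℝ) ^ (-β) +
      2 * v / Real.log y * upperMass y β v a := by
  set R := primesBetween (√y) (y / Real.exp 1) with hR
  set Y := Real.log y with hYdef
  set ρ := ∑ p ∈ R, (p : ℝ) ^ (-β) with hρ
  have hρ0 : 0 ≤ ρ := sum_nonneg fun _ _ => by positivity
  have hRsub : R ⊆ primesUpTo y := primesBetween_subset_primesUpTo
    (div_le_self (by linarith) (by linarith [Real.add_one_le_exp 1]))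
  set X := Real.exp (v - 1) with hX
  set F : ℕ → ℝ := fun n => if v - a ≤ Real.log n then (n : ℝ) ^ (-β) else 0 with hF
  have hF0 : ∀ n, 0 ≤ F n := fun n => by
    simp only [hF]; split_ifs <;> positivity
  have hkey := sum_smoothUpTo_mul X y R
    (fun d hd => ⟨(mem_primesBetween.1 hd).1.one_le, isSmooth_prime (hRsub hd)⟩) F (fun _ => 1)
  have hright : ∑ n ∈ smoothUpTo X y, F n * ∑ d ∈ R with d ∣ n, (1 : ℝ) ≤
      2 * v / Y * upperMass y β v a := by
    rw [upperMass, sum_filter, mul_sum]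
    refine sum_le_sum fun n hn => ?_
    rw [mem_smoothUpTo] at hn
    have hn0 : (0 : ℝ) < n := by exact_mod_cast hn.1
    have hlog : Real.log n ≤ v := by
      have := (Real.log_le_iff_le_exp hn0).2 hn.2.1
      linarith
    have h1 := card_dvd_mul_log_le (b := y / Real.exp 1) hy hn.1
    rw [mul_comm (2 * v / Y)]
    refine mul_le_mul_of_nonneg_left ?_ (hF0 n)
    rw [sum_const, nsmul_eq_mul, mul_one, le_div_iff₀ (by linarith)]
    linarith
  set M := (smoothUpTo X y).filter (fun l : ℕ => v - (a + Y / 2) ≤ Real.log l ∧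
    Real.log l < v - Y) with hM
  have hsplit : upperMass y β v (a + Y / 2) ≤ upperMass y β v Y + ∑ l ∈ M, (l : ℝ) ^ (-β) := by
    rw [upperMass, upperMass, hM, sum_filter, sum_filter, sum_filter, ← sum_add_distrib]
    refine sum_le_sum fun n _ => ?_
    have : (0 : ℝ) ≤ (n : ℝ) ^ (-β) := by positivity
    by_cases h1 : v - (a + Y / 2) ≤ Real.log n <;> by_cases h2 : v - Y ≤ Real.log n
    · simp [h1, h2, not_lt.2 h2]
    · simp [h1, h2, not_le.1 h2]
    · simp [h1, h2, this]
    · simp [h1, h2]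
  have hleft : (∑ l ∈ M, (l : ℝ) ^ (-β)) * ρ ≤
      ∑ l ∈ smoothUpTo X y, ∑ d ∈ R with ((l * d : ℕ) : ℝ) ≤ X, F (l * d) * 1 := by
    rw [sum_mul]
    refine le_trans (sum_le_sum fun l hl => ?_) (sum_le_sum_of_subset_of_nonneg
      (filter_subset _ _) fun l _ _ => sum_nonneg fun d _ => by simpa using hF0 _)
    rw [hρ, mul_sum]
    rw [hM, mem_filter, mem_smoothUpTo] at hl
    have hl0 : (0 : ℝ) < l := by exact_mod_cast hl.1.1
    have hmem : ∀ d ∈ R, ((l * d : ℕ) : ℝ) ≤ X ∧ v - a ≤ Real.log (l * d : ℕ) := by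
      intro d hd
      rw [hR, mem_primesBetween] at hd
      have hd0 : (0 : ℝ) < d := by exact_mod_cast hd.1.pos
      have hd1 : Y / 2 ≤ Real.log d := by
        rw [← Real.log_sqrt (by linarith)]
        exact Real.log_le_log (Real.sqrt_pos.2 (by linarith)) hd.2.1.le
      have hd2 : Real.log d ≤ Y - 1 := by
        have := Real.log_le_log hd0 hd.2.2
        rwa [Real.log_div (by linarith) (Real.exp_pos _).ne', Real.log_exp] at this
      have hlog : Real.log (l * d : ℕ) = Real.log l + Real.log d := by
        push_cast; exact Real.log_mul hl0.ne' hd0.ne'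
      constructor
      · rw [hX, ← Real.log_le_iff_le_exp (by push_cast; positivity), hlog]
        linarith [hl.2.2]
      · rw [hlog]; linarith [hl.2.1]
    rw [filter_true_of_mem fun d hd => (hmem d hd).1]
    refine sum_le_sum fun d hd => ?_
    simp only [hF, if_pos (hmem d hd).2, mul_one]
    push_cast
    rw [Real.mul_rpow (by positivity) (by positivity)]
  nlinarith [mul_le_mul_of_nonneg_right hsplit hρ0]

lemma upperMass_iterate {y β v K : ℝ} (hy : 1 ≤ y) (hY : 1 ≤ Real.log y) (hv : 0 ≤ v)
    (hρ : 0 < ∑ p ∈ primesBetween (√y) (y / Real.exp 1), (p : ℝ) ^ (-β))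
    (hK : 2 * v / Real.log y ≤
      K * ∑ p ∈ primesBetween (√y) (y / Real.exp 1), (p : ℝ) ^ (-β)) (i : ℕ) :
    upperMass y β v (Real.log y + i * (Real.log y / 2)) ≤
      (1 + K) ^ i * upperMass y β v (Real.log y) := by
  have hK0 : 0 ≤ K := by
    by_contra! h
    have : 0 ≤ 2 * v / Real.log y := by positivity
    nlinarith
  induction i with
  | zero => simp
  | succ i ih =>
    have h1 := upperMass_step (β := β) (v := v) (a := Real.log y + i * (Real.log y / 2)) hy hY
    have h2 : upperMass y β v (Real.log y) ≤
        upperMass y β v (Real.log y + i * (Real.log y / 2)) :=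
      upperMass_mono _ _ _ (by have : 0 ≤ (i : ℝ) * (Real.log y / 2) := by positivity
                               linarith)
    set ρ := ∑ p ∈ primesBetween (√y) (y / Real.exp 1), (p : ℝ) ^ (-β)
    have h3 := upperMass_nonneg y β v (Real.log y + i * (Real.log y / 2))
    set J := upperMass y β v (Real.log y + i * (Real.log y / 2))
    have h4 : upperMass y β v (Real.log y + (i + 1 : ℕ) * (Real.log y / 2)) * ρ ≤
        ((1 + K) * J) * ρ := by
      have : Real.log y + i * (Real.log y / 2) + Real.log y / 2 =
        Real.log y + (i + 1 : ℕ) * (Real.log y / 2) := by push_cast; ring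
      rw [← this]
      nlinarith [mul_le_mul_of_nonneg_right hK h3, mul_le_mul_of_nonneg_right h2 hρ.le]
    have h5 := le_of_mul_le_mul_right h4 hρ
    calc _ ≤ (1 + K) * J := h5
      _ ≤ (1 + K) * ((1 + K) ^ i * upperMass y β v (Real.log y)) := by gcongr
      _ = _ := by rw [pow_succ]; ring

/-- A lower bound for `Ψ(exp v, y)` in terms of the mass just below `exp v`. -/
lemma upperMass_le_Psi {c : ℝ} (hc : ∀ t : ℝ, 2 ≤ t → c * t ≤ Chebyshev.theta t) (hc0 : 0 < c)
    {y β v : ℝ} (hy : 1 ≤ y) (hβ : β ≤ 1) :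
    c * (Real.exp v ^ β * upperMass y β v (Real.log y)) ≤ v * Psi (Real.exp v) y := by
  have h := sum_theta_min_le (Real.exp v) y
  rw [Real.log_exp, mul_comm] at h
  refine le_trans ?_ h
  have hth : ∀ t, 0 ≤ Chebyshev.theta t := Chebyshev.theta_nonneg
  rw [upperMass, mul_sum, mul_sum]
  have hsub : (smoothUpTo (Real.exp (v - 1)) y).filter
      (fun l : ℕ => v - Real.log y ≤ Real.log l) ⊆ smoothUpTo (Real.exp v) y :=
    (filter_subset _ _).trans (smoothUpTo_mono (Real.exp_le_exp.2 (by linarith)))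
  refine le_trans (sum_le_sum fun l hl => ?_)
    (sum_le_sum_of_subset_of_nonneg hsub fun _ _ _ => hth _)
  rw [mem_filter, mem_smoothUpTo] at hl
  have hl0 : (0 : ℝ) < l := by exact_mod_cast hl.1.1
  have hy0 : 0 < y := by linarith
  have h1 : Real.exp v / l ≤ y := by
    rw [div_le_iff₀ hl0]
    calc Real.exp v ≤ Real.exp (Real.log y + Real.log l) := Real.exp_le_exp.2 (by linarith)
      _ = y * l := by rw [Real.exp_add, Real.exp_log hy0, Real.exp_log hl0]
  have h2 : 2 ≤ Real.exp v / l := by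
    rw [le_div_iff₀ hl0]
    have : Real.exp v = Real.exp 1 * Real.exp (v - 1) := by rw [← Real.exp_add]; ring_nf
    rw [this]
    have := Real.add_one_le_exp 1
    nlinarith [hl.1.2.1, Real.exp_pos (v - 1)]
  rw [min_eq_right h1]
  refine le_trans ?_ (hc _ h2)
  refine mul_le_mul_of_nonneg_left ?_ hc0.le
  rw [Real.rpow_neg hl0.le, ← div_eq_mul_inv, ← Real.div_rpow (Real.exp_pos _).le hl0.le]
  calc _ ≤ (Real.exp v / l) ^ (1 : ℝ) := Real.rpow_le_rpow_of_exponent_le (by linarith) hβ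
    _ = _ := Real.rpow_one _

set_option maxHeartbeats 400000 in
/-- Choice of the saddle point below `exp v`, with a lower bound for `Ψ (exp v) y`. -/
lemma exists_saddle_lower : ∃ C U₀ y₀ : ℝ, 1 ≤ C ∧ 1 ≤ U₀ ∧ 3 ≤ y₀ ∧ ∀ y α v : ℝ, y₀ ≤ y →
    1 / 20 ≤ α → α ≤ 1 → U₀ * Real.log y ≤ v → v ≤ smoothLogDeriv y α →
    ∃ β, α ≤ β ∧ β ≤ 1 ∧ v / 2 ≤ smoothLogDeriv y β ∧ smoothLogDeriv y β ≤ v ∧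
      Real.exp v ^ β * smoothZeta y β ≤
        C * v * Real.exp (C * √(v / Real.log y)) * Psi (Real.exp v) y := by
  obtain ⟨C₁, hC₁, hconc⟩ := exists_concentration
  obtain ⟨c, y₁, hc, hy₁, hprimes⟩ := exists_sum_primesBetween_ge
  obtain ⟨d, hd, hd1, htheta⟩ := exists_mul_le_theta
  set K := 4 * Real.exp 1 / c with hK
  have hK0 : 0 < K := by positivity
  refine ⟨K * (4 * C₁ + 3) + 2 / d + 1, 64 * C₁ ^ 2, max y₁ (Real.exp 40), ?_, by nlinarith,
    ?_, fun y α v hy hα hα1 hv hvm => ?_⟩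
  · have : 0 ≤ K * (4 * C₁ + 3) + 2 / d := by positivity
    linarith
  · exact le_max_of_le_right (by linarith [Real.add_one_le_exp 40])
  have hyexp : Real.exp 40 ≤ y := (le_max_right _ _).trans hy
  have hy1 : 1 ≤ y := by linarith [Real.add_one_le_exp 40]
  have hy0 : 0 < y := by linarith
  have hY : 40 ≤ Real.log y := (Real.le_log_iff_exp_le hy0).2 hyexp
  set Y := Real.log y with hYdef
  set u := v / Y with hu
  have hYpos : 0 < Y := by linarith
  have hvu : v = u * Y := by rw [hu]; field_simp
  have hu64 : 64 * C₁ ^ 2 ≤ u := by rw [hu, le_div_iff₀ hYpos]; exact hv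
  have hu1 : 64 ≤ u := by nlinarith
  set r := √u with hr
  have hr2 : r * r = u := Real.mul_self_sqrt (by linarith)
  have hr0 : 8 * C₁ ≤ r := Real.le_sqrt_of_sq_le (by nlinarith)
  have hr1 : 8 ≤ r := by linarith
  have hD : √(v * Y) = r * Y := by
    rw [hvu, mul_assoc, Real.sqrt_mul (by linarith), Real.sqrt_mul_self hYpos.le]
  set H := C₁ * (r * Y) with hH
  have hH0 : 0 < H := by positivity
  have hHv : H ≤ v / 8 := by
    rw [hvu, hH, ← hr2]
    have : 0 < r * Y := by positivity
    linarith [mul_le_mul_of_nonneg_right hr0 this.le]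
  have hvbig : 64 * Y ≤ v := by rw [hvu]; nlinarith
  obtain ⟨β, hβmem, hβm⟩ : ∃ β ∈ Set.Icc α 1, smoothLogDeriv y β = v - H - 1 := by
    have hcont : ContinuousOn (smoothLogDeriv y) (Set.Icc α 1) :=
      (continuousOn_smoothLogDeriv y).mono fun z hz => by
        simp only [Set.mem_Ioi]; linarith [hz.1]
    have h1 := smoothLogDeriv_one_le (y := y) (by linarith [Real.add_one_le_exp 40])
    exact intermediate_value_Icc' hα1 hcont ⟨by linarith, by linarith⟩
  have hβ20 : 1 / 20 ≤ β := hα.trans hβmem.1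
  refine ⟨β, hβmem.1, hβmem.2, by rw [hβm]; linarith, by rw [hβm]; linarith, ?_⟩
  obtain ⟨hP, -⟩ := hprimes y β ((le_max_left _ _).trans hy) hβ20 hβmem.2
  have hρ : c * Real.exp (-1) * (u / 2) ≤
      ∑ p ∈ primesBetween (√y) (y / Real.exp 1), (p : ℝ) ^ (-β) := by
    refine le_trans ?_ (hP (Real.exp 1) (by linarith [Real.add_one_le_exp 1]) ?_)
    · have h1 : Real.exp (-1) ≤ Real.exp 1 ^ (β - 1) := by
        rw [← Real.exp_mul]; exact Real.exp_le_exp.2 (by linarith)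
      have h2 : u / 2 ≤ smoothLogDeriv y β / Y := by
        rw [hβm, le_div_iff₀ hYpos, hu]; field_simp; linarith
      gcongr
    · rw [Real.rpow_def_of_pos hy0]; exact Real.exp_le_exp.2 (by linarith)
  have hρ0 := lt_of_lt_of_le (show 0 < c * Real.exp (-1) * (u / 2) by positivity) hρ
  have hKρ : 2 * v / Y ≤
      K * ∑ p ∈ primesBetween (√y) (y / Real.exp 1), (p : ℝ) ^ (-β) := by
    refine le_trans (le_of_eq ?_) (mul_le_mul_of_nonneg_left hρ hK0.le)
    have he : Real.exp 1 * Real.exp (-1) = 1 := by rw [← Real.exp_add]; simp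
    calc 2 * v / Y = 2 * u := by rw [hu]; ring
      _ = 2 * u * (Real.exp 1 * Real.exp (-1)) := by rw [he, mul_one]
      _ = _ := by rw [hK]; field_simp; ring
  have hv0 : 0 ≤ v := by linarith
  set i := ⌈(4 * H + 2) / Y⌉₊ with hi
  have hi1 : 4 * H + 2 ≤ i * Y := (div_le_iff₀ hYpos).1 (Nat.le_ceil _)
  have hi2 : (i : ℝ) ≤ (4 * C₁ + 3) * r := by
    have h1 := Nat.ceil_lt_add_one (show 0 ≤ (4 * H + 2) / Y by positivity)
    have h2 : (4 * H + 2) / Y = 4 * C₁ * r + 2 / Y := by rw [hH]; field_simp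
    have h3 : 2 / Y ≤ 1 := by rw [div_le_one hYpos]; linarith
    rw [← hi, h2] at h1
    nlinarith
  have hiter := upperMass_iterate hy1 (by linarith) hv0 hρ0 hKρ i
  have hconc' : smoothZeta y β / 2 ≤ upperMass y β v (2 * H + 1) := by
    have := hconc y β v hy1 hY hβ20 (by linarith) (by rw [hβm]; linarith)
    rw [hD, hβm, ← hH] at this
    rw [upperMass]
    convert this using 4
    · ring_nf
    · ring_nf
  have hmass : smoothZeta y β / 2 ≤
      Real.exp (K * (4 * C₁ + 3) * r) * upperMass y β v Y := by
    refine hconc'.trans ((upperMass_mono y β v (by linarith)).trans (hiter.trans ?_))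
    refine mul_le_mul_of_nonneg_right ?_ (upperMass_nonneg _ _ _ _)
    calc (1 + K) ^ i ≤ Real.exp K ^ i := by
          gcongr; linarith [Real.add_one_le_exp K]
      _ = Real.exp (i * K) := (Real.exp_nat_mul _ _).symm
      _ ≤ _ := Real.exp_le_exp.2 (by
        linarith [mul_le_mul_of_nonneg_right hi2 hK0.le])
  have hΨ := upperMass_le_Psi htheta hd (v := v) hy1 hβmem.2
  have hW : 0 ≤ Real.exp v ^ β := by positivity
  set E := Real.exp (K * (4 * C₁ + 3) * r) with hE
  set A := K * (4 * C₁ + 3) with hA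
  have hA0 : 0 < A := by positivity
  have hΨ0 : (0 : ℝ) ≤ v * Psi (Real.exp v) y := by positivity
  calc Real.exp v ^ β * smoothZeta y β
      ≤ 2 * E * (Real.exp v ^ β * upperMass y β v Y) := by
        linarith [mul_le_mul_of_nonneg_left hmass hW]
    _ ≤ 2 * E * (v * Psi (Real.exp v) y / d) := by
        gcongr
        rw [le_div_iff₀ hd]; linarith
    _ = 2 / d * E * (v * Psi (Real.exp v) y) := by ring
    _ ≤ (A + 2 / d + 1) * Real.exp ((A + 2 / d + 1) * r) * (v * Psi (Real.exp v) y) := by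
        gcongr
        · linarith
        · rw [hE]
          refine Real.exp_le_exp.2 ?_
          have : 0 ≤ 2 / d := by positivity
          exact mul_le_mul_of_nonneg_right (by linarith) (by linarith)
    _ = _ := by ring

lemma one_le_halfWeight {R : Finset ℕ} {n : ℕ} {κ : ℝ}
    (h : ((R.filter (· ∣ n)).card : ℝ) ≤ κ / 4) : 1 ≤ Real.exp (κ / 4) * halfWeight R n := by
  have h1 : ((1 : ℝ) / 2) ^ (R.filter (· ∣ n)).card ≥
      Real.exp (-1) ^ (R.filter (· ∣ n)).card := by
    refine pow_le_pow_left₀ (Real.exp_pos _).le ?_ _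
    rw [Real.exp_neg, one_div]
    gcongr
    linarith [Real.add_one_le_exp 1]
  rw [← Real.exp_nat_mul] at h1
  calc (1 : ℝ) = Real.exp 0 := Real.exp_zero.symm
    _ ≤ Real.exp (κ / 4 + (R.filter (· ∣ n)).card * -1) := Real.exp_le_exp.2 (by linarith)
    _ = Real.exp (κ / 4) * Real.exp ((R.filter (· ∣ n)).card * -1) := Real.exp_add _ _
    _ ≤ _ := by
      rw [halfWeight]
      gcongr

/-- Rankin's bound. -/
lemma Psi_le_rpow_mul_smoothZeta {X y s : ℝ} (hX : 0 < X) (hs : 0 < s) :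
    (Psi X y : ℝ) ≤ X ^ s * smoothZeta y s := by
  refine le_trans ?_ (mul_le_mul_of_nonneg_left (sum_rpow_neg_le_smoothZeta hs X) (by positivity))
  rw [Psi_eq_card, mul_sum, ← nsmul_one]
  refine card_nsmul_le_sum _ _ _ fun n hn => ?_
  rw [mem_smoothUpTo] at hn
  have hn0 : (0 : ℝ) < n := by exact_mod_cast hn.1
  rw [Real.rpow_neg hn0.le, ← div_eq_mul_inv, one_le_div (by positivity)]
  exact Real.rpow_le_rpow hn0.le hn.2.1 hs.le

/-- Few smooth numbers have few prime factors from a set `R` of primes. -/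
lemma card_few_prime_factors_le {y β v κ : ℝ} (hy : 3 ≤ y) (hβ : 1 / 20 ≤ β) (hβ1 : β ≤ 1)
    (hv : 0 < v) {R : Finset ℕ} (hR : R ⊆ primesUpTo y) (hκ : κ ≤ ∑ p ∈ R, (p : ℝ) ^ (-β)) :
    (((smoothUpTo (Real.exp v) y).filter
        (fun n : ℕ => ((R.filter (· ∣ n)).card : ℝ) ≤ κ / 4)).card : ℝ) ≤
      Real.exp (v / 2) ^ β * smoothZeta y β +
        200 / v * (y ^ (1 - β) * (Real.exp v ^ β * smoothZeta y β * Real.exp (-(κ / 4)))) := by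
  have hβ0 : 0 < β := by linarith
  set W := Real.exp v with hW
  have hW0 : 0 < W := Real.exp_pos v
  set F : ℕ → ℝ := fun n => if ((R.filter (· ∣ n)).card : ℝ) ≤ κ / 4 then 1 else 0 with hF
  have hF0 : ∀ n, 0 ≤ F n := fun n => by simp only [hF]; split_ifs <;> norm_num
  have hFmul : ∀ l d, l ≠ 0 → d ≠ 0 → F (l * d) ≤ F l := by
    intro l d hl hd
    simp only [hF]
    have hcard : ((R.filter (· ∣ l)).card : ℝ) ≤ (R.filter (· ∣ l * d)).card := by
      exact_mod_cast card_le_card fun p hp => by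
        rw [mem_filter] at hp ⊢
        exact ⟨hp.1, hp.2.mul_right d⟩
    split_ifs with h1 h2
    · exact le_rfl
    · exact absurd (hcard.trans h1) h2
    · norm_num
    · exact le_rfl
  have hFw : ∀ n, F n ≤ Real.exp (κ / 4) * halfWeight R n := by
    intro n
    simp only [hF]
    split_ifs with h
    · exact one_le_halfWeight h
    · exact mul_nonneg (Real.exp_pos _).le (halfWeight_pos R n).le
  have hΛ0 : ∀ d, 0 ≤ ArithmeticFunction.vonMangoldt d :=
    fun d => ArithmeticFunction.vonMangoldt_nonneg
  have hlog : ∑ n ∈ smoothUpTo W y, F n * Real.log n ≤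
      100 * (y ^ (1 - β) * (W ^ β * smoothZeta y β * Real.exp (-(κ / 4)))) := by
    rw [sum_mul_log_eq]
    calc _ ≤ ∑ l ∈ smoothUpTo W y, Real.exp (κ / 4) * halfWeight R l *
            (100 * (y ^ (1 - β) * (W / l) ^ β)) := by
          refine sum_le_sum fun l hl => ?_
          rw [mem_smoothUpTo] at hl
          have hl0 : (0 : ℝ) < l := by exact_mod_cast hl.1
          calc _ ≤ ∑ d ∈ smoothUpTo (W / l) y, F l * ArithmeticFunction.vonMangoldt d := by
                refine sum_le_sum fun d hd => ?_
                rw [mem_smoothUpTo] at hd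
                exact mul_le_mul_of_nonneg_right
                  (hFmul l d (by omega) (by omega)) (hΛ0 d)
            _ = F l * ∑ d ∈ smoothUpTo (W / l) y, ArithmeticFunction.vonMangoldt d :=
                (mul_sum _ _ _).symm
            _ ≤ _ := by
                refine mul_le_mul (hFw l) (sum_vonMangoldt_smoothUpTo_le hy ?_ hβ hβ1)
                  (sum_nonneg fun d _ => hΛ0 d)
                  (mul_nonneg (Real.exp_pos _).le (halfWeight_pos R l).le)
                rw [one_le_div hl0]; exact hl.2.1
      _ = 100 * (y ^ (1 - β) * (W ^ β * Real.exp (κ / 4) *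
            ∑ l ∈ smoothUpTo W y, halfWeight R l * (l : ℝ) ^ (-β))) := by
          rw [mul_sum, mul_sum, mul_sum]
          refine sum_congr rfl fun l hl => ?_
          rw [Real.div_rpow hW0.le (by positivity), Real.rpow_neg (by positivity)]
          ring
      _ ≤ 100 * (y ^ (1 - β) * (W ^ β * Real.exp (κ / 4) *
            (smoothZeta y β * Real.exp (-κ / 2)))) := by
          have h1 := sum_halfWeight_le hβ0 hR W
          have h2 : smoothZeta y β * Real.exp ((-∑ p ∈ R, (p : ℝ) ^ (-β)) / 2) ≤
              smoothZeta y β * Real.exp (-κ / 2) := by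
            refine mul_le_mul_of_nonneg_left ?_ (smoothZeta_pos hβ0).le
            exact Real.exp_le_exp.2 (by linarith)
          have h3 := h1.trans h2
          have hy0 : 0 ≤ y := by linarith
          gcongr
      _ = _ := by
          have : Real.exp (-(κ / 4)) = Real.exp (κ / 4) * Real.exp (-κ / 2) := by
            rw [← Real.exp_add]; ring_nf
          rw [this]; ring
  have hcount : (((smoothUpTo W y).filter
        (fun n : ℕ => ((R.filter (· ∣ n)).card : ℝ) ≤ κ / 4)).card : ℝ) =
      ∑ n ∈ smoothUpTo W y, F n := by
    simp only [hF]
    rw [← sum_filter, sum_const, nsmul_eq_mul, mul_one]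
  have hsplit : ∑ n ∈ smoothUpTo W y, F n ≤
      ∑ n ∈ smoothUpTo W y, (if (n : ℝ) ≤ Real.exp (v / 2) then (1 : ℝ) else 0) +
        2 / v * ∑ n ∈ smoothUpTo W y, F n * Real.log n := by
    rw [mul_sum, ← sum_add_distrib]
    refine sum_le_sum fun n hn => ?_
    rw [mem_smoothUpTo] at hn
    have hlog0 : 0 ≤ Real.log n := Real.log_natCast_nonneg n
    split_ifs with h
    · have : F n ≤ 1 := by simp only [hF]; split_ifs <;> norm_num
      have h2 : 0 ≤ 2 / v * (F n * Real.log n) :=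
        mul_nonneg (by positivity) (mul_nonneg (hF0 n) hlog0)
      linarith
    · have h1 : v / 2 ≤ Real.log n := by
        rw [Real.le_log_iff_exp_le (by exact_mod_cast hn.1)]
        exact (not_le.1 h).le
      have h2 : 1 ≤ 2 / v * Real.log n := by
        rw [div_mul_eq_mul_div, one_le_div hv]; linarith
      nlinarith [hF0 n]
  have hsmall : ∑ n ∈ smoothUpTo W y, (if (n : ℝ) ≤ Real.exp (v / 2) then (1 : ℝ) else 0) ≤
      Real.exp (v / 2) ^ β * smoothZeta y β := by
    refine le_trans ?_ (Psi_le_rpow_mul_smoothZeta (Real.exp_pos _) hβ0)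
    rw [← sum_filter, sum_const, nsmul_eq_mul, mul_one, Psi_eq_card]
    norm_cast
    refine card_le_card fun n hn => ?_
    simp only [mem_filter, mem_smoothUpTo] at hn ⊢
    exact ⟨hn.1.1, hn.2, hn.1.2.2⟩
  rw [hcount]
  refine hsplit.trans (add_le_add hsmall ?_)
  calc _ ≤ 2 / v * (100 * (y ^ (1 - β) * (W ^ β * smoothZeta y β * Real.exp (-(κ / 4))))) := by
        gcongr
    _ = _ := by ring

/-- Lower bound for `Ψ(2 * T * W, y)` in terms of the number of prime factors in `(√y, y/T]` of smooth
numbers up to `W`. -/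
lemma sum_card_prime_factors_le {d : ℝ} (hd : 0 < d)
    (htheta : ∀ t : ℝ, 2 ≤ t → d * t ≤ Chebyshev.theta t) {y T W : ℝ} (hy : 2 ≤ y) (hT : 1 ≤ T)
    (hW : 1 ≤ W) :
    d * T * Real.log y * ∑ n ∈ smoothUpTo W y,
        (((primesBetween (√y) (y / T)).filter (· ∣ n)).card : ℝ) ≤
      4 * (Psi (2 * T * W) y * Real.log (2 * T * W)) := by
  set R := primesBetween (√y) (y / T) with hR
  have hy0 : 0 < y := by linarith
  have hY : 0 < Real.log y := Real.log_pos (by linarith)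
  have hRsub : R ⊆ primesUpTo y := primesBetween_subset_primesUpTo (div_le_self hy0.le hT)
  have hkey := sum_smoothUpTo_mul W y R
    (fun d hd => ⟨(mem_primesBetween.1 hd).1.one_le, isSmooth_prime (hRsub hd)⟩)
    (fun _ => 1) (fun _ => 1)
  have hrhs : ∑ n ∈ smoothUpTo W y, ((R.filter (· ∣ n)).card : ℝ) =
      ∑ l ∈ smoothUpTo W y, ∑ d ∈ R with ((l * d : ℕ) : ℝ) ≤ W, (1 : ℝ) * 1 := by
    rw [hkey]; exact sum_congr rfl fun n _ => by simp
  have hθ0 : ∀ t, 0 ≤ Chebyshev.theta t := Chebyshev.theta_nonneg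
  have h2TW : W ≤ 2 * T * W := by nlinarith
  rw [hrhs, mul_sum]
  refine le_trans ?_ (mul_le_mul_of_nonneg_left (sum_theta_min_le (2 * T * W) y) (by norm_num))
  rw [mul_sum]
  refine le_trans (sum_le_sum fun l hl => ?_) (sum_le_sum_of_subset_of_nonneg
    (smoothUpTo_mono h2TW) fun _ _ _ => mul_nonneg (by norm_num) (hθ0 _))
  rw [mem_smoothUpTo] at hl
  have hl0 : (0 : ℝ) < l := by exact_mod_cast hl.1
  set t := min (y / T) (W / l) with ht
  have hWl : 1 ≤ W / l := by rw [one_le_div hl0]; exact hl.2.1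
  have ht0 : 0 ≤ t := le_min (by positivity) (by positivity)
  have hcount : (∑ d ∈ R with ((l * d : ℕ) : ℝ) ≤ W, (1 : ℝ) * 1) * (Real.log y / 2) ≤
      2 * t := by
    refine le_trans ?_ (theta_le_two_mul ht0)
    rw [theta_eq_sum_primesUpTo, sum_mul]
    refine le_trans (sum_le_sum (g := fun p : ℕ => Real.log p) fun p hp => ?_)
      (sum_le_sum_of_subset_of_nonneg ?_ fun p _ _ => Real.log_natCast_nonneg p)
    · rw [mem_filter, hR, mem_primesBetween] at hp
      rw [one_mul, one_mul, ← Real.log_sqrt hy0.le]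
      exact Real.log_le_log (Real.sqrt_pos.2 hy0) hp.1.2.1.le
    · intro p hp
      rw [mem_filter, hR, mem_primesBetween] at hp
      rw [mem_primesUpTo]
      refine ⟨hp.1.1, le_min hp.1.2.2 ?_⟩
      rw [le_div_iff₀ hl0]
      have := hp.2
      push_cast at this
      linarith
  have hθ : d * (T * t) ≤ Chebyshev.theta (min y (2 * T * W / l)) := by
    refine le_trans ?_ (htheta _ (le_min hy ?_))
    · refine mul_le_mul_of_nonneg_left ?_ hd.le
      refine le_min ?_ ?_
      · calc T * t ≤ T * (y / T) := by gcongr; exact min_le_left _ _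
          _ = y := by field_simp
      · calc T * t ≤ T * (W / l) := by gcongr; exact min_le_right _ _
          _ ≤ 2 * (T * (W / l)) := by
            have : 0 ≤ T * (W / l) := by positivity
            linarith
          _ = _ := by ring
    · calc (2 : ℝ) ≤ 2 * (T * (W / l)) := by nlinarith
        _ = _ := by ring
  calc _ = 2 * d * T * ((∑ d ∈ R with ((l * d : ℕ) : ℝ) ≤ W, (1 : ℝ) * 1) *
        (Real.log y / 2)) := by ring
    _ ≤ 2 * d * T * (2 * t) := by gcongr
    _ = 4 * (d * (T * t)) := by ring
    _ ≤ _ := by gcongr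

lemma exists_forall_sq_mul_exp_le (A C b : ℝ) (hA : 0 ≤ A) (hb : 0 < b) :
    ∃ U : ℝ, 1 ≤ U ∧ ∀ u, U ≤ u →
      A * u ^ 2 * Real.exp (C * √u - b * u ^ ((3 : ℝ) / 4)) ≤ 1 / 4 := by
  have h := (Real.tendsto_pow_mul_exp_neg_atTop_nhds_zero 8).const_mul A
  rw [mul_zero] at h
  have h' := (h.eventually_le_const (show (0 : ℝ) < 1 / 4 by norm_num))
  obtain ⟨w₀, hw₀⟩ := Filter.eventually_atTop.1 h'
  set w₁ := max (max w₀ 1) ((|C| + 1) / b) with hw₁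
  have hw₁1 : 1 ≤ w₁ := (le_max_right _ _).trans (le_max_left _ _)
  refine ⟨w₁ ^ 4, one_le_pow₀ hw₁1, fun u hu => ?_⟩
  have hu1 : 1 ≤ u := (one_le_pow₀ hw₁1).trans hu
  have hu0 : 0 ≤ u := by linarith
  set w := u ^ ((1 : ℝ) / 4) with hw
  have hww : w₁ ≤ w := by
    have h1 : (w₁ ^ 4) ^ ((1 : ℝ) / 4) ≤ w := by
      exact Real.rpow_le_rpow (by positivity) hu (by norm_num)
    have h2 : (w₁ ^ 4) ^ ((1 : ℝ) / 4) = w₁ := by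
      rw [← Real.rpow_natCast, ← Real.rpow_mul (by linarith)]; norm_num
    rwa [h2] at h1
  have hw0 : 0 ≤ w := by linarith
  have e1 : w ^ 4 = u := by
    rw [hw, ← Real.rpow_natCast, ← Real.rpow_mul hu0]; norm_num
  have e2 : √u = w ^ 2 := by
    rw [← e1, show w ^ 4 = w ^ 2 * w ^ 2 by ring, Real.sqrt_mul_self (by positivity)]
  have e3 : u ^ ((3 : ℝ) / 4) = w ^ 3 := by
    rw [hw, ← Real.rpow_natCast, ← Real.rpow_mul hu0]; norm_num
  have hbw : |C| + 1 ≤ b * w := by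
    have : (|C| + 1) / b ≤ w := (le_max_right _ _).trans hww
    rw [div_le_iff₀ hb] at this
    linarith
  have hexp : C * √u - b * u ^ ((3 : ℝ) / 4) ≤ -w := by
    rw [e2, e3]
    have h1 : C * w ^ 2 ≤ |C| * w ^ 2 := by gcongr; exact le_abs_self C
    have h2 : (|C| + 1) * w ^ 2 ≤ b * w * w ^ 2 := by gcongr
    have h3 : w ≤ w ^ 2 := by nlinarith
    nlinarith
  have h4 := hw₀ w (((le_max_left _ _).trans (le_max_left _ _)).trans hww)
  calc _ ≤ A * u ^ 2 * Real.exp (-w) := by gcongr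
    _ = A * (w ^ 8 * Real.exp (-w)) := by rw [← e1]; ring
    _ ≤ _ := h4

set_option maxHeartbeats 1000000 in
lemma exists_Psi_mul_ge_large : ∃ c U₀ y₀ : ℝ, 0 < c ∧ 1 ≤ U₀ ∧ 3 ≤ y₀ ∧ ∀ y α v T : ℝ,
    y₀ ≤ y → 1 / 20 ≤ α → α ≤ 1 → U₀ * Real.log y ≤ v → v ≤ smoothLogDeriv y α →
    1 ≤ T → T ≤ y ^ ((1 : ℝ) / 8) →
    c * T ^ α * Psi (Real.exp v) y ≤ Psi (2 * T * Real.exp v) y := by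
  obtain ⟨C₂, U₂, y₂, hC₂, hU₂, hy₂, hsaddle⟩ := exists_saddle_lower
  obtain ⟨c, y₁, hc, hy₁, hprimes⟩ := exists_sum_primesBetween_ge
  obtain ⟨d, hd, hd1, htheta⟩ := exists_mul_le_theta
  set b := c / 2 * c ^ ((1 : ℝ) / 8) with hb
  have hb0 : 0 < b := by positivity
  obtain ⟨U₃, hU₃, h3⟩ := exists_forall_sq_mul_exp_le C₂ C₂ (1 / 40) (by linarith) (by norm_num)
  obtain ⟨U₄, hU₄, h4⟩ := exists_forall_sq_mul_exp_le (200 * C₂ / c) C₂ (b / 4)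
    (by positivity) (by positivity)
  refine ⟨d * c / 128, max (max U₂ U₃) (max U₄ 2), max (max y₁ y₂) (Real.exp 8), by positivity,
    le_max_of_le_left (le_max_of_le_left hU₂), le_max_of_le_left (le_max_of_le_right hy₂),
    fun y α v T hy hα hα1 hv hvm hT hTy => ?_⟩
  have hyexp : Real.exp 8 ≤ y := (le_max_right _ _).trans hy
  have hy3 : 3 ≤ y := hy₂.trans (((le_max_right _ _).trans (le_max_left _ _)).trans hy)
  have hy0 : 0 < y := by linarith
  have hY : 8 ≤ Real.log y := (Real.le_log_iff_exp_le hy0).2 hyexp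
  have hYpos : 0 < Real.log y := by linarith
  set u := v / Real.log y with hu
  have hvu : v = u * Real.log y := by rw [hu]; field_simp
  have huU : max (max U₂ U₃) (max U₄ 2) ≤ u := (le_div_iff₀ hYpos).2 hv
  have hu2 : U₂ ≤ u := ((le_max_left _ _).trans (le_max_left _ _)).trans huU
  have hu3 : U₃ ≤ u := ((le_max_right _ _).trans (le_max_left _ _)).trans huU
  have hu4 : U₄ ≤ u := ((le_max_left _ _).trans (le_max_right _ _)).trans huU
  have hu5 : 2 ≤ u := ((le_max_right _ _).trans (le_max_right _ _)).trans huU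
  have hu0 : 0 < u := by linarith
  have huv : u ≤ v := by rw [hvu]; exact le_mul_of_one_le_right hu0.le (by linarith)
  have hv0 : 0 < v := by linarith
  obtain ⟨β, hαβ, hβ1, hm1, hm2, hΨ⟩ := hsaddle y α v
    (((le_max_right _ _).trans (le_max_left _ _)).trans hy) hα hα1
    ((le_div_iff₀ hYpos).1 hu2) hvm
  have hβ20 : 1 / 20 ≤ β := hα.trans hαβ
  have hβ0 : 0 < β := by linarith
  obtain ⟨hP, hyβ⟩ := hprimes y β (((le_max_left _ _).trans (le_max_left _ _)).trans hy) hβ20 hβ1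
  have hT0 : 0 < T := by linarith
  have hμ1 : u / 2 ≤ smoothLogDeriv y β / Real.log y := by
    rw [le_div_iff₀ hYpos, hu]; field_simp; linarith
  have hμ2 : smoothLogDeriv y β / Real.log y ≤ u := by
    rw [hu]; gcongr
  have hyβ' : y ^ (1 - β) ≤ u ^ 2 / c := by
    rw [le_div_iff₀ hc, mul_comm]
    exact hyβ.trans (by gcongr; linarith)
  have hTβ : T ^ (1 - β) ≤ (u ^ 2 / c) ^ ((1 : ℝ) / 8) := by
    calc T ^ (1 - β) ≤ (y ^ ((1 : ℝ) / 8)) ^ (1 - β) :=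
          Real.rpow_le_rpow hT0.le hTy (by linarith)
      _ = (y ^ (1 - β)) ^ ((1 : ℝ) / 8) := by
          rw [← Real.rpow_mul hy0.le, ← Real.rpow_mul hy0.le, mul_comm]
      _ ≤ _ := Real.rpow_le_rpow (by positivity) hyβ' (by norm_num)
  set κ := c * T ^ (β - 1) * (u / 2) with hκ
  have hκ0 : 0 < κ := by positivity
  set R := primesBetween (√y) (y / T) with hR
  have hRsub : R ⊆ primesUpTo y := primesBetween_subset_primesUpTo (div_le_self hy0.le hT)
  have hκρ : κ ≤ ∑ p ∈ R, (p : ℝ) ^ (-β) := by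
    refine le_trans ?_ (hP T hT hTy)
    rw [hκ]; gcongr
  have hκb : b * u ^ ((3 : ℝ) / 4) ≤ κ := by
    have h1 : T ^ (β - 1) * T ^ (1 - β) = 1 := by
      rw [← Real.rpow_add hT0]; simp
    have h2 : (u ^ 2 / c) ^ ((1 : ℝ) / 8) * c ^ ((1 : ℝ) / 8) = u ^ ((1 : ℝ) / 4) := by
      rw [← Real.mul_rpow (by positivity) hc.le, div_mul_cancel₀ _ hc.ne', ← Real.rpow_natCast,
        ← Real.rpow_mul hu0.le]
      norm_num
    have h3 : u ^ ((3 : ℝ) / 4) * u ^ ((1 : ℝ) / 4) = u := by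
      rw [← Real.rpow_add hu0]; norm_num
    have h5 : c ^ ((1 : ℝ) / 8) ≤ T ^ (β - 1) * u ^ ((1 : ℝ) / 4) := by
      calc c ^ ((1 : ℝ) / 8) = T ^ (β - 1) * T ^ (1 - β) * c ^ ((1 : ℝ) / 8) := by
            rw [h1, one_mul]
        _ ≤ T ^ (β - 1) * (u ^ 2 / c) ^ ((1 : ℝ) / 8) * c ^ ((1 : ℝ) / 8) := by gcongr
        _ = _ := by rw [mul_assoc, h2]
    calc b * u ^ ((3 : ℝ) / 4) = c / 2 * u ^ ((3 : ℝ) / 4) * c ^ ((1 : ℝ) / 8) := by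
          rw [hb]; ring
      _ ≤ c / 2 * u ^ ((3 : ℝ) / 4) * (T ^ (β - 1) * u ^ ((1 : ℝ) / 4)) := by gcongr
      _ = c / 2 * T ^ (β - 1) * (u ^ ((3 : ℝ) / 4) * u ^ ((1 : ℝ) / 4)) := by ring
      _ = κ := by rw [h3, hκ]; ring
  have hfew := card_few_prime_factors_le hy3 hβ20 hβ1 hv0 hRsub hκρ
  set W := Real.exp v with hW
  have hW0 : 0 < W := Real.exp_pos v
  have hW1 : 1 ≤ W := Real.one_le_exp hv0.le
  set P := (Psi W y : ℝ) with hPsi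
  have hP0 : 0 ≤ P := by positivity
  have hterm1 : Real.exp (v / 2) ^ β * smoothZeta y β ≤ 1 / 4 * P := by
    have e1 : Real.exp (v / 2) ^ β = Real.exp (-(v / 2 * β)) * W ^ β := by
      rw [hW, ← Real.exp_mul, ← Real.exp_mul, ← Real.exp_add]; ring_nf
    have h1 := h3 v (hu3.trans huv)
    have hv34 : v ^ ((3 : ℝ) / 4) ≤ v := by
      calc v ^ ((3 : ℝ) / 4) ≤ v ^ (1 : ℝ) :=
            Real.rpow_le_rpow_of_exponent_le (by linarith) (by norm_num)
        _ = v := Real.rpow_one v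
    calc _ = Real.exp (-(v / 2 * β)) * (W ^ β * smoothZeta y β) := by rw [e1]; ring
      _ ≤ Real.exp (-(1 / 40 * v ^ ((3 : ℝ) / 4))) *
          (C₂ * v * Real.exp (C₂ * √u) * P) := by
          refine mul_le_mul (Real.exp_le_exp.2 ?_) hΨ
            (mul_nonneg (by positivity) (smoothZeta_pos hβ0).le) (Real.exp_pos _).le
          linarith [mul_le_mul_of_nonneg_left hβ20 hv0.le]
      _ ≤ Real.exp (-(1 / 40 * v ^ ((3 : ℝ) / 4))) *
          (C₂ * v ^ 2 * Real.exp (C₂ * √v) * P) := by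
          gcongr
          exact le_self_pow₀ (by linarith) two_ne_zero
      _ = C₂ * v ^ 2 * Real.exp (C₂ * √v - 1 / 40 * v ^ ((3 : ℝ) / 4)) * P := by
          rw [sub_eq_add_neg, Real.exp_add]; ring
      _ ≤ _ := by gcongr
  have hterm2 : 200 / v * (y ^ (1 - β) * (W ^ β * smoothZeta y β * Real.exp (-(κ / 4)))) ≤
      1 / 4 * P := by
    have h1 := h4 u hu4
    calc _ = 200 / v * y ^ (1 - β) * Real.exp (-(κ / 4)) * (W ^ β * smoothZeta y β) := by ring
      _ ≤ 200 / v * (u ^ 2 / c) * Real.exp (-(b / 4 * u ^ ((3 : ℝ) / 4))) *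
          (C₂ * v * Real.exp (C₂ * √u) * P) := by
          have : 0 ≤ W ^ β * smoothZeta y β :=
            mul_nonneg (by positivity) (smoothZeta_pos hβ0).le
          gcongr
          linarith
      _ = 200 * C₂ / c * u ^ 2 * Real.exp (C₂ * √u - b / 4 * u ^ ((3 : ℝ) / 4)) * P := by
          rw [sub_eq_add_neg, Real.exp_add]; field_simp
      _ ≤ _ := by gcongr
  have hmany : κ / 8 * P ≤ ∑ n ∈ smoothUpTo W y, ((R.filter (· ∣ n)).card : ℝ) := by
    have h1 : ∑ n ∈ smoothUpTo W y,
        (κ / 4 - if ((R.filter (· ∣ n)).card : ℝ) ≤ κ / 4 then κ / 4 else 0) ≤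
        ∑ n ∈ smoothUpTo W y, ((R.filter (· ∣ n)).card : ℝ) := by
      refine sum_le_sum fun n _ => ?_
      split_ifs with h
      · simp
      · linarith
    refine le_trans ?_ h1
    rw [sum_sub_distrib, ← sum_filter, sum_const, sum_const, nsmul_eq_mul, nsmul_eq_mul,
      ← Psi_eq_card]
    linarith [mul_le_mul_of_nonneg_right hfew hκ0.le, mul_le_mul_of_nonneg_right hterm1 hκ0.le,
      mul_le_mul_of_nonneg_right hterm2 hκ0.le]
  have hsum := sum_card_prime_factors_le hd htheta (y := y) (by linarith) hT hW1
  have hlog : Real.log (2 * T * W) ≤ 2 * v := by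
    rw [Real.log_mul (by positivity) hW0.ne', Real.log_mul (by norm_num) hT0.ne', hW,
      Real.log_exp]
    have h1 : Real.log T ≤ 1 / 8 * Real.log y := by
      rw [← Real.log_rpow hy0]; exact Real.log_le_log hT0 hTy
    have h2 := Real.log_two_lt_d9
    have h3 : 2 * Real.log y ≤ v := by rw [hvu]; gcongr
    linarith
  set P' := (Psi (2 * T * W) y : ℝ) with hP'
  have hP'0 : 0 ≤ P' := by positivity
  have hfinal : d * T * Real.log y * (κ / 8 * P) ≤ 4 * (P' * (2 * v)) :=
    calc _ ≤ d * T * Real.log y * ∑ n ∈ smoothUpTo W y, ((R.filter (· ∣ n)).card : ℝ) := by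
          gcongr
      _ ≤ _ := hsum
      _ ≤ _ := by gcongr
  have hTα : T ^ α ≤ T * T ^ (β - 1) := by
    calc T ^ α ≤ T ^ β := Real.rpow_le_rpow_of_exponent_le hT hαβ
      _ = T ^ (1 + (β - 1)) := by ring_nf
      _ = _ := by rw [Real.rpow_add hT0, Real.rpow_one]
  refine le_of_mul_le_mul_right ?_ (show 0 < 8 * v by linarith)
  calc d * c / 128 * T ^ α * P * (8 * v)
      ≤ d * c / 128 * (T * T ^ (β - 1)) * P * (8 * v) := by gcongr
    _ = d * T * Real.log y * (κ / 8 * P) := by rw [hκ, hvu]; ring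
    _ ≤ _ := hfinal
    _ = _ := by ring

/-- Smooth numbers have positive density up to any fixed power of `y`. -/
lemma exists_Psi_ge_mul : ∃ y₀ : ℝ, 3 ≤ y₀ ∧ ∀ k : ℕ, ∃ c : ℝ, 0 < c ∧ ∀ y V : ℝ, y₀ ≤ y →
    1 ≤ V → V ≤ y ^ (1 + (k : ℝ) / 2) → c * V ≤ Psi V y := by
  obtain ⟨c₁, y₁, hc₁, hy₁, hprimes⟩ := exists_sum_primesBetween_ge
  refine ⟨max y₁ 3, le_max_right _ _, fun k => ?_⟩
  have hbase : ∀ y V : ℝ, 1 ≤ V → V ≤ y → 1 / 2 * V ≤ Psi V y := by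
    intro y V hV hVy
    rw [Psi_eq_floor hVy]
    have h1 := Nat.lt_floor_add_one V
    have h2 : (1 : ℝ) ≤ ⌊V⌋₊ := by exact_mod_cast (Nat.one_le_floor_iff V).2 hV
    linarith
  induction k with
  | zero => exact ⟨1 / 2, by norm_num, fun y V _ hV hVy => hbase y V hV (by simpa using hVy)⟩
  | succ k ih =>
    obtain ⟨c, hc, hck⟩ := ih
    refine ⟨min (1 / 2) (c * (c₁ * √c₁) / (k + 3)), by positivity, fun y V hy hV hVy => ?_⟩
    rcases le_or_gt V y with hVy' | hVy'
    · exact le_trans (by gcongr; exact min_le_left _ _) (hbase y V hV hVy')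
    have hy3 : 3 ≤ y := (le_max_right _ _).trans hy
    have hy0 : 0 < y := by linarith
    have hYpos : 0 < Real.log y := Real.log_pos (by linarith)
    have hV0 : 0 < V := by linarith
    have hlogV : Real.log V ≤ (k + 3) / 2 * Real.log y := by
      have := Real.log_le_log hV0 hVy
      rw [Real.log_rpow hy0] at this
      push_cast at this
      linarith
    have hlogV0 : 0 < Real.log V := Real.log_pos (by linarith)
    obtain ⟨hP, hm⟩ := hprimes y 1 ((le_max_left _ _).trans hy) (by norm_num) le_rfl
    have hP1 := hP 1 le_rfl (Real.one_le_rpow (by linarith) (by norm_num))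
    rw [sub_self, Real.rpow_zero, mul_one] at hm
    rw [sub_self, Real.rpow_zero, mul_one, div_one] at hP1
    have hμ : √c₁ ≤ smoothLogDeriv y 1 / Real.log y :=
      Real.sqrt_le_iff.2 ⟨div_nonneg (smoothLogDeriv_nonneg (by norm_num)) hYpos.le, hm⟩
    have hsum := sum_log_mul_Psi_le (X := V) hVy'.le
    have hlow : c * V * (Real.log y / 2) * ∑ p ∈ primesBetween (√y) y, (p : ℝ) ^ (-(1 : ℝ)) ≤
        ∑ p ∈ primesUpTo y, Real.log p * Psi (V / p) y := by
      rw [mul_sum]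
      refine le_trans (sum_le_sum fun p hp => ?_) (sum_le_sum_of_subset_of_nonneg
        (primesBetween_subset_primesUpTo le_rfl) fun p _ _ =>
          mul_nonneg (Real.log_natCast_nonneg p) (by positivity))
      rw [mem_primesBetween] at hp
      have hp0 : (0 : ℝ) < p := by exact_mod_cast hp.1.pos
      have hlogp : Real.log y / 2 ≤ Real.log p := by
        rw [← Real.log_sqrt hy0.le]
        exact Real.log_le_log (Real.sqrt_pos.2 hy0) hp.2.1.le
      have h1 : 1 ≤ V / p := by rw [one_le_div hp0]; linarith [hp.2.2]
      have h2 : V / p ≤ y ^ (1 + (k : ℝ) / 2) := by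
        rw [div_le_iff₀ hp0]
        calc V ≤ _ := hVy
          _ = y ^ (1 + (k : ℝ) / 2) * √y := by
              rw [Real.sqrt_eq_rpow, ← Real.rpow_add hy0]
              push_cast; ring_nf
          _ ≤ _ := by gcongr; exact hp.2.1.le
      have h3 := hck y (V / p) hy h1 h2
      rw [Real.rpow_neg hp0.le, Real.rpow_one]
      calc _ = Real.log y / 2 * (c * (V / p)) := by ring
        _ ≤ _ := by gcongr
    have hmain : c * V * (Real.log y / 2) * (c₁ * √c₁) ≤
        Psi V y * ((k + 3) / 2 * Real.log y) := by
      calc _ ≤ c * V * (Real.log y / 2) *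
            ∑ p ∈ primesBetween (√y) y, (p : ℝ) ^ (-(1 : ℝ)) := by
            gcongr
            exact le_trans (by gcongr) hP1
        _ ≤ _ := hlow
        _ ≤ _ := hsum
        _ ≤ _ := by gcongr
    refine le_trans (mul_le_mul_of_nonneg_right (min_le_right _ _) hV0.le) ?_
    rw [div_mul_eq_mul_div, div_le_iff₀ (by positivity)]
    have h5 : 0 < Real.log y / 2 := by positivity
    nlinarith

lemma exists_Psi_mul_ge : ∃ c y₀ : ℝ, 0 < c ∧ c ≤ 1 ∧ 3 ≤ y₀ ∧ ∀ y α W T : ℝ,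
    y₀ ≤ y → 1 / 20 ≤ α → α ≤ 1 → 1 ≤ W → Real.log W ≤ smoothLogDeriv y α →
    1 ≤ T → T ≤ y ^ ((1 : ℝ) / 8) →
    c * T ^ α * Psi W y ≤ Psi (T * W) y := by
  obtain ⟨c, U₀, y₁, hc, hU₀, hy₁, hlarge⟩ := exists_Psi_mul_ge_large
  obtain ⟨y₂, hy₂, hsmall⟩ := exists_Psi_ge_mul
  obtain ⟨c', hc', hsmall'⟩ := hsmall ⌈2 * U₀⌉₊
  set c'' := min (min c c') 1 with hc''
  have hcc : c'' ≤ c := (min_le_left _ _).trans (min_le_left _ _)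
  have hcc' : c'' ≤ c' := (min_le_left _ _).trans (min_le_right _ _)
  have hc''0 : 0 < c'' := by positivity
  refine ⟨c'' / 2, max y₁ y₂, by positivity, by linarith [min_le_right (min c c') 1],
    le_max_of_le_left hy₁, fun y α W T hy hα hα1 hW hWm hT hTy => ?_⟩
  have hW0 : 0 < W := by linarith
  have hT0 : 0 < T := by linarith
  have hα0 : 0 ≤ α := by linarith
  have hΨ0 : (0 : ℝ) ≤ Psi W y := by positivity
  have hTα : T ^ α ≤ T :=
    calc T ^ α ≤ T ^ (1 : ℝ) := Real.rpow_le_rpow_of_exponent_le hT hα1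
      _ = T := Real.rpow_one T
  rcases lt_or_ge T 2 with hT2 | hT2
  · have h1 : (Psi W y : ℝ) ≤ Psi (T * W) y := Psi_mono (by nlinarith)
    have h2 : c'' / 2 * T ^ α ≤ 1 := by
      have : c'' ≤ 1 := min_le_right _ _
      have : 0 ≤ T ^ α := by positivity
      nlinarith
    calc _ ≤ 1 * (Psi W y : ℝ) := by gcongr
      _ ≤ _ := by linarith
  have hT' : T ^ α / 2 ≤ (T / 2) ^ α := by
    rw [Real.div_rpow hT0.le (by norm_num)]
    have : (2 : ℝ) ^ α ≤ 2 ^ (1 : ℝ) := Real.rpow_le_rpow_of_exponent_le (by norm_num) hα1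
    rw [Real.rpow_one] at this
    gcongr
  have hy3 : 3 ≤ y := hy₁.trans ((le_max_left _ _).trans hy)
  have hy0 : 0 < y := by linarith
  rcases le_or_gt (U₀ * Real.log y) (Real.log W) with hv | hv
  · have h := hlarge y α (Real.log W) (T / 2) ((le_max_left _ _).trans hy) hα hα1 hv hWm
      (by linarith) (by linarith)
    rw [Real.exp_log hW0, show 2 * (T / 2) * W = T * W by ring] at h
    refine le_trans ?_ h
    calc c'' / 2 * T ^ α * (Psi W y : ℝ) = c'' * (T ^ α / 2) * Psi W y := by ring
      _ ≤ _ := by gcongr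
  · have hWy : W ≤ y ^ U₀ := by
      rw [← Real.exp_log hW0, Real.rpow_def_of_pos hy0, mul_comm]
      exact Real.exp_le_exp.2 hv.le
    have h := hsmall' y (T * W) ((le_max_right _ _).trans hy) (by nlinarith) ?_
    · refine le_trans ?_ h
      have h1 := Psi_le_self hW0.le y
      calc c'' / 2 * T ^ α * (Psi W y : ℝ) ≤ c'' / 2 * T * W := by gcongr
        _ ≤ c' * (T * W) := by
          have : 0 ≤ T * W := by positivity
          nlinarith
    · calc T * W ≤ y ^ ((1 : ℝ) / 8) * y ^ U₀ := by gcongr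
        _ = y ^ ((1 : ℝ) / 8 + U₀) := (Real.rpow_add hy0 _ _).symm
        _ ≤ _ := by
          refine Real.rpow_le_rpow_of_exponent_le (by linarith) ?_
          have := Nat.le_ceil (2 * U₀)
          linarith

/-- Smooth numbers are at least as dense as the saddle point predicts. -/
lemma exists_rpow_mul_Psi_le : ∃ c y₀ : ℝ, 0 < c ∧ 3 ≤ y₀ ∧ ∀ y α W X : ℝ,
    y₀ ≤ y → 1 / 20 ≤ α → α ≤ 1 → 1 ≤ W → W ≤ X →
    Real.log X ≤ smoothLogDeriv y α - Real.log y →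
    c * (X / W) ^ α * Psi W y ≤ Psi X y := by
  obtain ⟨c, y₁, hc, hc1, hy₁, hstep⟩ := exists_Psi_mul_ge
  obtain ⟨y₂, hy₂, htail⟩ := exists_smoothLogDeriv_tail
  refine ⟨c ^ 328, max y₁ y₂, by positivity, le_max_of_le_left hy₁,
    fun y α W X hy hα hα1 hW hWX hXm => ?_⟩
  have hy1 := (le_max_left _ _).trans hy
  have hy2 := (le_max_right _ _).trans hy
  have hy3 : 3 ≤ y := hy₁.trans hy1
  have hy0 : 0 < y := by linarith
  have hYpos : 0 < Real.log y := Real.log_pos (by linarith)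
  have hα0 : 0 ≤ α := by linarith
  have hW0 : 0 < W := by linarith
  obtain ⟨N, hN⟩ := pow_unbounded_of_one_lt (X / W) (one_lt_two (α := ℝ))
  have hshort : ∀ X, W ≤ X → Real.log X ≤ smoothLogDeriv y α - Real.log y →
      X / W ≤ y ^ (41 : ℝ) → c ^ 328 * (X / W) ^ α * Psi W y ≤ Psi X y := by
    intro X hWX hXm hXW
    have hX0 : 0 < X := by linarith
    have hr1 : 1 ≤ X / W := by rwa [one_le_div hW0]
    set T := (X / W) ^ ((1 : ℝ) / 328) with hT
    have hT1 : 1 ≤ T := Real.one_le_rpow hr1 (by norm_num)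
    have hTy : T ≤ y ^ ((1 : ℝ) / 8) := by
      calc T ≤ (y ^ (41 : ℝ)) ^ ((1 : ℝ) / 328) :=
            Real.rpow_le_rpow (by linarith) hXW (by norm_num)
        _ = _ := by rw [← Real.rpow_mul hy0.le]; norm_num
    have hT328 : T ^ 328 = X / W := by
      rw [hT, ← Real.rpow_natCast, ← Real.rpow_mul (by linarith)]; norm_num
    have hiter : ∀ i : ℕ, i ≤ 328 →
        c ^ i * (T ^ i) ^ α * Psi W y ≤ Psi (T ^ i * W) y := by
      intro i
      induction i with
      | zero => intro _; simp
      | succ i ih =>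
        intro hi
        have h1 := ih (by omega)
        have hTi : 1 ≤ T ^ i := one_le_pow₀ hT1
        have h2 : T ^ i * W ≤ X := by
          calc T ^ i * W ≤ T ^ 328 * W := by
                gcongr
                omega
            _ = X := by rw [hT328]; field_simp
        have h3 := hstep y α (T ^ i * W) T hy1 hα hα1 (by nlinarith)
          ((Real.log_le_log (by positivity) h2).trans (by linarith)) hT1 hTy
        calc c ^ (i + 1) * (T ^ (i + 1)) ^ α * (Psi W y : ℝ)
            = c * T ^ α * (c ^ i * (T ^ i) ^ α * Psi W y) := by
              rw [pow_succ T, Real.mul_rpow (by positivity) (by positivity)]; ring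
          _ ≤ c * T ^ α * Psi (T ^ i * W) y := by gcongr
          _ ≤ _ := h3
          _ = _ := by rw [pow_succ]; ring_nf
    have := hiter 328 le_rfl
    rw [hT328] at this
    rwa [div_mul_cancel₀ _ hW0.ne'] at this
  clear hstep
  induction N generalizing X with
  | zero =>
    have h41 : 1 ≤ y ^ (41 : ℝ) := Real.one_le_rpow (by linarith) (by norm_num)
    exact hshort X hWX hXm (hN.le.trans (by rwa [pow_zero]))
  | succ N ih =>
    rcases le_or_gt (X / W) (y ^ (41 : ℝ)) with h41 | h41
    · exact hshort X hWX hXm h41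
    have hX0 : 0 < X := by linarith
    have hX1 : 1 < X := by
      have h1 : 1 < X / W := lt_of_le_of_lt (Real.one_le_rpow (by linarith) (by norm_num)) h41
      rw [one_lt_div hW0] at h1
      linarith
    have hlogX : 0 < Real.log X := Real.log_pos hX1
    refine le_of_mul_le_mul_right ?_ hlogX
    refine le_trans ?_ (sum_vonMangoldt_mul_Psi_le X y)
    have ht := htail y α (X / W) hy2 hα h41.le
    have hΨ0 : (0 : ℝ) ≤ Psi W y := by positivity
    calc c ^ 328 * (X / W) ^ α * (Psi W y : ℝ) * Real.log X
        ≤ c ^ 328 * (X / W) ^ α * (Psi W y : ℝ) *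
          ∑ d ∈ smoothUpTo (X / W) y, ArithmeticFunction.vonMangoldt d * (d : ℝ) ^ (-α) := by
          gcongr
          linarith
      _ = ∑ d ∈ smoothUpTo (X / W) y, ArithmeticFunction.vonMangoldt d *
          (c ^ 328 * (X / d / W) ^ α * Psi W y) := by
          rw [mul_sum]
          refine sum_congr rfl fun d _ => ?_
          rw [div_right_comm X, Real.div_rpow (x := X / W) (by positivity) (by positivity),
            Real.rpow_neg (by positivity)]
          ring
      _ ≤ ∑ d ∈ smoothUpTo (X / W) y, ArithmeticFunction.vonMangoldt d * Psi (X / d) y := by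
          refine sum_le_sum fun d hd => ?_
          rw [mem_smoothUpTo] at hd
          rcases eq_or_lt_of_le hd.1 with h1 | h2
          · rw [← h1]; simp
          have hd2 : (2 : ℝ) ≤ d := by exact_mod_cast h2
          refine mul_le_mul_of_nonneg_left ?_ ArithmeticFunction.vonMangoldt_nonneg
          have hWd : W ≤ X / d := by
            rw [le_div_iff₀ (by linarith), mul_comm, ← le_div_iff₀ hW0]; exact hd.2.1
          have hXd : X / d ≤ X := div_le_self hX0.le (by linarith)
          refine ih (X / d) hWd ((Real.log_le_log (by positivity) hXd).trans hXm) ?_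
          rw [div_right_comm, div_lt_iff₀ (by linarith)]
          calc X / W < 2 ^ (N + 1) := hN
            _ = 2 ^ N * 2 := pow_succ _ _
            _ ≤ _ := by gcongr
      _ ≤ ∑ d ∈ smoothUpTo X y, ArithmeticFunction.vonMangoldt d * Psi (X / d) y :=
          sum_le_sum_of_subset_of_nonneg (smoothUpTo_mono (div_le_self hX0.le hW)) fun d _ _ =>
            mul_nonneg ArithmeticFunction.vonMangoldt_nonneg (by positivity)

lemma card_le_of_modEq_of_abs_sub_le {T : Finset ℕ} {M : ℕ} (hM : 1 ≤ M) {D : ℝ} (hD : 0 ≤ D)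
    (hmod : ∀ n ∈ T, ∀ n' ∈ T, n ≡ n' [MOD M])
    (hdist : ∀ n ∈ T, ∀ n' ∈ T, (n : ℝ) - n' ≤ D) : (T.card : ℝ) ≤ D / M + 1 := by
  rcases T.eq_empty_or_nonempty with rfl | hT
  · simp; positivity
  have hM0 : (0 : ℝ) < M := by exact_mod_cast hM
  obtain ⟨m, hm, hmin⟩ := exists_min_image T id hT
  have hcard : T.card ≤ (range (⌊D / M⌋₊ + 1)).card := by
    refine card_le_card_of_injOn (fun n => (n - m) / M) (fun n hn => ?_) fun n hn n' hn' h => ?_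
    · rw [coe_range, Set.mem_Iio, Nat.lt_succ_iff, Nat.le_floor_iff (by positivity)]
      refine Nat.cast_div_le.trans ?_
      have h1 : m ≤ n := hmin n hn
      rw [Nat.cast_sub h1]
      gcongr
      exact hdist n hn m hm
    · have h1 : m ≤ n := hmin n hn
      have h2 : m ≤ n' := hmin n' hn'
      have d1 : M ∣ n - m := (Nat.modEq_iff_dvd' h1).1 (hmod m hm n hn)
      have d2 : M ∣ n' - m := (Nat.modEq_iff_dvd' h2).1 (hmod m hm n' hn')
      have := Nat.div_mul_cancel d1
      have h3 := Nat.div_mul_cancel d2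
      simp only at h
      rw [h, h3] at this
      omega
  rw [card_range] at hcard
  have h1 : (T.card : ℝ) ≤ (⌊D / M⌋₊ : ℝ) + 1 := by exact_mod_cast hcard
  have h2 := Nat.floor_le (show 0 ≤ D / M by positivity)
  linarith

/-- A smooth number exceeding `W` has a divisor in `(W / y, W]`. -/
lemma exists_dvd_mem_smoothUpTo {y W : ℝ} (hW : 1 ≤ W) {n : ℕ} (hn : 1 ≤ n)
    (hs : IsSmooth y n) (hnW : W < n) :
    ∃ l ∈ smoothUpTo W y, l ∣ n ∧ W < l * y := by
  obtain ⟨l, hl, hmax⟩ := exists_max_image (n.divisors.filter fun l : ℕ => (l : ℝ) ≤ W) id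
    ⟨1, by simp only [mem_filter, Nat.mem_divisors, one_dvd, Nat.cast_one, true_and]
           exact ⟨by omega, hW⟩⟩
  rw [mem_filter, Nat.mem_divisors] at hl
  obtain ⟨⟨⟨k, hk⟩, hn0⟩, hlW⟩ := hl
  have hl0 : 1 ≤ l := Nat.one_le_iff_ne_zero.2 fun h => hn0 (by rw [hk, h, zero_mul])
  refine ⟨l, mem_smoothUpTo.2 ⟨hl0, hlW, hs.of_dvd ⟨k, hk⟩⟩, ⟨k, hk⟩, ?_⟩
  have hk1 : k ≠ 1 := by
    rintro rfl
    rw [mul_one] at hk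
    rw [hk] at hnW
    linarith
  obtain ⟨p, hp, hpk⟩ := Nat.exists_prime_and_dvd hk1
  have hpn : l * p ∣ n := by rw [hk]; exact mul_dvd_mul_left l hpk
  have hpy : (p : ℝ) ≤ y := hs p hp ((Dvd.intro_left l rfl).trans hpn)
  by_contra! hcon
  have hlp : ((l * p : ℕ) : ℝ) ≤ W := by
    push_cast
    exact le_trans (by gcongr) hcon
  have := hmax (l * p) (by
    rw [mem_filter, Nat.mem_divisors]; exact ⟨⟨hpn, hn0⟩, hlp⟩)
  simp only [id] at this
  have h2 := hp.two_le
  nlinarith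

lemma exists_sum_div_le : ∃ C : ℝ, 1 ≤ C ∧ ∀ y W : ℝ, 1 ≤ W →
    ∑ l ∈ (smoothUpTo W y).filter (fun l : ℕ => W < l * y), W / l ≤
      C * (Psi W y * (1 + Real.log W)) := by
  obtain ⟨d, hd, hd1, htheta⟩ := exists_mul_le_theta
  refine ⟨2 + 1 / d, by have : 0 < 1 / d := by positivity
                        linarith, fun y W hW => ?_⟩
  have hth : ∀ t, 0 ≤ Chebyshev.theta t := Chebyshev.theta_nonneg
  have hlogW : 0 ≤ Real.log W := Real.log_nonneg hW
  have hΨ0 : (0 : ℝ) ≤ Psi W y := by positivity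
  calc _ ≤ ∑ l ∈ (smoothUpTo W y).filter (fun l : ℕ => W < l * y),
          (2 + 1 / d * Chebyshev.theta (min y (W / l))) := by
        refine sum_le_sum fun l hl => ?_
        rw [mem_filter, mem_smoothUpTo] at hl
        have hl0 : (0 : ℝ) < l := by exact_mod_cast hl.1.1
        rcases le_or_gt (W / l) 2 with h | h
        · have := mul_nonneg (one_div_nonneg.2 hd.le) (hth (min y (W / l)))
          linarith
        · have h1 : W / l ≤ y := by rw [div_le_iff₀ hl0]; linarith [hl.2]
          rw [min_eq_right h1]
          have h2 := htheta _ h.le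
          have h3 : W / l ≤ 1 / d * Chebyshev.theta (W / l) := by
            rw [div_mul_eq_mul_div, one_mul, le_div_iff₀ hd]; linarith
          linarith
    _ ≤ ∑ l ∈ smoothUpTo W y, (2 + 1 / d * Chebyshev.theta (min y (W / l))) :=
        sum_le_sum_of_subset_of_nonneg (filter_subset _ _) fun l _ _ => by
          have := mul_nonneg (one_div_nonneg.2 hd.le) (hth (min y (W / l)))
          linarith
    _ = 2 * Psi W y + 1 / d * ∑ l ∈ smoothUpTo W y, Chebyshev.theta (min y (W / l)) := by
        rw [sum_add_distrib, sum_const, ← mul_sum, Psi_eq_card, nsmul_eq_mul, mul_comm (2 : ℝ)]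
    _ ≤ 2 * Psi W y + 1 / d * (Psi W y * Real.log W) := by
        gcongr; exact sum_theta_min_le W y
    _ ≤ _ := by
        have h1 : 0 ≤ Psi W y * Real.log W := by positivity
        have h2 : 0 ≤ 1 / d := by positivity
        nlinarith

/-- Smooth numbers in a residue class modulo `Q` and an interval of length `Q * W`. -/
lemma exists_card_smooth_modEq_le : ∃ C : ℝ, 1 ≤ C ∧ ∀ (y W : ℝ) (Q : ℕ) (T : Finset ℕ),
    1 ≤ W → 1 ≤ Q → (∀ n ∈ T, 1 ≤ n ∧ IsSmooth y n) →
    (∀ n ∈ T, ∀ n' ∈ T, n ≡ n' [MOD Q]) → (∀ n ∈ T, ∀ n' ∈ T, (n : ℝ) - n' ≤ Q * W) →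
    (T.card : ℝ) ≤ C * (Psi W y * (1 + Real.log W)) := by
  obtain ⟨C, hC, hsum⟩ := exists_sum_div_le
  refine ⟨1 + 2 * C, by linarith, fun y W Q T hW hQ hT hmod hdist => ?_⟩
  have hlogW : 0 ≤ Real.log W := Real.log_nonneg hW
  have hΨ0 : (0 : ℝ) ≤ Psi W y := by positivity
  have hW0 : 0 < W := by linarith
  have hQ0 : (0 : ℝ) < Q := by exact_mod_cast hQ
  rcases T.eq_empty_or_nonempty with rfl | ⟨n₀, hn₀⟩
  · simp; positivity
  set d := Nat.gcd n₀ Q with hd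
  have hd0 : 0 < d := Nat.gcd_pos_of_pos_right _ hQ
  have hdQ : d ∣ Q := Nat.gcd_dvd_right _ _
  have hgcd : ∀ n ∈ T, Nat.gcd n Q = d := fun n hn => (hmod n hn n₀ hn₀).gcd_eq
  have hdn : ∀ n ∈ T, d ∣ n := fun n hn => by rw [← hgcd n hn]; exact Nat.gcd_dvd_left _ _
  set T₁ := T.filter fun n : ℕ => ((n / d : ℕ) : ℝ) ≤ W with hT₁
  set T₂ := T.filter fun n : ℕ => ¬ ((n / d : ℕ) : ℝ) ≤ W with hT₂
  have hcard : T.card = T₁.card + T₂.card := (card_filter_add_card_filter_not _).symm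
  have hquot : ∀ n ∈ T, 1 ≤ n / d ∧ IsSmooth y (n / d) := fun n hn =>
    ⟨Nat.div_pos (Nat.le_of_dvd (hT n hn).1 (hdn n hn)) hd0,
      (hT n hn).2.of_dvd (Nat.div_dvd_of_dvd (hdn n hn))⟩
  have h1 : T₁.card ≤ Psi W y := by
    rw [Psi_eq_card]
    refine card_le_card_of_injOn (fun n => n / d) (fun n hn => ?_) fun n hn n' hn' h => ?_
    · rw [mem_coe, hT₁, mem_filter] at hn
      exact mem_coe.2 (mem_smoothUpTo.2 ⟨(hquot n hn.1).1, hn.2, (hquot n hn.1).2⟩)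
    · rw [mem_coe, hT₁, mem_filter] at hn hn'
      exact (Nat.div_left_inj (hdn n hn.1) (hdn n' hn'.1)).1 h
  set Ls := (smoothUpTo W y).filter (fun l : ℕ => W < l * y) with hLs
  have hsub : T₂ ⊆ (Ls.filter fun l : ℕ => l.Coprime (Q / d)).biUnion
      fun l => T.filter fun n => d * l ∣ n := by
    intro n hn
    rw [hT₂, mem_filter, not_le] at hn
    obtain ⟨l, hl, hln, hly⟩ :=
      exists_dvd_mem_smoothUpTo hW (hquot n hn.1).1 (hquot n hn.1).2 hn.2
    rw [mem_biUnion]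
    refine ⟨l, ?_, mem_filter.2 ⟨hn.1, ?_⟩⟩
    · rw [mem_filter, hLs, mem_filter]
      refine ⟨⟨hl, hly⟩, Nat.Coprime.coprime_dvd_left hln ?_⟩
      have := Nat.coprime_div_gcd_div_gcd (m := n) (n := Q) (by rw [hgcd n hn.1]; exact hd0)
      rwa [hgcd n hn.1] at this
    · rw [← Nat.mul_div_cancel' (hdn n hn.1)]
      exact mul_dvd_mul_left d hln
  have hfiber : ∀ l ∈ Ls.filter fun l : ℕ => l.Coprime (Q / d),
      ((T.filter fun n => d * l ∣ n).card : ℝ) ≤ 2 * (W / l) := by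
    intro l hl
    rw [mem_filter, hLs, mem_filter, mem_smoothUpTo] at hl
    obtain ⟨⟨⟨hl1, hlW, -⟩, -⟩, hcop⟩ := hl
    have hl0 : (0 : ℝ) < l := by exact_mod_cast hl1
    have h2 := card_le_of_modEq_of_abs_sub_le (T := T.filter fun n => d * l ∣ n) (M := l * Q)
      (D := Q * W) (Nat.mul_pos hl1 hQ) (by positivity) ?_ ?_
    · have h3 : (Q : ℝ) * W / (l * Q : ℕ) = W / l := by push_cast; field_simp
      rw [h3] at h2
      have h4 : 1 ≤ W / l := by rwa [one_le_div hl0]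
      linarith
    · intro n hn n' hn'
      rw [mem_filter] at hn hn'
      have e1 : n ≡ n' [MOD d * (Q / d)] := by
        rw [Nat.mul_div_cancel' hdQ]; exact hmod n hn.1 n' hn'.1
      have e2 : n ≡ n' [MOD d * l] :=
        ((Nat.modEq_zero_iff_dvd.2 hn.2).trans (Nat.modEq_zero_iff_dvd.2 hn'.2).symm)
      obtain ⟨a, ha⟩ := hdn n hn.1
      obtain ⟨b, hb⟩ := hdn n' hn'.1
      rw [ha, hb] at e1 e2 ⊢
      have f1 := Nat.ModEq.mul_left_cancel' hd0.ne' e1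
      have f2 := Nat.ModEq.mul_left_cancel' hd0.ne' e2
      have f3 := (Nat.modEq_and_modEq_iff_modEq_mul hcop).1 ⟨f2, f1⟩
      have f4 := Nat.ModEq.mul_left' d f3
      have f5 : d * (l * (Q / d)) = l * Q := by
        rw [mul_left_comm, Nat.mul_div_cancel' hdQ]
      rwa [f5] at f4
    · intro n hn n' hn'
      exact hdist n (mem_filter.1 hn).1 n' (mem_filter.1 hn').1
  have h2 : (T₂.card : ℝ) ≤ 2 * (C * (Psi W y * (1 + Real.log W))) := by
    calc (T₂.card : ℝ) ≤ ∑ l ∈ Ls.filter fun l : ℕ => l.Coprime (Q / d),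
          ((T.filter fun n => d * l ∣ n).card : ℝ) := by
          exact_mod_cast (card_le_card hsub).trans card_biUnion_le
      _ ≤ ∑ l ∈ Ls.filter fun l : ℕ => l.Coprime (Q / d), 2 * (W / l) := sum_le_sum hfiber
      _ ≤ ∑ l ∈ Ls, 2 * (W / l) :=
          sum_le_sum_of_subset_of_nonneg (filter_subset _ _) fun l _ _ => by positivity
      _ = 2 * ∑ l ∈ Ls, W / l := (mul_sum _ _ _).symm
      _ ≤ _ := by gcongr; exact hsum y W hW
  have h3 : (T₁.card : ℝ) ≤ Psi W y := by exact_mod_cast h1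
  have h4 : (Psi W y : ℝ) ≤ Psi W y * (1 + Real.log W) := by nlinarith
  rw [hcard]
  push_cast
  linarith

/-- Smooth numbers up to `X` in a residue class modulo `Q` and an interval of length `Z`. -/
lemma exists_card_short_modEq_le : ∃ C y₀ : ℝ, 1 ≤ C ∧ 3 ≤ y₀ ∧
    ∀ (y α X Z : ℝ) (Q : ℕ) (T : Finset ℕ), y₀ ≤ y → 1 / 20 ≤ α → α ≤ 1 → 1 ≤ X →
      Real.log X ≤ smoothLogDeriv y α - Real.log y → 0 < Z → 1 ≤ Q → T ⊆ smoothUpTo X y →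
      (∀ n ∈ T, ∀ n' ∈ T, n ≡ n' [MOD Q]) → (∀ n ∈ T, ∀ n' ∈ T, (n : ℝ) - n' ≤ Z) →
      (T.card : ℝ) ≤ C * (Psi X y * (Z / (Q * X)) ^ α * (1 + Real.log X) + y) := by
  obtain ⟨C, hC, hAP⟩ := exists_card_smooth_modEq_le
  obtain ⟨c, y₀, hc, hy₀, hlong⟩ := exists_rpow_mul_Psi_le
  refine ⟨2 + C / c, y₀, by have : 0 < C / c := by positivity
                            linarith, hy₀,
    fun y α X Z Q T hy hα hα1 hX hXm hZ hQ hT hmod hdist => ?_⟩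
  have hQ0 : (0 : ℝ) < Q := by exact_mod_cast hQ
  have hX0 : 0 < X := by linarith
  have hlogX : 0 ≤ Real.log X := Real.log_nonneg hX
  have hΨ0 : (0 : ℝ) ≤ Psi X y := by positivity
  have hα0 : 0 ≤ α := by linarith
  have hCc : 0 ≤ C / c := by positivity
  have hy1 : 1 ≤ y := by linarith
  set W := Z / Q with hW
  have hW0 : 0 < W := by positivity
  have hZW : Z = Q * W := by rw [hW]; field_simp
  have hratio : Z / (Q * X) = W / X := by rw [hW, div_div]
  rw [hratio]
  have hmain0 : 0 ≤ Psi X y * (W / X) ^ α * (1 + Real.log X) := by positivity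
  rcases le_or_gt W y with hWy | hWy
  · have h1 := card_le_of_modEq_of_abs_sub_le hQ hZ.le hmod hdist
    have h2 : 0 ≤ C / c * (Psi X y * (W / X) ^ α * (1 + Real.log X) + y) := by positivity
    have h3 : W + 1 ≤ 2 * y := by linarith
    linarith
  rcases le_or_gt W X with hWX | hWX
  · have h1 := hAP y W Q T (by linarith) hQ
      (fun n hn => by have := mem_smoothUpTo.1 (hT hn); exact ⟨this.1, this.2.2⟩)
      hmod (fun n hn n' hn' => hZW ▸ hdist n hn n' hn')
    have h2 := hlong y α W X hy hα hα1 (by linarith) hWX hXm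
    have h3 : (Psi W y : ℝ) ≤ 1 / c * (Psi X y * (W / X) ^ α) := by
      have e : (X / W) ^ α * (W / X) ^ α = 1 := by
        rw [← Real.mul_rpow (by positivity) (by positivity)]
        have : X / W * (W / X) = 1 := by field_simp
        rw [this, Real.one_rpow]
      calc (Psi W y : ℝ) = 1 / c * (c * (X / W) ^ α * Psi W y * (W / X) ^ α) := by
            rw [show c * (X / W) ^ α * (Psi W y : ℝ) * (W / X) ^ α =
              c * Psi W y * ((X / W) ^ α * (W / X) ^ α) by ring, e]
            field_simp
        _ ≤ _ := by gcongr
    have hlogW : Real.log W ≤ Real.log X := Real.log_le_log hW0 hWX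
    have hlogW0 : 0 ≤ Real.log W := Real.log_nonneg (by linarith)
    calc (T.card : ℝ) ≤ C * (Psi W y * (1 + Real.log W)) := h1
      _ ≤ C * (1 / c * (Psi X y * (W / X) ^ α) * (1 + Real.log X)) := by gcongr
      _ = C / c * (Psi X y * (W / X) ^ α * (1 + Real.log X)) := by ring
      _ ≤ (2 + C / c) * (Psi X y * (W / X) ^ α * (1 + Real.log X) + y) := by
          gcongr <;> linarith
  · have h1 : (T.card : ℝ) ≤ Psi X y := by
      rw [Psi_eq_card]; exact_mod_cast card_le_card hT
    have h2 : 1 ≤ (W / X) ^ α := Real.one_le_rpow (by rw [one_le_div hX0]; exact hWX.le) hα0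
    have h3 : 1 ≤ (W / X) ^ α * (1 + Real.log X) := by nlinarith
    have h4 : (Psi X y : ℝ) ≤ Psi X y * (W / X) ^ α * (1 + Real.log X) := by
      rw [mul_assoc]; exact le_mul_of_one_le_right hΨ0 h3
    have h5 : 0 ≤ (1 + C / c) * (Psi X y * (W / X) ^ α * (1 + Real.log X) + y) := by positivity
    linarith

/-- Dyadic decomposition of a weighted sum according to the size of `D`. -/
lemma sum_le_sum_dyadic {ι : Type*} (T : Finset ι) (D w : ι → ℝ) {X B L : ℝ} (hX : 0 < X)
    (hB : 0 ≤ B) (hL : 0 < L) (I : ℕ) (hI : L ≤ 2 ^ I) (hD : ∀ n ∈ T, D n ≤ X)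
    (hw : ∀ n ∈ T, w n ≤ B) (hwD : ∀ n ∈ T, w n * (L * D n) ≤ 4 * B * X) :
    ∑ n ∈ T, w n ≤ ∑ i ∈ range (I + 1),
      8 * B / 2 ^ i * (T.filter fun n => D n ≤ 2 ^ i * (X / L)).card := by
  have hterm : ∀ n ∈ T, w n ≤ ∑ i ∈ range (I + 1),
      if D n ≤ 2 ^ i * (X / L) then 8 * B / 2 ^ i else 0 := by
    intro n hn
    have hex : ∃ i, D n ≤ 2 ^ i * (X / L) := by
      refine ⟨I, (hD n hn).trans ?_⟩
      rw [mul_div_left_comm]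
      exact le_mul_of_one_le_right hX.le (by rwa [one_le_div hL])
    set i := Nat.find hex with hi
    have hiI : i ≤ I := Nat.find_le (by
      refine (hD n hn).trans ?_
      rw [mul_div_left_comm]
      exact le_mul_of_one_le_right hX.le (by rwa [one_le_div hL]))
    have hle : w n ≤ 8 * B / 2 ^ i := by
      rcases Nat.eq_zero_or_pos i with h0 | h0
      · rw [h0, pow_zero, div_one]; linarith [hw n hn]
      · have hnot := Nat.find_min hex (m := i - 1) (by omega)
        rw [not_le] at hnot
        have hpow : (2 : ℝ) ^ i = 2 * 2 ^ (i - 1) := by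
          rw [← pow_succ']; congr 1; omega
        have hD0 : 0 < D n := lt_trans (by positivity) hnot
        have h1 : 2 ^ (i - 1) * X < L * D n := by
          have : 2 ^ (i - 1) * X / L < D n := by rwa [mul_div_assoc]
          rw [div_lt_iff₀ hL] at this
          linarith
        rw [le_div_iff₀ (by positivity), hpow]
        rcases le_or_gt (w n) 0 with hw0 | hw0
        · have : (0 : ℝ) < 2 * 2 ^ (i - 1) := by positivity
          nlinarith
        · have h2 := hwD n hn
          have h3 := mul_le_mul_of_nonneg_left h1.le hw0.le
          refine le_of_mul_le_mul_right ?_ hX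
          linarith
    refine hle.trans (le_trans (le_of_eq ?_) (single_le_sum (f := fun i =>
      if D n ≤ 2 ^ i * (X / L) then 8 * B / 2 ^ i else 0) (fun k _ => ?_)
      (mem_range.2 (Nat.lt_succ_of_le hiI))))
    · simp only [hi, if_pos (Nat.find_spec hex)]
    · split_ifs <;> positivity
  refine (sum_le_sum hterm).trans (le_of_eq ?_)
  rw [sum_comm]
  refine sum_congr rfl fun i _ => ?_
  rw [← sum_filter, sum_const, nsmul_eq_mul, mul_comm]

lemma abs_sub_le_of_mem_smoothUpTo {X y : ℝ} {m n : ℕ} (hm : m ∈ smoothUpTo X y)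
    (hn : n ∈ smoothUpTo X y) : |(m : ℝ) - n| ≤ X := by
  have h1 := mem_smoothUpTo.1 hm
  have h2 := mem_smoothUpTo.1 hn
  have h3 : (0 : ℝ) ≤ n := by positivity
  have h4 : (0 : ℝ) ≤ m := by positivity
  rw [abs_le]
  constructor <;> linarith [h1.2.1, h2.2.1]

/-- A weighted sum over smooth numbers in a residue class, the weight decaying away from `m`. -/
lemma exists_sum_modEq_le : ∃ C y₀ : ℝ, 1 ≤ C ∧ 3 ≤ y₀ ∧
    ∀ (y α X B L : ℝ) (Q m : ℕ) (w : ℕ → ℝ), y₀ ≤ y → 1 / 20 ≤ α → α ≤ 1 → 1 ≤ X →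
      Real.log X ≤ smoothLogDeriv y α - Real.log y → 0 ≤ B → 2 ≤ L → 1 ≤ Q →
      m ∈ smoothUpTo X y → (∀ n, w n ≤ B) →
      (∀ n ∈ smoothUpTo X y, w n * (L * |(m : ℝ) - n|) ≤ 4 * B * X) →
      ∑ n ∈ (smoothUpTo X y).filter (fun n => m ≡ n [MOD Q]), w n ≤
        C * B * (Psi X y * (L * Q) ^ (-α) * (1 + Real.log X) * Real.log L + y) := by
  obtain ⟨C, y₀, hC, hy₀, h⟩ := exists_card_short_modEq_le
  refine ⟨80 * C, y₀, by linarith, hy₀,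
    fun y α X B L Q m w hy hα hα1 hX hXm hB hL hQ hm hwB hwD => ?_⟩
  have hL0 : 0 < L := by linarith
  have hX0 : 0 < X := by linarith
  have hQ0 : (0 : ℝ) < Q := by exact_mod_cast hQ
  have hl2 : 0 < Real.log 2 := Real.log_pos (by norm_num)
  have hlog2 := Real.log_two_gt_d9
  have hlogL : Real.log 2 ≤ Real.log L := Real.log_le_log (by norm_num) hL
  have hlogX : 0 ≤ Real.log X := Real.log_nonneg hX
  set T := (smoothUpTo X y).filter (fun n => m ≡ n [MOD Q]) with hT
  set I := ⌈Real.log L / Real.log 2⌉₊ with hI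
  have hLI : L ≤ 2 ^ I := Real.le_pow_of_log_le (by norm_num)
    ((div_le_iff₀ hl2).1 (Nat.le_ceil _))
  have hI5 : (I : ℝ) + 1 ≤ 5 * Real.log L := by
    have h1 : (I : ℝ) < Real.log L / Real.log 2 + 1 :=
      Nat.ceil_lt_add_one (div_nonneg (by linarith) hl2.le)
    have h2 : 1 ≤ Real.log L / Real.log 2 := by rwa [one_le_div hl2]
    have h3 : Real.log L / Real.log 2 * 3 ≤ 5 * Real.log L := by
      rw [div_mul_eq_mul_div, div_le_iff₀ hl2]
      nlinarith
    linarith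
  have hdist : ∀ n ∈ T, |(m : ℝ) - n| ≤ X := fun n hn =>
    abs_sub_le_of_mem_smoothUpTo hm (mem_filter.1 hn).1
  set P := Psi X y * (L * Q) ^ (-α) * (1 + Real.log X) with hP
  have hP0 : 0 ≤ P := by positivity
  have hy0 : 0 ≤ y := by linarith
  have hshell : ∀ i ∈ range (I + 1),
      8 * B / 2 ^ i * ((T.filter fun n : ℕ => |(m : ℝ) - n| ≤ 2 ^ i * (X / L)).card : ℝ) ≤
        8 * B * C * (2 * P + y * (1 / 2) ^ i) := by
    intro i _
    have h2i : (1 : ℝ) ≤ 2 ^ (i + 1) := one_le_pow₀ (by norm_num)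
    have hcard := h y α X (2 ^ (i + 1) * (X / L)) Q
      (T.filter fun n : ℕ => |(m : ℝ) - n| ≤ 2 ^ i * (X / L)) hy hα hα1 hX hXm (by positivity) hQ
      ((filter_subset _ _).trans (filter_subset _ _))
      (fun n hn n' hn' => by
        have h1 := (mem_filter.1 (mem_filter.1 hn).1).2
        have h2 := (mem_filter.1 (mem_filter.1 hn').1).2
        exact h1.symm.trans h2)
      (fun n hn n' hn' => by
        have h1 := abs_le.1 (mem_filter.1 hn).2
        have h2 := abs_le.1 (mem_filter.1 hn').2
        rw [pow_succ]
        linarith [h1.1, h2.2])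
    have hpow : (2 ^ (i + 1) * (X / L) / (Q * X)) ^ α ≤ (2 : ℝ) ^ (i + 1) * (L * Q) ^ (-α) := by
      have h1 : (2 : ℝ) ^ (i + 1) * (X / L) / (Q * X) = 2 ^ (i + 1) * (L * Q)⁻¹ := by
        field_simp
      rw [h1, Real.mul_rpow (by positivity) (by positivity), Real.inv_rpow (by positivity),
        ← Real.rpow_neg (by positivity)]
      gcongr
      calc ((2 : ℝ) ^ (i + 1)) ^ α ≤ ((2 : ℝ) ^ (i + 1)) ^ (1 : ℝ) :=
            Real.rpow_le_rpow_of_exponent_le h2i hα1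
        _ = 2 ^ (i + 1) := Real.rpow_one _
    calc 8 * B / 2 ^ i * ((T.filter fun n : ℕ => |(m : ℝ) - n| ≤ 2 ^ i * (X / L)).card : ℝ)
        ≤ 8 * B / 2 ^ i * (C * (Psi X y * (2 ^ (i + 1) * (L * Q) ^ (-α)) *
            (1 + Real.log X) + y)) := by
          refine mul_le_mul_of_nonneg_left (hcard.trans ?_) (by positivity)
          gcongr
      _ = 8 * B * C * (2 * P + y * (1 / 2) ^ i) := by
          rw [hP, one_div, inv_pow, pow_succ]
          field_simp
  have hgeom : ∑ i ∈ range (I + 1), ((1 : ℝ) / 2) ^ i ≤ 2 := sum_geometric_two_le _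
  calc ∑ n ∈ T, w n
      ≤ ∑ i ∈ range (I + 1),
          8 * B / 2 ^ i * ((T.filter fun n : ℕ => |(m : ℝ) - n| ≤ 2 ^ i * (X / L)).card : ℝ) :=
        sum_le_sum_dyadic T (fun n => |(m : ℝ) - n|) w hX0 hB hL0 I hLI hdist
          (fun n _ => hwB n) (fun n hn => hwD n (mem_filter.1 hn).1)
    _ ≤ ∑ i ∈ range (I + 1), 8 * B * C * (2 * P + y * (1 / 2) ^ i) := sum_le_sum hshell
    _ = 8 * B * C * ((I + 1) * (2 * P) + y * ∑ i ∈ range (I + 1), ((1 : ℝ) / 2) ^ i) := by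
        rw [← mul_sum, sum_add_distrib, sum_const, card_range, nsmul_eq_mul, ← mul_sum]
        push_cast
        rfl
    _ ≤ 8 * B * C * (5 * Real.log L * (2 * P) + y * 2) := by
        gcongr
    _ ≤ 80 * C * B * (P * Real.log L + y) := by
        have : 0 ≤ B * C * y := by positivity
        linarith

/-- The weight `min (B, 1 / |d δ|)` is bounded and decays away from `d = 0`. -/
lemma min_weight_bounds {B X x δ d : ℝ} (hB : 0 ≤ B) (hx : 0 ≤ x) (hBX : B * X = 2 * x)
    (hd : |d| ≤ X) :
    (if d * δ = 0 then B else min B (1 / |d * δ|)) * (2 * (1 + |δ * x|) * |d|) ≤ 4 * B * X := by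
  set w := if d * δ = 0 then B else min B (1 / |d * δ|) with hw
  have hwB : w ≤ B := by
    rw [hw]
    split_ifs
    exacts [le_rfl, min_le_left _ _]
  have hwd : w * |d * δ| ≤ 1 := by
    rw [hw]
    split_ifs with h
    · simp [h]
    · exact (mul_le_mul_of_nonneg_right (min_le_right _ _) (abs_nonneg _)).trans
        (one_div_mul_cancel (abs_ne_zero.2 h)).le
  have h1 : w * |d| ≤ B * X := mul_le_mul hwB hd (abs_nonneg _) hB
  have h2 : w * |d * δ| * x ≤ 1 * x := mul_le_mul_of_nonneg_right hwd hx
  rw [abs_mul] at h2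
  rw [abs_mul, abs_of_nonneg hx]
  linarith

/-- The pair sum of a weight as an iterated sum over smooth numbers. -/
lemma sum_filter_modEq_eq (X y : ℝ) (Q : ℕ) (w : ℕ → ℕ → ℝ) :
    ∑ nn ∈ ((Finset.Icc 1 ⌊X⌋₊ ×ˢ Finset.Icc 1 ⌊X⌋₊).filter
        (fun nn => IsSmooth y nn.1 ∧ IsSmooth y nn.2 ∧ nn.1 ≡ nn.2 [MOD Q])), w nn.1 nn.2 =
      ∑ m ∈ smoothUpTo X y, ∑ n ∈ (smoothUpTo X y).filter (fun n => m ≡ n [MOD Q]), w m n := by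
  rw [sum_sigma']
  refine sum_bij' (fun nn _ => ⟨nn.1, nn.2⟩) (fun s _ => (s.1, s.2)) ?_ ?_ ?_ ?_ ?_
  · rintro ⟨m, n⟩ h
    simp only [mem_filter, mem_product] at h
    simp only [mem_sigma, mem_filter, smoothUpTo]
    tauto
  · rintro ⟨m, n⟩ h
    simp only [mem_sigma, mem_filter, smoothUpTo] at h
    simp only [mem_filter, mem_product]
    tauto
  all_goals intros; rfl

end SmoothSums

/-- Bound (2.7): for a prime `p ∣ q`, the congruence sum with
`min{2^(j+1)qLy, 1/|(n₁−n₂)δ|}` over pairs of positive `y`-smooth integers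
`n₁, n₂ ≤ x/(2^j qLy)` with `n₁ ≡ n₂ (mod q/p)`. -/
theorem congruence_min_sum_bound_div_p :
    ∃ C : ℝ, 0 < C ∧
      ∀ (x y : ℝ) (q : ℕ) (δ L : ℝ) (j : ℕ) (p : ℕ) (α : ℝ),
        3 ≤ x → Real.log x ^ (1.1 : ℝ) ≤ y → y ≤ x ^ ((1 : ℝ) / 3) →
        1 ≤ q → L = 2 * (1 + |δ * x|) →
        (j : ℝ) ≤ Real.log y / Real.log 2 →
        p.Prime → p ∣ q → alphaEq x y α →
        ∑ nn ∈ ((Finset.Icc 1 ⌊x / (2 ^ j * q * L * y)⌋₊ ×ˢ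
              Finset.Icc 1 ⌊x / (2 ^ j * q * L * y)⌋₊).filter
            (fun nn => IsSmooth y nn.1 ∧ IsSmooth y nn.2 ∧ nn.1 ≡ nn.2 [MOD (q / p)])),
          (if ((nn.1 : ℝ) - (nn.2 : ℝ)) * δ = 0 then (2 : ℝ) ^ (j + 1) * q * L * y
            else min ((2 : ℝ) ^ (j + 1) * q * L * y)
              (1 / |((nn.1 : ℝ) - (nn.2 : ℝ)) * δ|)) ≤
          C * ((p : ℝ) * (2 : ℝ) ^ j * y * (Psi (x / (2 ^ j * q * L * y)) y : ℝ) ^ 2 *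
              ((q : ℝ) * L / p) ^ (1 - α) * Real.log x * Real.log L +
            (2 : ℝ) ^ j * q * L * y ^ 2 * (Psi (x / (2 ^ j * q * L * y)) y : ℝ)) := by
  obtain ⟨y₁, -, hα⟩ := exists_alpha_bounds
  obtain ⟨C, y₂, hC, hy₂, hsum⟩ := exists_sum_modEq_le
  refine ⟨4 * C + 2 * Real.exp (max y₁ y₂), by positivity,
    fun x y q δ L j p α hx hxy hyx hq hL _ hp hpq hαeq => ?_⟩
  have hx0 : 0 < x := by linarith
  have hq0 : (1 : ℝ) ≤ q := by exact_mod_cast hq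
  have hL2 : 2 ≤ L := by rw [hL]; linarith [abs_nonneg (δ * x)]
  have hlx : 1 ≤ Real.log x := by
    rw [Real.le_log_iff_exp_le hx0]
    linarith [Real.exp_one_lt_d9]
  have hlxy : Real.log x ≤ y := (Real.self_le_rpow_of_one_le hlx (by norm_num)).trans hxy
  have hy1 : 1 ≤ y := hlx.trans hlxy
  have h2j : (1 : ℝ) ≤ 2 ^ j := one_le_pow₀ (by norm_num)
  have hlL : 0 ≤ Real.log L := Real.log_nonneg (by linarith)
  have hden : y ≤ 2 ^ j * q * L * y := by
    refine le_mul_of_one_le_left (by linarith) ?_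
    have : (1 : ℝ) ≤ 2 ^ j * q := one_le_mul_of_one_le_of_one_le h2j hq0
    exact one_le_mul_of_one_le_of_one_le this (by linarith)
  set X := x / (2 ^ j * q * L * y) with hXdef
  set B := (2 : ℝ) ^ (j + 1) * q * L * y with hB
  have hB0 : 0 ≤ B := by positivity
  have hX0 : 0 < X := by positivity
  have hBX : B * X = 2 * x := by
    rw [hB, hXdef, pow_succ]
    field_simp
  have hXy : X ≤ x / y := div_le_div_of_nonneg_left hx0.le (by linarith) hden
  have hΨ0 : (0 : ℝ) ≤ Psi X y := by positivity
  set E := (p : ℝ) * (2 : ℝ) ^ j * y * (Psi X y : ℝ) ^ 2 * ((q : ℝ) * L / p) ^ (1 - α) *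
    Real.log x * Real.log L with hE
  have hE0 : 0 ≤ E := by positivity
  set F := (2 : ℝ) ^ j * q * L * y ^ 2 * (Psi X y : ℝ) with hF
  have hF0 : 0 ≤ F := by positivity
  set w : ℕ → ℕ → ℝ := fun m n => if ((m : ℝ) - n) * δ = 0 then B else
    min B (1 / |((m : ℝ) - n) * δ|) with hw
  have hwB : ∀ m n, w m n ≤ B := fun m n => by
    rw [hw]
    dsimp only
    split_ifs
    exacts [le_rfl, min_le_left _ _]
  refine (le_of_eq (sum_filter_modEq_eq X y (q / p) w)).trans ?_
  set Q := q / p with hQdef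
  have hQ : 1 ≤ Q := Nat.div_pos (Nat.le_of_dvd hq hpq) hp.pos
  have hBF : B * y * Psi X y = 2 * F := by
    rw [hB, hF, pow_succ]
    ring
  by_cases hy : max y₁ y₂ ≤ y
  · rcases lt_or_ge X 1 with hX1 | hX1
    · have : smoothUpTo X y = ∅ := by
        rw [smoothUpTo, Nat.floor_eq_zero.2 hX1]
        rfl
      rw [this, Finset.sum_empty]
      positivity
    · obtain ⟨hα0, hα1, hαlog⟩ := hα x y α ((le_max_left _ _).trans hy) (by linarith) hxy hyx hαeq
      have hXm : Real.log X ≤ smoothLogDeriv y α - Real.log y := by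
        rw [hαlog, ← Real.log_div (by positivity) (by positivity)]
        exact Real.log_le_log hX0 hXy
      have hlX : 1 + Real.log X ≤ 2 * Real.log x := by
        have := Real.log_nonneg hy1
        linarith
      have hlX0 := Real.log_nonneg hX1
      have hterm : ∀ m ∈ smoothUpTo X y,
          ∑ n ∈ (smoothUpTo X y).filter (fun n => m ≡ n [MOD Q]), w m n ≤
            C * B * (Psi X y * (L * Q) ^ (-α) * (2 * Real.log x) * Real.log L + y) := by
        intro m hm
        refine (hsum y α X B L Q m (w m) ((le_max_right _ _).trans hy) hα0 hα1 hX1 hXm hB0 hL2 hQ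
          hm (hwB m) fun n hn => ?_).trans (by gcongr)
        rw [hL]
        exact min_weight_bounds hB0 hx0.le hBX (abs_sub_le_of_mem_smoothUpTo hm hn)
      have hmain : B * (Psi X y * (Psi X y * (L * Q) ^ (-α) * (2 * Real.log x) * Real.log L)) =
          4 * E := by
        have hp0 : (0 : ℝ) < p := by exact_mod_cast hp.pos
        have hQc : L * Q = q * L / p := by
          rw [hQdef, Nat.cast_div hpq hp0.ne']
          ring
        have hpow : q * L / p * (q * L / p) ^ (-α) = ((q : ℝ) * L / p) ^ (1 - α) := by
          rw [sub_eq_add_neg, Real.rpow_add (by positivity), Real.rpow_one]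
        rw [hE, ← hpow, hQc, hB, pow_succ]
        field_simp
        ring
      calc ∑ m ∈ smoothUpTo X y,
            ∑ n ∈ (smoothUpTo X y).filter (fun n => m ≡ n [MOD Q]), w m n
          ≤ ∑ m ∈ smoothUpTo X y,
            C * B * (Psi X y * (L * Q) ^ (-α) * (2 * Real.log x) * Real.log L + y) :=
            Finset.sum_le_sum hterm
        _ = C * (B * (Psi X y * (Psi X y * (L * Q) ^ (-α) * (2 * Real.log x) * Real.log L)) +
              B * y * Psi X y) := by
            rw [Finset.sum_const, nsmul_eq_mul, ← Psi_eq_card]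
            ring
        _ = C * (4 * E + 2 * F) := by rw [hmain, hBF]
        _ ≤ (4 * C + 2 * Real.exp (max y₁ y₂)) * (E + F) := by
            have h1 : 0 ≤ Real.exp (max y₁ y₂) * (E + F) := by positivity
            have h2 : 0 ≤ C * F := by positivity
            linarith
  · push Not at hy
    have hΨ : (Psi X y : ℝ) ≤ Real.exp (max y₁ y₂) := by
      refine (Psi_le_self hX0.le y).trans (hXy.trans ((div_le_self hx0.le hy1).trans ?_))
      rw [← Real.log_le_iff_le_exp hx0]
      linarith
    calc ∑ m ∈ smoothUpTo X y,
          ∑ n ∈ (smoothUpTo X y).filter (fun n => m ≡ n [MOD Q]), w m n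
        ≤ ∑ m ∈ smoothUpTo X y, Psi X y * B := by
          refine Finset.sum_le_sum fun m _ => ?_
          refine (Finset.sum_le_card_nsmul _ _ B fun n _ => hwB m n).trans ?_
          rw [nsmul_eq_mul, Psi_eq_card]
          gcongr
          exact Finset.filter_subset _ _
      _ = B * Psi X y * Psi X y := by
          rw [Finset.sum_const, nsmul_eq_mul, ← Psi_eq_card]
          ring
      _ ≤ B * y * Psi X y * Real.exp (max y₁ y₂) := by
          have : B * Psi X y ≤ B * y * Psi X y := by
            rw [mul_right_comm B y]
            exact le_mul_of_one_le_right (by positivity) hy1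
          gcongr
      _ = 2 * Real.exp (max y₁ y₂) * F := by
          rw [hBF]
          ring
      _ ≤ (4 * C + 2 * Real.exp (max y₁ y₂)) * (E + F) := by
          have h1 : 0 ≤ Real.exp (max y₁ y₂) * E := by positivity
          have h2 : 0 ≤ C * (E + F) := by positivity
          linarith
end
end

section
/- Let θ > 1 be a real number, ψ ∈ ℝ, and m a positive integer. Then there exists an integer n with ⌊θn + ψ⌋ = m if and only if 0 < {(m + 1 − ψ)/θ} ≤ 1/θ, where {t} denotes the fractional part of t. -/
open scoped Classical

noncomputable section

/-- Membership criterion (3.2) for the Beatty sequence: for `θ > 1`, `ψ ∈ ℝ` and a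
positive integer `m`, one has `⌊θn + ψ⌋ = m` for some integer `n` if and only if
`0 < {(m + 1 − ψ)/θ} ≤ 1/θ`. -/
theorem beatty_membership_criterion
    (θ ψ : ℝ) (hθ : 1 < θ) (m : ℕ) (hm : 0 < m) :
    (∃ n : ℤ, ⌊θ * n + ψ⌋ = (m : ℤ)) ↔
      (0 < Int.fract (((m : ℝ) + 1 - ψ) / θ) ∧
        Int.fract (((m : ℝ) + 1 - ψ) / θ) ≤ 1 / θ) := by
  have hθ0 : 0 < θ := by linarith
  have hinv : 1 / θ < 1 := (div_lt_one hθ0).mpr hθ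
  set t : ℝ := ((m : ℝ) + 1 - ψ) / θ with ht
  have hfloor (n : ℤ) : ⌊θ * n + ψ⌋ = (m : ℤ) ↔ 0 < t - n ∧ t - n ≤ 1 / θ := by
    have hmul : θ * t = m + 1 - ψ := mul_div_cancel₀ _ hθ0.ne'
    rw [Int.floor_eq_iff, le_div_iff₀ hθ0, ← mul_pos_iff_of_pos_left hθ0, Int.cast_natCast]
    constructor <;> rintro ⟨h₁, h₂⟩ <;> constructor <;> linarith
  simp only [hfloor]
  constructor
  · rintro ⟨n, h₁, h₂⟩
    have hn : Int.fract t = t - n :=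
      Int.fract_eq_iff.mpr ⟨h₁.le, h₂.trans_lt hinv, n, by ring⟩
    exact hn ▸ ⟨h₁, h₂⟩
  · exact fun h => ⟨⌊t⌋, h⟩
end
end

section
/- For every ε > 0 there exist η > 0 and x₀ such that for all x ≥ x₀ and all y with (log x)^{3+ε} ≤ y ≤ x, one has α(x, y) ≥ 2/3 + η. -/
open scoped Classical

noncomputable section

open Real Filter in
/-- A weak form of Chebyshev's lower bound for `θ`. -/
theorem eventually_quarter_mul_le_theta : ∀ᶠ y : ℝ in atTop, y / 4 ≤ Chebyshev.theta y := by
  have h := (isLittleO_log_rpow_atTop (r := 1 / 2) (by norm_num)).bound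
    (show (0 : ℝ) < 1 / 100 by norm_num)
  filter_upwards [h, eventually_ge_atTop (100 : ℝ)] with y hy hy100
  have hlog : log y ≤ 1 / 100 * √y := by
    rw [← sqrt_eq_rpow, norm_of_nonneg (log_nonneg (by linarith)),
      norm_of_nonneg (sqrt_nonneg y)] at hy
    exact hy
  have hsq : √y * √y = y := mul_self_sqrt (by linarith)
  have hsqrt : √y ≤ y := by
    nlinarith [sqrt_nonneg y, one_le_sqrt.mpr (by linarith : (1 : ℝ) ≤ y)]
  have hlog' : log (y + 2) ≤ 2 * log y := by
    rw [← log_rpow (by linarith)]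
    refine log_le_log (by linarith) ?_
    norm_num
    nlinarith
  have hmul : √y * log y ≤ y / 100 := by
    nlinarith [mul_le_mul_of_nonneg_left hlog (sqrt_nonneg y)]
  nlinarith [Chebyshev.theta_ge' (by linarith : (1 : ℝ) ≤ y), log_two_gt_d9, log_two_lt_d9]

/-- A solution `a` of `alphaEq x y a` with `x > 1` is positive. -/
theorem alphaEq.pos {x y a : ℝ} (h : alphaEq x y a) (hx : 1 < x) : 0 < a := by
  by_contra! ha
  refine (Real.log_pos hx).not_ge (h ▸ Finset.sum_nonpos fun p hp => ?_)
  have hp1 : (1 : ℝ) ≤ p := mod_cast (Finset.mem_filter.mp hp).2.one_le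
  exact div_nonpos_of_nonneg_of_nonpos (Real.log_nonneg hp1)
    (sub_nonpos.mpr (Real.rpow_le_one_of_one_le_of_nonpos hp1 ha))

/-- Bounding each `p ^ a - 1` by `y ^ a` in the defining equation. -/
theorem alphaEq.theta_le {x y a : ℝ} (h : alphaEq x y a) (ha : 0 < a) (hy : 0 < y) :
    Chebyshev.theta y ≤ Real.log x * y ^ a := by
  have hset : (Finset.Ioc 0 ⌊y⌋₊).filter Nat.Prime =
      (Finset.range (⌊y⌋₊ + 1)).filter Nat.Prime := by
    ext p
    simp only [Finset.mem_filter, Finset.mem_Ioc, Finset.mem_range, Nat.lt_succ_iff]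
    exact ⟨fun ⟨⟨_, h₁⟩, h₂⟩ => ⟨h₁, h₂⟩, fun ⟨h₁, h₂⟩ => ⟨⟨h₂.pos, h₁⟩, h₂⟩⟩
  rw [alphaEq] at h
  rw [Chebyshev.theta, hset, ← h, Finset.sum_mul]
  refine Finset.sum_le_sum fun p hp => ?_
  obtain ⟨hpy, hp⟩ := Finset.mem_filter.mp hp
  have hpy : (p : ℝ) ≤ y := (Nat.le_floor_iff hy.le).mp (by simpa [Nat.lt_succ_iff] using hpy)
  have hp1 : (1 : ℝ) < p := mod_cast hp.one_lt
  have hpos : 0 < (p : ℝ) ^ a - 1 := sub_pos.mpr (Real.one_lt_rpow hp1 ha)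
  have hle : (p : ℝ) ^ a ≤ y ^ a := Real.rpow_le_rpow (by linarith) hpy ha.le
  rw [div_mul_eq_mul_div, le_div_iff₀ hpos]
  exact mul_le_mul_of_nonneg_left (by linarith) (Real.log_nonneg hp1.le)

/-- For every `ε > 0` there is `η > 0` with `α(x, y) ≥ 2/3 + η` whenever `x` is large
and `(log x)^(3+ε) ≤ y ≤ x`. -/
theorem alpha_lower_bound (ε : ℝ) (hε : 0 < ε) :
    ∃ η > (0 : ℝ), ∃ x₀ : ℝ, ∀ x : ℝ, x₀ ≤ x → ∀ y : ℝ,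
      Real.log x ^ (3 + ε) ≤ y → y ≤ x →
      ∀ α : ℝ, alphaEq x y α → 2 / 3 + η ≤ α := by
  obtain ⟨Y, hY⟩ := Filter.eventually_atTop.mp eventually_quarter_mul_le_theta
  have hlog := Real.tendsto_log_atTop
  have hlarge := ((tendsto_rpow_atTop (by positivity : 0 < 3 + ε)).comp hlog).eventually_ge_atTop Y
  have hgap := ((tendsto_rpow_atTop (by positivity : 0 < ε / 6)).comp hlog).eventually_gt_atTop 4
  obtain ⟨x₀, hx₀⟩ := Filter.eventually_atTop.mp
    (hlarge.and (hgap.and (hlog.eventually_ge_atTop 1)))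
  simp only [Function.comp_apply] at hx₀
  refine ⟨ε / (6 * (3 + ε)), by positivity, max x₀ 2, fun x hx y hy _ α hα => ?_⟩
  obtain ⟨hLY, hL4, hL1⟩ := hx₀ x ((le_max_left _ _).trans hx)
  have hx1 : 1 < x := by linarith [le_max_right x₀ 2]
  have hα0 := hα.pos hx1
  by_contra! hlt
  set η := ε / (6 * (3 + ε)) with hη
  set L := Real.log x
  have hL0 : 0 < L := by linarith
  have hy1 : 1 ≤ y := (Real.one_le_rpow hL1 (by positivity)).trans hy
  have hy0 : 0 < y := by linarith
  have hη3 : 0 ≤ 1 / 3 - η := by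
    rw [hη, sub_nonneg, div_le_div_iff₀ (by positivity) (by norm_num)]
    linarith
  have hupper : y / 4 ≤ L * y ^ (2 / 3 + η) :=
    (hY y (hLY.trans hy)).trans <| (hα.theta_le hα0 hy0).trans <|
      mul_le_mul_of_nonneg_left (Real.rpow_le_rpow_of_exponent_le hy1 hlt.le) hL0.le
  have hsplit : y = y ^ (1 / 3 - η) * y ^ (2 / 3 + η) := by
    rw [← Real.rpow_add hy0]
    norm_num
  have hypow : y ^ (1 / 3 - η) ≤ 4 * L := by
    refine le_of_mul_le_mul_right ?_ (Real.rpow_pos_of_pos hy0 (2 / 3 + η))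
    rw [← hsplit]
    linarith
  have hlower : L * L ^ (ε / 6) ≤ y ^ (1 / 3 - η) := by
    refine le_trans (le_of_eq ?_) (Real.rpow_le_rpow (by positivity) hy hη3)
    rw [← Real.rpow_mul hL0.le, ← Real.rpow_one_add' hL0.le (by positivity)]
    congr 1
    rw [hη]
    field_simp
    ring
  nlinarith
end
end

section
/- Let y ≥ 2 and T ≥ 1 be real numbers. Then every y-smooth integer N with N ≥ Ty can be written uniquely as N = m·n, where m and n are positive integers satisfying: m is y-smooth, T < m ≤ Ty, m/P(m) ≤ T, and the smallest prime factor p(n) of n satisfies p(n) ≥ P(m). (Equivalently, there is exactly one such ordered factorization (m, n) of N.) -/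
open scoped Classical

noncomputable section

/-- The largest prime factor of `n` (equal to `0` for `n ≤ 1`). -/
def Pmax (n : ℕ) : ℕ := n.primeFactors.sup id

theorem Nat.Prime.le_Pmax {p n : ℕ} (hp : p.Prime) (h : p ∣ n) (hn : n ≠ 0) : p ≤ Pmax n :=
  Finset.le_sup (f := id) (Nat.mem_primeFactors.2 ⟨hp, h, hn⟩)

theorem Pmax_mem_primeFactors {n : ℕ} (hn : 1 < n) : Pmax n ∈ n.primeFactors := by
  obtain ⟨p, hp, h⟩ := Finset.exists_mem_eq_sup n.primeFactors
    (Nat.nonempty_primeFactors.2 hn) id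
  rw [Pmax, h]
  exact hp

/-- `m * n` cuts its sorted list of prime factors in two: every prime factor of `m` is at most
every prime factor of `n`. -/
def IsSortedSplit (m n : ℕ) : Prop :=
  ∀ p q : ℕ, p.Prime → q.Prime → p ∣ m → q ∣ n → p ≤ q

theorem isSortedSplit_of_Pmax_le_minFac {m n : ℕ} (hm : m ≠ 0) (h : n = 1 ∨ Pmax m ≤ n.minFac) :
    IsSortedSplit m n := by
  intro p q hp hq hpm hqn
  rcases h with rfl | h
  · exact absurd (Nat.dvd_one.1 hqn) hq.ne_one
  · exact (hp.le_Pmax hpm hm).trans (h.trans (Nat.minFac_le_of_dvd hq.two_le hqn))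

theorem IsSortedSplit.Pmax_le_minFac {m n : ℕ} (hm : 1 < m) (h : IsSortedSplit m n) :
    n = 1 ∨ Pmax m ≤ n.minFac := by
  have hP := Pmax_mem_primeFactors hm
  exact or_iff_not_imp_left.2 fun hn => h _ _ (Nat.prime_of_mem_primeFactors hP)
    (Nat.minFac_prime hn) (Nat.dvd_of_mem_primeFactors hP) n.minFac_dvd

/-- The first factors of the sorted splits of a number form a chain under divisibility. -/
theorem IsSortedSplit.dvd_or_dvd {m n m' n' : ℕ} (hm : m ≠ 0) (h : IsSortedSplit m n)
    (h' : IsSortedSplit m' n') (heq : m * n = m' * n') : m ∣ m' ∨ m' ∣ m := by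
  obtain ⟨g, a, b, hg, hab, rfl, rfl⟩ := Nat.exists_coprime' (Nat.gcd_pos_of_pos_left m'
    (Nat.pos_of_ne_zero hm))
  have hcancel : a * n = b * n' := Nat.eq_of_mul_eq_mul_left hg (by linarith)
  by_cases ha : a = 1
  · simp [ha]
  by_cases hb : b = 1
  · simp [hb]
  obtain ⟨p, hp, hpa⟩ := Nat.exists_prime_and_dvd ha
  obtain ⟨q, hq, hqb⟩ := Nat.exists_prime_and_dvd hb
  have hpn' : p ∣ n' := hpa.trans (hab.dvd_of_dvd_mul_left (hcancel ▸ dvd_mul_right a n))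
  have hqn : q ∣ n := hqb.trans (hab.symm.dvd_of_dvd_mul_left (hcancel ▸ dvd_mul_right b n'))
  have hpq : p = q := le_antisymm (h p q hp hq (hpa.mul_right g) hqn)
    (h' q p hq hp (hqb.mul_right g) hpn')
  exact absurd hab (Nat.not_coprime_of_dvd_of_dvd hp.one_lt hpa (hpq ▸ hqb))

theorem IsSortedSplit.eq_of_dvd {T : ℝ} {m n m' n' : ℕ} (h : IsSortedSplit m n)
    (heq : m * n = m' * n') (hm : 0 < m) (hm' : 1 < m') (hT : T < m)
    (hT' : (m' : ℝ) / Pmax m' ≤ T) (hdvd : m ∣ m') : m = m' := by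
  obtain ⟨b, rfl⟩ := hdvd
  have hmem := Pmax_mem_primeFactors hm'
  have hP := Nat.prime_of_mem_primeFactors hmem
  have hbP : b < Pmax (m * b) := by
    have hlt := hT'.trans_lt hT
    rw [div_lt_iff₀ (by exact_mod_cast hP.pos)] at hlt
    exact lt_of_mul_lt_mul_left (by exact_mod_cast hlt) hm.le
  have hb0 : 0 < b := Nat.pos_of_ne_zero (by rintro rfl; simp at hm')
  by_contra hne
  have hb1 : b ≠ 1 := by rintro rfl; simp at hne
  have hn : n = b * n' := Nat.eq_of_mul_eq_mul_left hm (by rw [heq, mul_assoc])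
  refine hbP.not_ge ?_
  rcases hP.dvd_mul.1 (Nat.dvd_of_mem_primeFactors hmem) with hPm | hPb
  · exact (h _ _ hP (Nat.minFac_prime hb1) hPm
      (hn ▸ b.minFac_dvd.mul_right n')).trans (Nat.minFac_le hb0)
  · exact Nat.le_of_dvd hb0 hPb

/-- The least first factor exceeding `T` of a sorted split of `N`. -/
theorem exists_isSortedSplit {T : ℝ} {N : ℕ} (hT : 1 ≤ T) (hN : T < N) :
    ∃ m n : ℕ, N = m * n ∧ IsSortedSplit m n ∧ T < m ∧ (m : ℝ) / Pmax m ≤ T := by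
  have hex : ∃ m : ℕ, T < m ∧ ∃ n, N = m * n ∧ IsSortedSplit m n :=
    ⟨N, hN, 1, (mul_one N).symm, fun p q _ hq _ h => absurd (Nat.dvd_one.1 h) hq.ne_one⟩
  obtain ⟨hTm, n, hmn, hs⟩ := Nat.find_spec hex
  have hmin := fun k => Nat.find_min hex (m := k)
  generalize Nat.find hex = m at *
  refine ⟨m, n, hmn, hs, hTm, ?_⟩
  have hm1 : 1 < m := by exact_mod_cast hT.trans_lt hTm
  have hmem := Pmax_mem_primeFactors hm1
  have hP := Nat.prime_of_mem_primeFactors hmem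
  obtain ⟨k, hk⟩ := Nat.dvd_of_mem_primeFactors hmem
  have hk0 : 0 < k := Nat.pos_of_ne_zero (by rintro rfl; omega)
  have hkm : k < m := by
    calc k < Pmax m * k := lt_mul_of_one_lt_left hk0 hP.one_lt
      _ = m := hk.symm
  have hkT : (k : ℝ) ≤ T := by
    by_contra! hlt
    refine hmin k hkm ⟨hlt, Pmax m * n, ?_, ?_⟩
    · calc N = m * n := hmn
        _ = Pmax m * k * n := by rw [← hk]
        _ = k * (Pmax m * n) := by ring
    · intro p q hp hq hpk hqn
      have hpm : p ∣ m := hk ▸ hpk.mul_left _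
      rcases hq.dvd_mul.1 hqn with hqP | hqn
      · rw [(Nat.prime_dvd_prime_iff_eq hq hP).1 hqP]
        exact hp.le_Pmax hpm (by omega)
      · exact hs p q hp hq hpm hqn
  rw [div_le_iff₀ (by exact_mod_cast hP.pos)]
  calc (m : ℝ) = k * Pmax m := by rw [mul_comm]; exact_mod_cast hk
    _ ≤ T * Pmax m := by gcongr

/-- Unique factorization of a `y`-smooth number `N ≥ Ty` as `N = m·n` with `m`
`y`-smooth, `T < m ≤ Ty`, `m/P(m) ≤ T`, and `p(n) ≥ P(m)` (vacuous for `n = 1`);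
here `p(n) = n.minFac` is the smallest prime factor. -/
theorem smooth_factorization_unique
    (y T : ℝ) (hy : 2 ≤ y) (hT : 1 ≤ T)
    (N : ℕ) (hN : IsSmooth y N) (hNT : T * y ≤ (N : ℝ)) :
    ∃! mn : ℕ × ℕ, N = mn.1 * mn.2 ∧ 0 < mn.1 ∧ 0 < mn.2 ∧
      IsSmooth y mn.1 ∧ T < (mn.1 : ℝ) ∧ (mn.1 : ℝ) ≤ T * y ∧
      (mn.1 : ℝ) / (Pmax mn.1 : ℝ) ≤ T ∧
      (mn.2 = 1 ∨ Pmax mn.1 ≤ mn.2.minFac) := by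
  have hTN : T < N := by nlinarith
  obtain ⟨m, n, hmn, hs, hTm, hmT⟩ := exists_isSortedSplit hT hTN
  have hN0 : N ≠ 0 := by rintro rfl; norm_num at hTN; linarith
  have hm1 : 1 < m := by exact_mod_cast hT.trans_lt hTm
  have hn0 : 0 < n := Nat.pos_of_ne_zero (by rintro rfl; exact hN0 hmn)
  have hsm : IsSmooth y m := fun p hp h => hN p hp (hmn ▸ h.mul_right n)
  have hmem := Pmax_mem_primeFactors hm1
  have hP := Nat.prime_of_mem_primeFactors hmem
  refine ⟨(m, n), ⟨hmn, by omega, hn0, hsm, hTm, ?_, hmT, hs.Pmax_le_minFac hm1⟩, ?_⟩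
  · calc (m : ℝ) ≤ T * Pmax m := (div_le_iff₀ (by exact_mod_cast hP.pos)).1 hmT
      _ ≤ T * y := by
        gcongr
        exact hsm _ hP (Nat.dvd_of_mem_primeFactors hmem)
  · rintro ⟨m', n'⟩ ⟨hmn', hm'0, -, -, hTm', -, hmT', hs'⟩
    dsimp only at *
    replace hs' := isSortedSplit_of_Pmax_le_minFac hm'0.ne' hs'
    have hm'1 : 1 < m' := by exact_mod_cast hT.trans_lt hTm'
    have heq : m * n = m' * n' := hmn.symm.trans hmn'
    have hm : m = m' := by
      rcases hs.dvd_or_dvd (by omega) hs' heq with h | h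
      · exact hs.eq_of_dvd heq (by omega) hm'1 hTm hmT' h
      · exact (hs'.eq_of_dvd heq.symm hm'0 hm1 hTm' hmT h).symm
    subst hm
    rw [Nat.eq_of_mul_eq_mul_left hm'0 heq]
end
end
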